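/- arXiv:1301.3421 — 2 statements merged into one kernel-verified Lean document; each statement's English description precedes it below -/
import Mathlib

section
/- Let V be a complex inner product space of dimension M, where M ∈ {7, 9, 11}, with a fixed orthonormal basis e_1, …, e_M. Let W ⊆ ⋀³V be the complex subspace spanned by all BSOVs e_{ijk} except the M-1 of them with index triples (1,4,M), (2,5,M), and (i, i+2, M) for 1 ≤ i ≤ M-3. Then W is universal and dim W = M(M-1)(M-5)/6. -/
open ExteriorAlgebra Finset

noncomputable section

/-- The single-particle Hilbert space: `ℂ^M` with its standard inner product. -/
abbrev V (M : ℕ) : Type := EuclideanSpace ℂ (Fin M)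

/-- The fixed orthonormal basis vector `e_n` (1-indexed, `1 ≤ n ≤ M`);
out-of-range indices give `0`. -/
def stdVec (M n : ℕ) : V M :=
  if h : 1 ≤ n ∧ n ≤ M then EuclideanSpace.single (⟨n - 1, by omega⟩ : Fin M) 1 else 0

/-- The wedge `e_{i 0} ∧ ⋯ ∧ e_{i (N-1)}` in the exterior algebra of `V M`. -/
def wedge (M N : ℕ) (i : Fin N → ℕ) : ExteriorAlgebra ℂ (V M) :=
  ExteriorAlgebra.ιMulti ℂ N fun j => stdVec M (i j)

/-- `i` enumerates a strictly increasing sequence of indices in `{1, …, M}`. -/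
def IsBasisIndex (M N : ℕ) (i : Fin N → ℕ) : Prop :=
  StrictMono i ∧ ∀ j, 1 ≤ i j ∧ i j ≤ M

/-- Single occupancy: no two of the indices lie in the same standard pair
`{2k-1, 2k}` (the pair of `n` is `(n+1)/2`). -/
def SingleOcc (N : ℕ) (i : Fin N → ℕ) : Prop :=
  ∀ j k : Fin N, j ≠ k → (i j + 1) / 2 ≠ (i k + 1) / 2

/-- The single occupancy subspace `𝒮 ⊆ ⋀^N V`: the span of all basic single
occupancy vectors. -/
def SOV (M N : ℕ) : Submodule ℂ (ExteriorAlgebra ℂ (V M)) :=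
  Submodule.span ℂ
    {x | ∃ i : Fin N → ℕ, IsBasisIndex M N i ∧ SingleOcc N i ∧ x = wedge M N i}

/-- The exterior power of a unitary operator `U` on `V M`, acting on the whole
exterior algebra (on `⋀^N V` it acts as `⋀^N U`). -/
def luMap (M : ℕ) (U : V M ≃ₗᵢ[ℂ] V M) :
    ExteriorAlgebra ℂ (V M) →ₐ[ℂ] ExteriorAlgebra ℂ (V M) :=
  ExteriorAlgebra.map U.toLinearEquiv.toLinearMap

/-- The commutation relations between the operators of equivariant exterior calculus:
multiplication `M` by functions, partial derivatives `P`, exterior multiplication `e`, interior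
multiplication `k`, and multiplication `x` by the polynomial variables. -/
structure DeRhamOps (A R τ K : Type*) [CommRing A] [Algebra ℂ A] [Ring R] [Algebra ℂ R]
    [DecidableEq τ] (pd : τ → Derivation ℂ A A) where
  M : A →ₐ[ℂ] R
  P : τ → R
  e : τ → R
  k : τ → R
  x : K → R
  P_M : ∀ t u, P t * M u = M u * P t + M (pd t u)
  P_P : ∀ s t, P s * P t = P t * P s
  P_e : ∀ s t, e s * P t = P t * e s
  P_k : ∀ s t, k s * P t = P t * k s
  P_x : ∀ i t, x i * P t = P t * x i
  M_e : ∀ s u, e s * M u = M u * e s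
  M_k : ∀ s u, k s * M u = M u * k s
  M_x : ∀ i u, x i * M u = M u * x i
  x_e : ∀ i s, x i * e s = e s * x i
  x_k : ∀ i s, x i * k s = k s * x i
  x_x : ∀ i j, x i * x j = x j * x i
  e_e : ∀ s t, e s * e t = - (e t * e s)
  k_e : ∀ s t, k s * e t = (if s = t then 1 else 0) - e t * k s

namespace DeRhamOps

variable {A R τ K : Type*} [CommRing A] [Algebra ℂ A] [Ring R] [Algebra ℂ R]
    [DecidableEq τ] {pd : τ → Derivation ℂ A A}
    (O : DeRhamOps A R τ K pd)

section

variable [Fintype τ]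

/-- The exterior derivative. -/
def d : R := ∑ t, O.P t * O.e t

/-- The differential of a function, acting by left multiplication. -/
def df (u : A) : R := ∑ t, O.M (pd t u) * O.e t

/-- Contraction with a vector field. -/
def contr (ξ : τ → A) : R := ∑ t, O.M (ξ t) * O.k t

lemma eq_zero_of_eq_neg {a : R} (h : a = -a) : a = 0 := by
  have h2 : (2 : ℂ) • a = 0 := by
    rw [two_smul]; nth_rewrite 2 [h]; simp
  simpa using (smul_eq_zero_iff_right (two_ne_zero (α := ℂ))).1 h2

lemma d_mul_M (u : A) : O.d * O.M u = O.M u * O.d + O.df u := by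
  simp only [d, df, Finset.sum_mul, Finset.mul_sum, ← Finset.sum_add_distrib]
  refine Finset.sum_congr rfl fun t _ => ?_
  rw [mul_assoc, O.M_e, ← mul_assoc, O.P_M, add_mul, mul_assoc]

lemma df_mul_M (u v : A) : O.df u * O.M v = O.M v * O.df u := by
  simp only [df, Finset.sum_mul, Finset.mul_sum]
  refine Finset.sum_congr rfl fun t _ => ?_
  rw [mul_assoc, O.M_e, ← mul_assoc, ← mul_assoc, ← map_mul, ← map_mul, mul_comm]

lemma contr_mul_M (ξ : τ → A) (v : A) : O.contr ξ * O.M v = O.M v * O.contr ξ := by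
  simp only [contr, Finset.sum_mul, Finset.mul_sum]
  refine Finset.sum_congr rfl fun t _ => ?_
  rw [mul_assoc, O.M_k, ← mul_assoc, ← mul_assoc, ← map_mul, ← map_mul, mul_comm]

lemma d_mul_d : O.d * O.d = 0 := by
  apply eq_zero_of_eq_neg
  simp only [d, Finset.sum_mul, Finset.mul_sum]
  conv_lhs => rw [Finset.sum_comm]
  simp only [← Finset.sum_neg_distrib]
  refine Finset.sum_congr rfl fun t _ => Finset.sum_congr rfl fun s _ => ?_
  calc O.P t * O.e t * (O.P s * O.e s) = O.P t * (O.e t * O.P s) * O.e s := by noncomm_ring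
    _ = (O.P t * O.P s) * (O.e t * O.e s) := by rw [O.P_e]; noncomm_ring
    _ = - (O.P s * (O.P t * O.e s) * O.e t) := by rw [O.P_P, O.e_e]; noncomm_ring
    _ = _ := by rw [← O.P_e]; noncomm_ring

lemma df_eq (u : A) : O.df u = O.d * O.M u - O.M u * O.d := by rw [d_mul_M]; abel

lemma d_mul_df (u : A) : O.d * O.df u = - (O.df u * O.d) := by
  have h := O.d_mul_d
  have h1 : O.d * (O.d * O.M u) = 0 := by rw [← mul_assoc, h, zero_mul]
  have h2 : O.M u * O.d * O.d = 0 := by rw [mul_assoc, h, mul_zero]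
  rw [df_eq, mul_sub, sub_mul, h1, h2, mul_assoc]
  abel

lemma df_mul (u v : A) : O.df (u * v) = O.M u * O.df v + O.M v * O.df u := by
  simp only [df, Finset.mul_sum, ← Finset.sum_add_distrib]
  refine Finset.sum_congr rfl fun t _ => ?_
  simp [add_mul, mul_assoc]

lemma contr_mul_df (ξ : τ → A) (u : A) :
    O.contr ξ * O.df u = O.M (∑ t, ξ t * pd t u) - O.df u * O.contr ξ := by
  rw [eq_sub_iff_add_eq]
  simp only [contr, df, Finset.sum_mul, Finset.mul_sum, map_sum]
  rw [Finset.sum_comm]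
  simp only [← Finset.sum_add_distrib]
  refine Finset.sum_congr rfl fun t _ => ?_
  have : ∀ s, O.M (ξ t) * O.k t * (O.M (pd s u) * O.e s) +
      O.M (pd s u) * O.e s * (O.M (ξ t) * O.k t) = if t = s then O.M (ξ t * pd s u) else 0 := by
    intro s
    calc _ = O.M (ξ t) * (O.k t * O.M (pd s u)) * O.e s
          + O.M (pd s u) * (O.e s * O.M (ξ t)) * O.k t := by noncomm_ring
      _ = (O.M (ξ t) * O.M (pd s u)) * (O.k t * O.e s) +
          (O.M (pd s u) * O.M (ξ t)) * (O.e s * O.k t) := by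
            rw [O.M_k, O.M_e]; noncomm_ring
      _ = _ := by
        rw [← map_mul, ← map_mul, mul_comm (pd s u), ← mul_add, O.k_e]
        split_ifs <;> simp
  simp [this]

lemma x_mul_df (i : K) (u : A) : O.x i * O.df u = O.df u * O.x i := by
  simp only [df, Finset.sum_mul, Finset.mul_sum]
  refine Finset.sum_congr rfl fun t _ => ?_
  rw [← mul_assoc, O.M_x, mul_assoc, O.x_e, mul_assoc]

lemma x_mul_contr (i : K) (ξ : τ → A) : O.x i * O.contr ξ = O.contr ξ * O.x i := by
  simp only [contr, Finset.sum_mul, Finset.mul_sum]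
  refine Finset.sum_congr rfl fun t _ => ?_
  rw [← mul_assoc, O.M_x, mul_assoc, O.x_k, mul_assoc]

lemma x_mul_d (i : K) : O.x i * O.d = O.d * O.x i := by
  simp only [d, Finset.sum_mul, Finset.mul_sum]
  refine Finset.sum_congr rfl fun t _ => ?_
  rw [← mul_assoc, O.P_x, mul_assoc, O.x_e, mul_assoc]

variable [Fintype K]

/-- The equivariant differential. -/
def D (ξ : K → τ → A) : R := O.d + ∑ i, O.x i * O.contr (ξ i)

/-- A weight as an operator. -/
def wt (χ : K → ℂ) : R := ∑ i, χ i • O.x i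

lemma x_mul_D (ξ : K → τ → A) (i : K) : O.x i * O.D ξ = O.D ξ * O.x i := by
  simp only [D, Finset.sum_mul, Finset.mul_sum, mul_add, add_mul, x_mul_d]
  congr 1
  refine Finset.sum_congr rfl fun t _ => ?_
  rw [← mul_assoc, O.x_x, mul_assoc, O.x_mul_contr, mul_assoc]

lemma D_mul_wt (ξ : K → τ → A) (χ : K → ℂ) : O.D ξ * O.wt χ = O.wt χ * O.D ξ := by
  simp [wt, Finset.sum_mul, Finset.mul_sum, x_mul_D]

lemma D_mul_M (ξ : K → τ → A) (u : A) : O.D ξ * O.M u = O.M u * O.D ξ + O.df u := by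
  simp only [D, add_mul, mul_add, d_mul_M, Finset.sum_mul, Finset.mul_sum]
  rw [add_right_comm]
  congr 2
  refine Finset.sum_congr rfl fun t _ => ?_
  rw [mul_assoc, contr_mul_M, ← mul_assoc, O.M_x, mul_assoc]

lemma D_mul_df (ξ : K → τ → A) (u : A) (χ : K → ℂ)
    (h : ∀ i, ∑ t, ξ i t * pd t u = χ i • u) :
    O.D ξ * O.df u = - (O.df u * O.D ξ) + O.M u * O.wt χ := by
  have : ∀ i, O.x i * O.contr (ξ i) * O.df u =
      O.M u * (χ i • O.x i) - O.df u * (O.x i * O.contr (ξ i)) := by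
    intro i
    rw [mul_assoc, contr_mul_df, h, mul_sub, ← mul_assoc, x_mul_df, mul_assoc, O.M_x]
    congr 1
    rw [map_smul, smul_mul_assoc, mul_smul_comm]
  simp only [D, add_mul, mul_add, d_mul_df, Finset.sum_mul, this, Finset.sum_sub_distrib, wt,
    Finset.mul_sum]
  abel

/-- The deformed weight, homotopic to the weight `χ` by means of the functions `F` and `f`. -/
def deformedWt (χ : K → ℂ) (F f : A) : R :=
  (1 + O.M (f * F)) * O.wt χ + O.df f * O.df F

lemma anticomm (ξ : K → τ → A) (χ : K → ℂ) (F f : A)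
    (hF : ∀ i, ∑ t, ξ i t * pd t F = χ i • F) :
    O.D ξ * (O.M f * O.df F) + O.M f * O.df F * O.D ξ = O.deformedWt χ F f - O.wt χ := by
  rw [← mul_assoc, D_mul_M, add_mul, mul_assoc, D_mul_df _ _ _ _ hF, deformedWt, map_mul]
  noncomm_ring

lemma D_mul_deformedWt (ξ : K → τ → A) (χ : K → ℂ) (F f : A)
    (hF : ∀ i, ∑ t, ξ i t * pd t F = χ i • F)
    (hf : ∀ i, ∑ t, ξ i t * pd t f = -χ i • f) :
    O.D ξ * O.deformedWt χ F f = O.deformedWt χ F f * O.D ξ := by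
  have hw : O.wt (fun i => -χ i) = - O.wt χ := by simp [wt]
  have h1 : O.D ξ * ((1 + O.M (f * F)) * O.wt χ) =
    (1 + O.M (f * F)) * O.wt χ * O.D ξ + O.df (f * F) * O.wt χ := by
    rw [← mul_assoc, mul_add, mul_one, D_mul_M, mul_assoc, ← D_mul_wt]
    noncomm_ring
  have h2 : O.D ξ * (O.df f * O.df F) = O.df f * O.df F * O.D ξ - O.df (f * F) * O.wt χ := by
    have hc : O.wt χ * O.df F = O.df F * O.wt χ := by
      simp [wt, Finset.sum_mul, Finset.mul_sum, O.x_mul_df]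
    rw [← mul_assoc, D_mul_df _ _ _ (fun i => -χ i) hf, hw, add_mul, neg_mul, mul_assoc,
      D_mul_df _ _ _ _ hF, df_mul, mul_neg, mul_assoc, neg_mul, mul_assoc (O.M f), hc, mul_add,
      ← mul_assoc (O.df f) (O.M F), O.df_mul_M]
    noncomm_ring
  rw [deformedWt, mul_add, h1, h2]
  noncomm_ring

end

end DeRhamOps

namespace DeRhamOps

variable {A H τ K J : Type*} [CommRing A] [Algebra ℂ A] [AddCommGroup H] [Module ℂ H]
    [DecidableEq τ] [Fintype τ] [Fintype K] {pd : τ → Derivation ℂ A A}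

lemma prod_deformedWt_apply (O : DeRhamOps A (Module.End ℂ H) τ K pd) (ξ : K → τ → A) (v : H)
    (hv : O.D ξ v = 0) (χ : J → K → ℂ) (F f : J → A)
    (hF : ∀ j i, ∑ t, ξ i t * pd t (F j) = χ j i • F j)
    (hf : ∀ j i, ∑ t, ξ i t * pd t (f j) = -χ j i • f j) (l : List J) :
    O.D ξ ((l.map fun j => O.deformedWt (χ j) (F j) (f j)).prod v) = 0 ∧
    ∃ γ, (l.map fun j => O.deformedWt (χ j) (F j) (f j)).prod v =
      (l.map fun j => O.wt (χ j)).prod v + O.D ξ γ := by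
  induction l with
  | nil => exact ⟨by simpa using hv, 0, by simp⟩
  | cons j l ih =>
    obtain ⟨h0, γ, hγ⟩ := ih
    simp only [List.map_cons, List.prod_cons, Module.End.mul_apply]
    set y := (l.map fun j => O.deformedWt (χ j) (F j) (f j)).prod v
    constructor
    · rw [← Module.End.mul_apply, O.D_mul_deformedWt ξ (χ j) (F j) (f j) (hF j) (hf j),
        Module.End.mul_apply, h0, map_zero]
    · have h1 := congrArg (fun T : Module.End ℂ H => T y)
        (O.anticomm ξ (χ j) (F j) (f j) (hF j))
      have h2 := congrArg (fun T : Module.End ℂ H => T γ) (O.D_mul_wt ξ (χ j))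
      simp only [LinearMap.add_apply, LinearMap.sub_apply, Module.End.mul_apply, h0,
        map_zero, add_zero] at h1 h2
      refine ⟨O.wt (χ j) γ + O.M (f j) (O.df (F j) y), ?_⟩
      have h3 := congrArg (O.wt (χ j)) hγ
      rw [map_add] at h3
      rw [map_add, h1, h2, h3]
      abel

end DeRhamOps

section TopFunctional

open CliffordAlgebra

variable (B : Type*) [CommRing B] {S T : Type*}

/-- The exterior algebra on generators `dx_s, dy_s`. -/
abbrev Forms (T : Type*) := ExteriorAlgebra B (T → B)

variable [DecidableEq T]

variable {B} in
/-- Exterior multiplication by a generator. -/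
def extMul (t : T) : Module.End B (Forms B T) :=
  LinearMap.mulLeft B (ExteriorAlgebra.ι B (Pi.single t 1))

variable {B} in
/-- Contraction by a dual generator. -/
def intMul (t : T) : Module.End B (Forms B T) :=
  contractLeft (Q := (0 : QuadraticForm B (T → B))) (LinearMap.proj t : (T → B) →ₗ[B] B)

lemma extMul_extMul (s t : T) :
    (extMul s * extMul t : Module.End B (Forms B T)) = -(extMul t * extMul s) := by
  refine LinearMap.ext fun x => ?_
  have h := ExteriorAlgebra.ι_add_mul_swap (R := B) (Pi.single s 1 : T → B) (Pi.single t 1)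
  simp only [extMul, Module.End.mul_apply, LinearMap.mulLeft_apply, LinearMap.neg_apply,
    ← mul_assoc]
  rw [eq_neg_of_add_eq_zero_left h, neg_mul]

lemma intMul_extMul (s t : T) :
    (intMul s * extMul t : Module.End B (Forms B T)) =
      (if s = t then 1 else 0) - extMul t * intMul s := by
  refine LinearMap.ext fun x => ?_
  simp only [extMul, intMul, Module.End.mul_apply, LinearMap.mulLeft_apply, LinearMap.sub_apply]
  erw [contractLeft_ι_mul]
  split_ifs with h
  · subst h; simp
  · simp [h]

variable [Algebra ℂ B] [Fintype S]

/-- The alternating form used to identify `dx, dy` with interior products. -/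
def pairForm : LinearMap.BilinForm B (S × Bool → B) :=
  ∑ s : S, (algebraMap ℂ B (Complex.I / 2)) •
    ((LinearMap.proj (R := B) (φ := fun _ : S × Bool => B) (s, false)).smulRight
        (LinearMap.proj (R := B) (φ := fun _ : S × Bool => B) (s, true)) -
      (LinearMap.proj (R := B) (φ := fun _ : S × Bool => B) (s, true)).smulRight
        (LinearMap.proj (R := B) (φ := fun _ : S × Bool => B) (s, false)))

lemma pairForm_toQuadraticMap :
    (pairForm B (S := S)).toQuadraticMap = (0 : QuadraticForm B (S × Bool → B)) - 0 := by
  ext v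
  simp [pairForm, mul_comm]

lemma pairForm_single_false [DecidableEq S] (s : S) : pairForm B (Pi.single (s, false) 1) =
    algebraMap ℂ B (Complex.I / 2) • LinearMap.proj (s, true) := by
  ext v
  simp [pairForm, Pi.single_apply]

lemma pairForm_single_true [DecidableEq S] (s : S) : pairForm B (Pi.single (s, true) 1) =
    - algebraMap ℂ B (Complex.I / 2) • LinearMap.proj (s, false) := by
  ext v
  simp [pairForm, Pi.single_apply]

/-- The scalar part after changing the quadratic form by `pairForm`. -/
def topForm : Forms B (S × Bool) →ₗ[B] B :=
  (ExteriorAlgebra.algebraMapInv (R := B) (M := S × Bool → B)).toLinearMap ∘ₗ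
    changeForm (pairForm_toQuadraticMap B)

lemma topForm_algebraMap (b : B) :
    topForm B (algebraMap B (Forms B (S × Bool)) b) = b := by
  simp only [topForm, LinearMap.comp_apply, AlgHom.toLinearMap_apply]
  erw [changeForm_algebraMap]
  exact ExteriorAlgebra.algebraMap_leftInverse _ b

lemma topForm_ι_mul (m : S × Bool → B) (q : Forms B (S × Bool)) :
    topForm B (ExteriorAlgebra.ι B m * q) = - topForm B
      (contractLeft (Q := (0 : QuadraticForm B (S × Bool → B))) (pairForm B m) q) := by
  simp only [topForm, LinearMap.comp_apply, AlgHom.toLinearMap_apply]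
  rw [changeForm_contractLeft]
  erw [changeForm_ι_mul]
  rw [map_sub, map_mul]
  have : ExteriorAlgebra.algebraMapInv (ExteriorAlgebra.ι B m) = 0 := by
    simp [ExteriorAlgebra.algebraMapInv]
  erw [this, zero_mul, zero_sub]

lemma topForm_extMul_false [DecidableEq S] (s : S) (q : Forms B (S × Bool)) :
    topForm B (extMul (s, false) q) =
      - algebraMap ℂ B (Complex.I / 2) * topForm B (intMul (s, true) q) := by
  rw [extMul, LinearMap.mulLeft_apply, topForm_ι_mul, pairForm_single_false, map_smul,
    LinearMap.smul_apply, map_smul, smul_eq_mul, neg_mul]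
  rfl

lemma topForm_extMul_true [DecidableEq S] (s : S) (q : Forms B (S × Bool)) :
    topForm B (extMul (s, true) q) =
      algebraMap ℂ B (Complex.I / 2) * topForm B (intMul (s, false) q) := by
  rw [extMul, LinearMap.mulLeft_apply, topForm_ι_mul, pairForm_single_true, map_smul,
    LinearMap.smul_apply, map_smul, smul_eq_mul, neg_mul, neg_neg]
  rfl

end TopFunctional

section TensorModel

open TensorProduct

variable {A τ K : Type*} [CommRing A] [Algebra ℂ A]

/-- Equivariant forms with coefficients in `A`. -/
abbrev EquivForms (A τ K : Type*) [CommRing A] [Algebra ℂ A] : Type _ :=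
  A ⊗[ℂ] Forms (MvPolynomial K ℂ) τ

/-- An operator on forms, extended to equivariant forms. -/
def formOp (T : Module.End (MvPolynomial K ℂ) (Forms (MvPolynomial K ℂ) τ)) :
    Module.End ℂ (EquivForms A τ K) :=
  LinearMap.lTensor A (T.restrictScalars ℂ)

/-- An operator on coefficients, extended to equivariant forms. -/
def coeffOp (T : Module.End ℂ A) : Module.End ℂ (EquivForms A τ K) :=
  LinearMap.rTensor _ T

lemma formOp_mul (T T' : Module.End (MvPolynomial K ℂ) (Forms (MvPolynomial K ℂ) τ)) :
    (formOp (T * T') : Module.End ℂ (EquivForms A τ K)) = formOp T * formOp T' :=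
  TensorProduct.ext' fun _ _ => rfl

lemma formOp_neg (T : Module.End (MvPolynomial K ℂ) (Forms (MvPolynomial K ℂ) τ)) :
    formOp (A := A) (-T) = -(formOp (A := A) T) :=
  TensorProduct.ext' fun a q => tmul_neg a (T q)

lemma formOp_sub (T T' : Module.End (MvPolynomial K ℂ) (Forms (MvPolynomial K ℂ) τ)) :
    (formOp (T - T') : Module.End ℂ (EquivForms A τ K)) = formOp T - formOp T' :=
  TensorProduct.ext' fun a q => tmul_sub a (T q) (T' q)

lemma formOp_mul_coeffOp (T : Module.End (MvPolynomial K ℂ) (Forms (MvPolynomial K ℂ) τ))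
    (S : Module.End ℂ A) :
    (formOp T * coeffOp S : Module.End ℂ (EquivForms A τ K)) = coeffOp S * formOp T :=
  TensorProduct.ext' fun _ _ => rfl

/-- Multiplication by a polynomial generator. -/
def varMul (i : K) : Module.End (MvPolynomial K ℂ) (Forms (MvPolynomial K ℂ) τ) :=
  LinearMap.lsmul (MvPolynomial K ℂ) _ (MvPolynomial.X i)

lemma varMul_mul (i : K) (T : Module.End (MvPolynomial K ℂ) (Forms (MvPolynomial K ℂ) τ)) :
    varMul i * T = T * varMul i := by
  refine LinearMap.ext fun x => ?_
  simp [varMul, Module.End.mul_apply]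

variable [DecidableEq τ]

/-- The operators of equivariant exterior calculus on `EquivForms A τ K`. -/
def tensorOps (pd : τ → Derivation ℂ A A) (hpd : ∀ s t u, pd s (pd t u) = pd t (pd s u)) :
    DeRhamOps A (Module.End ℂ (EquivForms A τ K)) τ K pd where
  M := (Module.End.rTensorAlgHom ℂ A _).comp (Algebra.lmul ℂ A)
  P t := coeffOp (pd t).toLinearMap
  e t := formOp (extMul t)
  k t := formOp (intMul t)
  x i := formOp (varMul i)
  P_M t u := TensorProduct.ext' fun a q => by
    change (pd t (u * a)) ⊗ₜ[ℂ] q = (u * pd t a) ⊗ₜ[ℂ] q + (pd t u * a) ⊗ₜ[ℂ] q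
    rw [Derivation.leibniz, smul_eq_mul, smul_eq_mul, mul_comm a, add_tmul]
  P_P s t := TensorProduct.ext' fun a q => congrArg (· ⊗ₜ[ℂ] q) (hpd s t a)
  P_e _ _ := formOp_mul_coeffOp _ _
  P_k _ _ := formOp_mul_coeffOp _ _
  P_x _ _ := formOp_mul_coeffOp _ _
  M_e _ _ := formOp_mul_coeffOp _ _
  M_k _ _ := formOp_mul_coeffOp _ _
  M_x _ _ := formOp_mul_coeffOp _ _
  x_e _ _ := by rw [← formOp_mul, ← formOp_mul, varMul_mul]
  x_k _ _ := by rw [← formOp_mul, ← formOp_mul, varMul_mul]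
  x_x _ _ := by rw [← formOp_mul, ← formOp_mul, varMul_mul]
  e_e _ _ := by rw [← formOp_mul, ← formOp_mul, extMul_extMul, formOp_neg]
  k_e s t := by
    rw [← formOp_mul, ← formOp_mul, intMul_extMul, formOp_sub]
    congr 1
    split_ifs
    · exact TensorProduct.ext' fun _ _ => rfl
    · exact TensorProduct.ext' fun a _ => tmul_zero _ a

end TensorModel

section SmoothFunctions

open scoped ContDiff

variable (X : Type*) [NormedAddCommGroup X] [NormedSpace ℝ X]

/-- The algebra of smooth complex-valued functions on `X`. -/
def smoothFun : Subalgebra ℂ (X → ℂ) where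
  carrier := {f | ContDiff ℝ ∞ f}
  mul_mem' {f g} hf hg := by
    have hf' : ContDiff ℝ ∞ f := hf
    have hg' : ContDiff ℝ ∞ g := hg
    exact hf'.mul hg'
  add_mem' {f g} hf hg := by
    have hf' : ContDiff ℝ ∞ f := hf
    have hg' : ContDiff ℝ ∞ g := hg
    exact hf'.add hg'
  algebraMap_mem' c := (contDiff_const : ContDiff ℝ ∞ fun _ : X => c)

variable {X}

lemma smoothFun.contDiff (f : smoothFun X) : ContDiff ℝ ∞ f.1 := f.2

lemma smoothFun.differentiable (f : smoothFun X) : Differentiable ℝ f.1 :=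
  (smoothFun.contDiff f).differentiable (by simp)

lemma contDiff_fderiv_apply_vec {f : X → ℂ} (hf : ContDiff ℝ ∞ f) (v : X) :
    ContDiff ℝ ∞ fun a => fderiv ℝ f a v :=
  (hf.fderiv_right (m := ∞) (by norm_cast)).clm_apply contDiff_const

/-- The directional derivative as a derivation. -/
def dirDeriv (v : X) : Derivation ℂ (smoothFun X) (smoothFun X) :=
  Derivation.mk'
    { toFun f := ⟨fun a => fderiv ℝ f.1 a v, contDiff_fderiv_apply_vec f.2 v⟩
      map_add' f g := by
        ext a
        have hf : DifferentiableAt ℝ f.1 a := (smoothFun.differentiable f) a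
        have hg : DifferentiableAt ℝ g.1 a := (smoothFun.differentiable g) a
        change fderiv ℝ (f.1 + g.1) a v = fderiv ℝ f.1 a v + fderiv ℝ g.1 a v
        rw [fderiv_add hf hg]; rfl
      map_smul' c f := by
        ext a
        have hf : DifferentiableAt ℝ f.1 a := (smoothFun.differentiable f) a
        change fderiv ℝ (c • f.1) a v = c • fderiv ℝ f.1 a v
        rw [fderiv_const_smul hf]; rfl }
    fun f g => by
      ext a
      have hf : DifferentiableAt ℝ f.1 a := (smoothFun.differentiable f) a
      have hg : DifferentiableAt ℝ g.1 a := (smoothFun.differentiable g) a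
      change fderiv ℝ (f.1 * g.1) a v = f.1 a * fderiv ℝ g.1 a v + g.1 a * fderiv ℝ f.1 a v
      rw [fderiv_mul hf hg]; rfl

lemma dirDeriv_apply (v : X) (f : smoothFun X) (a : X) :
    (dirDeriv v f).1 a = fderiv ℝ f.1 a v := rfl

lemma dirDeriv_comm (v w : X) (f : smoothFun X) :
    dirDeriv v (dirDeriv w f) = dirDeriv w (dirDeriv v f) := by
  ext a
  have h2 : ContDiff ℝ ∞ (fderiv ℝ f.1) :=
    (smoothFun.contDiff f).fderiv_right (m := ∞) (by norm_cast)
  have key : ∀ v w : X, (dirDeriv v (dirDeriv w f)).1 a = fderiv ℝ (fderiv ℝ f.1) a v w := by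
    intro v w
    change fderiv ℝ (fun a => fderiv ℝ f.1 a w) a v = _
    rw [fderiv_clm_apply (h2.differentiable (by simp) a) (differentiableAt_const w)]
    simp
  rw [key, key]
  have hs : IsSymmSndFDerivAt ℝ f.1 a :=
    (smoothFun.contDiff f).contDiffAt.isSymmSndFDerivAt (by simp; norm_cast)
  exact hs v w

end SmoothFunctions

section ShellIntegral

open scoped ContDiff

/-- A smooth function of a real variable supported in `[1/2, 2]`. -/
def IsCutoff (g : ℝ → ℝ) : Prop := ContDiff ℝ ∞ g ∧ tsupport g ⊆ Set.Icc (1 / 2) 2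

lemma IsCutoff.deriv {g : ℝ → ℝ} (hg : IsCutoff g) : IsCutoff (deriv g) :=
  ⟨(contDiff_infty_iff_deriv.1 hg.1).2, (tsupport_deriv_subset (f := g)).trans hg.2⟩

lemma IsCutoff.iterate_deriv {g : ℝ → ℝ} (hg : IsCutoff g) (n : ℕ) :
    IsCutoff (_root_.deriv^[n] g) := by
  induction n with
  | zero => exact hg
  | succ n ih => rw [Function.iterate_succ_apply']; exact ih.deriv

lemma IsCutoff.eq_zero {g : ℝ → ℝ} (hg : IsCutoff g) {t : ℝ} (ht : t ∉ Set.Icc (1 / 2 : ℝ) 2) :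
    g t = 0 :=
  image_eq_zero_of_notMem_tsupport fun h => ht (hg.2 h)

variable (K ι : Type*) [Fintype K] [Fintype ι]

/-- Tuples of complex vectors in real coordinates. -/
abbrev Blocks : Type _ := K → EuclideanSpace ℝ (ι × Bool)

/-- Tuples of vectors with norms in the given range. -/
def shell : Set (Blocks K ι) := {a | ∀ i, ‖a i‖ ^ 2 ∈ Set.Icc (1 / 2 : ℝ) 2}

lemma isCompact_shell : IsCompact (shell K ι) := by
  refine Metric.isCompact_of_isClosed_isBounded ?_ ?_
  · have : shell K ι = ⋂ i, {a | ‖a i‖ ^ 2 ∈ Set.Icc (1 / 2 : ℝ) 2} := by ext; simp [shell]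
    rw [this]
    exact isClosed_iInter fun i => isClosed_Icc.preimage (by fun_prop)
  · refine (Metric.isBounded_closedBall (x := (0 : Blocks K ι)) (r := 2)).subset fun a ha => ?_
    rw [mem_closedBall_zero_iff, pi_norm_le_iff_of_nonneg (by norm_num)]
    intro i
    have := (ha i).2
    nlinarith [norm_nonneg (a i)]

variable {K ι}

/-- Substitute derivatives of `g` evaluated at squared norms for powers of variables. -/
def evPoly (g : ℝ → ℝ) : MvPolynomial K ℂ →ₗ[ℂ] (Blocks K ι → ℂ) :=
  (MvPolynomial.basisMonomials K ℂ).constr ℂ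
    fun p a => ∏ i, ((deriv^[p i] g (‖a i‖ ^ 2) : ℝ) : ℂ)

lemma evPoly_monomial (g : ℝ → ℝ) (p : K →₀ ℕ) :
    evPoly g (MvPolynomial.monomial p 1) =
      fun a : Blocks K ι => ∏ i, ((deriv^[p i] g (‖a i‖ ^ 2) : ℝ) : ℂ) := by
  have h : MvPolynomial.monomial p (1 : ℂ) = MvPolynomial.basisMonomials K ℂ p := by simp
  rw [evPoly, h, Module.Basis.constr_basis]

omit [Fintype K] in
lemma evPoly_induction {motive : MvPolynomial K ℂ → Prop}
    (hm : ∀ p, motive (MvPolynomial.monomial p 1))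
    (hadd : ∀ p q, motive p → motive q → motive (p + q))
    (hsmul : ∀ (c : ℂ) p, motive p → motive (c • p)) (p : MvPolynomial K ℂ) : motive p := by
  induction p using MvPolynomial.monomial_add_induction_on with
  | C a => simpa [MvPolynomial.smul_eq_C_mul] using hsmul a _ (hm 0)
  | monomial_add a b f _ _ ih =>
    refine hadd _ _ ?_ ih
    simpa [MvPolynomial.smul_monomial] using hsmul b _ (hm a)

lemma contDiff_evPoly {g : ℝ → ℝ} (hg : IsCutoff g) (p : MvPolynomial K ℂ) :
    ContDiff ℝ ∞ (evPoly g p : Blocks K ι → ℂ) := by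
  induction p using evPoly_induction with
  | hm p =>
    rw [evPoly_monomial]
    refine contDiff_prod fun i _ => ?_
    refine Complex.ofRealCLM.contDiff.comp ((hg.iterate_deriv (p i)).1.comp ?_)
    exact (contDiff_norm_sq ℝ).comp (contDiff_apply ℝ _ i)
  | hadd p q hp hq => rw [map_add]; exact hp.add hq
  | hsmul c p hp => rw [map_smul]; exact hp.const_smul c

lemma evPoly_eq_zero {g : ℝ → ℝ} (hg : IsCutoff g) (p : MvPolynomial K ℂ) {a : Blocks K ι}
    (ha : a ∉ shell K ι) : evPoly g p a = 0 := by
  induction p using evPoly_induction with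
  | hm p =>
    rw [evPoly_monomial]
    simp only [shell, Set.mem_ofPred_eq, not_forall] at ha
    obtain ⟨i, hi⟩ := ha
    refine Finset.prod_eq_zero (Finset.mem_univ i) ?_
    rw [(hg.iterate_deriv (p i)).eq_zero hi, Complex.ofReal_zero]
  | hadd p q hp hq => simp [hp, hq]
  | hsmul c p hp => simp [hp]

lemma hasCompactSupport_evPoly {g : ℝ → ℝ} (hg : IsCutoff g) (p : MvPolynomial K ℂ) :
    HasCompactSupport (evPoly g p : Blocks K ι → ℂ) :=
  HasCompactSupport.intro (isCompact_shell K ι) fun _ ha => evPoly_eq_zero hg p ha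

variable [DecidableEq K] [DecidableEq ι]

/-- The coordinate directions. -/
def basisVec (t : (K × ι) × Bool) : Blocks K ι :=
  Pi.single t.1.1 (EuclideanSpace.single (t.1.2, t.2) 1)

lemma fderiv_evPoly {g : ℝ → ℝ} (hg : IsCutoff g) (p : MvPolynomial K ℂ) (a : Blocks K ι)
    (t : (K × ι) × Bool) : fderiv ℝ (evPoly g p) a (basisVec t) =
      2 * (a t.1.1 (t.1.2, t.2) : ℂ) * evPoly g (MvPolynomial.X t.1.1 * p) a := by
  induction p using evPoly_induction with
  | hm p =>
    have h1 : ∀ i, HasFDerivAt (fun a : Blocks K ι => ((deriv^[p i] g (‖a i‖ ^ 2) : ℝ) : ℂ))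
        (Complex.ofRealCLM.comp ((deriv^[p i + 1] g (‖a i‖ ^ 2)) •
          ((2 • innerSL ℝ (a i)).comp (ContinuousLinearMap.proj i)))) a := by
      intro i
      refine Complex.ofRealCLM.hasFDerivAt.comp a ?_
      have hd : HasDerivAt (deriv^[p i] g) (deriv^[p i + 1] g (‖a i‖ ^ 2)) (‖a i‖ ^ 2) := by
        rw [Function.iterate_succ_apply']
        exact ((hg.iterate_deriv (p i)).1.differentiable (by simp) _).hasDerivAt
      refine hd.comp_hasFDerivAt a ?_
      exact (hasStrictFDerivAt_norm_sq (a i)).hasFDerivAt.comp a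
        (ContinuousLinearMap.proj (R := ℝ) (φ := fun _ : K => EuclideanSpace ℝ (ι × Bool))
          i).hasFDerivAt
    have h2 := HasFDerivAt.finsetProd (u := Finset.univ) fun i _ => h1 i
    rw [evPoly_monomial, h2.fderiv]
    have h3 : MvPolynomial.X t.1.1 * MvPolynomial.monomial p (1 : ℂ) =
        MvPolynomial.monomial (Finsupp.single t.1.1 1 + p) 1 := by
      rw [MvPolynomial.X, MvPolynomial.monomial_mul, one_mul]
    rw [h3, evPoly_monomial]
    simp only [_root_.sum_apply, smul_apply]
    rw [Finset.sum_eq_single t.1.1]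
    · have h4 : ∏ i ∈ Finset.univ.erase t.1.1,
          ((deriv^[(Finsupp.single t.1.1 1 + p : K →₀ ℕ) i] g (‖a i‖ ^ 2) : ℝ) : ℂ) =
          ∏ i ∈ Finset.univ.erase t.1.1, ((deriv^[p i] g (‖a i‖ ^ 2) : ℝ) : ℂ) := by
        refine Finset.prod_congr rfl fun i hi => ?_
        simp [(Finset.ne_of_mem_erase hi).symm]
      rw [← Finset.mul_prod_erase _ _ (Finset.mem_univ t.1.1), h4]
      simp [basisVec, EuclideanSpace.inner_single_right, add_comm (1 : ℕ)]
      ring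
    · intro i _ hi
      simp [basisVec, hi]
    · simp
  | hadd p q hp hq =>
    have h1 := (contDiff_evPoly (ι := ι) hg p).differentiable (by simp) a
    have h2 := (contDiff_evPoly (ι := ι) hg q).differentiable (by simp) a
    rw [mul_add, map_add, map_add, fderiv_add h1 h2, add_apply, hp, hq,
      Pi.add_apply, mul_add]
  | hsmul c p hp =>
    have h1 := (contDiff_evPoly (ι := ι) hg p).differentiable (by simp) a
    rw [mul_smul_comm, map_smul, map_smul, fderiv_const_smul h1, smul_apply,
      hp, Pi.smul_apply, mul_smul_comm]

open MeasureTheory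

instance : (volume : Measure (Blocks K ι)).IsAddHaarMeasure := Measure.pi.isAddHaarMeasure _

omit [DecidableEq K] [DecidableEq ι] in
lemma integrable_mul_evPoly {g : ℝ → ℝ} (hg : IsCutoff g) (p : MvPolynomial K ℂ)
    {f : Blocks K ι → ℂ} (hf : Continuous f) : Integrable fun a => f a * evPoly g p a :=
  (hf.mul (contDiff_evPoly hg p).continuous).integrable_of_hasCompactSupport
    (hasCompactSupport_evPoly hg p).mul_left

lemma integral_fderiv_mul_evPoly {g : ℝ → ℝ} (hg : IsCutoff g) (p : MvPolynomial K ℂ)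
    {f : Blocks K ι → ℂ} (hf : ContDiff ℝ ∞ f) (t : (K × ι) × Bool) :
    ∫ a, fderiv ℝ f a (basisVec t) * evPoly g p a =
      - ∫ a, f a * (2 * (a t.1.1 (t.1.2, t.2) : ℂ) * evPoly g (MvPolynomial.X t.1.1 * p) a) := by
  have hp := contDiff_evPoly (ι := ι) hg p
  have hs := hasCompactSupport_evPoly (ι := ι) hg p
  simp only [← fderiv_evPoly hg]
  have h1 := integrable_mul_evPoly hg p (contDiff_fderiv_apply_vec hf (basisVec t)).continuous
  have h2 : Integrable fun a => f a * fderiv ℝ (evPoly g p) a (basisVec t) :=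
    (hf.continuous.mul (contDiff_fderiv_apply_vec hp _).continuous).integrable_of_hasCompactSupport
      ((hs.fderiv ℝ).comp_left (g := fun L : Blocks K ι →L[ℝ] ℂ => L (basisVec t)) rfl).mul_left
  have h3 := integrable_mul_evPoly hg p hf.continuous
  rw [integral_mul_fderiv_eq_neg_fderiv_mul_of_integrable h1 h2 h3
    (fun a _ => hf.differentiable (by simp) a) (fun a _ => hp.differentiable (by simp) a), neg_neg]

end ShellIntegral

section EquivariantIntegral

open scoped ContDiff TensorProduct
open MeasureTheory

variable {K ι : Type*} [Fintype K] [Fintype ι] [DecidableEq K] [DecidableEq ι]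

/-- The generator of the rotation action on the `i`-th block. -/
def rotField (i : K) (t : (K × ι) × Bool) : smoothFun (Blocks K ι) :=
  ⟨fun a => if t.1.1 = i then
      (if t.2 then -Complex.I * (a t.1.1 (t.1.2, false) : ℂ)
        else Complex.I * (a t.1.1 (t.1.2, true) : ℂ))
    else 0, by
    have h : ∀ b, ContDiff ℝ ∞ fun a : Blocks K ι => (a t.1.1 (t.1.2, b) : ℂ) := fun b =>
      Complex.ofRealCLM.contDiff.comp (((EuclideanSpace.proj (𝕜 := ℝ) (t.1.2, b)).contDiff).comp
        (contDiff_apply ℝ _ t.1.1))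
    change ContDiff ℝ ∞ _
    split_ifs
    · exact contDiff_const.mul (h false)
    · exact contDiff_const.mul (h true)
    · exact contDiff_const⟩

/-- The differential operators on equivariant forms over `Blocks K ι`. -/
abbrev blockOps (K ι : Type*) [Fintype K] [Fintype ι] [DecidableEq K] [DecidableEq ι] :
    DeRhamOps (smoothFun (Blocks K ι))
      (Module.End ℂ (EquivForms (smoothFun (Blocks K ι)) ((K × ι) × Bool) K))
      ((K × ι) × Bool) K (fun t => dirDeriv (basisVec t)) :=
  tensorOps _ fun _ _ u => dirDeriv_comm _ _ u

/-- Evaluation of the coefficients at a point. -/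
def evalAt (a : Blocks K ι) : EquivForms (smoothFun (Blocks K ι)) ((K × ι) × Bool) K →ₗ[ℂ]
    Forms (MvPolynomial K ℂ) ((K × ι) × Bool) :=
  TensorProduct.lift
    { toFun := fun f => f.1 a • LinearMap.id
      map_add' := fun f g => by
        rw [← add_smul]; rfl
      map_smul' := fun c f => by
        rw [RingHom.id_apply, smul_smul]; rfl }

omit [DecidableEq K] [DecidableEq ι] in
lemma evalAt_tmul (a : Blocks K ι) (f : smoothFun (Blocks K ι))
    (q : Forms (MvPolynomial K ℂ) ((K × ι) × Bool)) : evalAt a (f ⊗ₜ q) = f.1 a • q := rfl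

/-- The density of an equivariant form. -/
def density (g : ℝ → ℝ) (h : EquivForms (smoothFun (Blocks K ι)) ((K × ι) × Bool) K)
    (a : Blocks K ι) : ℂ :=
  evPoly g (topForm (MvPolynomial K ℂ) (evalAt a h)) a

omit [DecidableEq K] [DecidableEq ι] in
lemma density_tmul (g : ℝ → ℝ) (f : smoothFun (Blocks K ι))
    (q : Forms (MvPolynomial K ℂ) ((K × ι) × Bool)) (a : Blocks K ι) :
    density g (f ⊗ₜ q) a = f.1 a * evPoly g (topForm (MvPolynomial K ℂ) q) a := by
  have : topForm (MvPolynomial K ℂ) (f.1 a • q) = f.1 a • topForm (MvPolynomial K ℂ) q :=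
    ((topForm (MvPolynomial K ℂ)).restrictScalars ℂ).map_smul (f.1 a) q
  rw [density, evalAt_tmul, this, map_smul, Pi.smul_apply, smul_eq_mul]

omit [DecidableEq K] [DecidableEq ι] in
lemma density_add (g : ℝ → ℝ) (h h' : EquivForms (smoothFun (Blocks K ι)) ((K × ι) × Bool) K) :
    density g (h + h') = density g h + density g h' := by
  ext a; simp [density]

omit [DecidableEq K] [DecidableEq ι] in
lemma integrable_density {g : ℝ → ℝ} (hg : IsCutoff g)
    (h : EquivForms (smoothFun (Blocks K ι)) ((K × ι) × Bool) K) : Integrable (density g h) := by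
  induction h using TensorProduct.induction_on with
  | zero =>
    have : density g (0 : EquivForms (smoothFun (Blocks K ι)) ((K × ι) × Bool) K) = 0 := by
      ext a; simp [density]
    rw [this]; exact integrable_zero _ _ _
  | tmul f q =>
    simp only [funext (density_tmul g f q)]
    exact integrable_mul_evPoly hg _ (smoothFun.contDiff f).continuous
  | add x y hx hy => rw [density_add]; exact hx.add hy

/-- Equivariant integration. -/
def equivIntegral {g : ℝ → ℝ} (hg : IsCutoff g) :
    EquivForms (smoothFun (Blocks K ι)) ((K × ι) × Bool) K →+ ℂ where
  toFun h := ∫ a, density g h a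
  map_zero' := by simp [density]
  map_add' h h' := by
    rw [density_add]
    exact integral_add (integrable_density hg h) (integrable_density hg h')

omit [DecidableEq K] [DecidableEq ι] in
lemma equivIntegral_apply {g : ℝ → ℝ} (hg : IsCutoff g)
    (h : EquivForms (smoothFun (Blocks K ι)) ((K × ι) × Bool) K) :
    equivIntegral hg h = ∫ a, density g h a := rfl

lemma equivIntegral_D {g : ℝ → ℝ} (hg : IsCutoff g)
    (h : EquivForms (smoothFun (Blocks K ι)) ((K × ι) × Bool) K) :
    equivIntegral hg ((blockOps K ι).D rotField h) = 0 := by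
  induction h using TensorProduct.induction_on with
  | zero => simp
  | add x y hx hy => rw [map_add, map_add, hx, hy, add_zero]
  | tmul f q =>
    have hf := smoothFun.contDiff f
    have h1 : (blockOps K ι).D rotField (f ⊗ₜ[ℂ] q) =
        ∑ t, dirDeriv (basisVec t) f ⊗ₜ[ℂ] extMul t q +
        ∑ i, ∑ t, (rotField i t * f) ⊗ₜ[ℂ] varMul i (intMul t q) := by
      simp only [DeRhamOps.D, DeRhamOps.d, DeRhamOps.contr, LinearMap.add_apply,
        LinearMap.sum_apply, Finset.mul_sum]
      rfl
    have h2 : ∀ t : (K × ι) × Bool, ∑ i, (rotField i t * f) ⊗ₜ[ℂ] varMul i (intMul t q) =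
        (rotField t.1.1 t * f) ⊗ₜ[ℂ] varMul t.1.1 (intMul t q) := by
      intro t
      refine Finset.sum_eq_single _ (fun i _ hi => ?_) (by simp)
      have : rotField i t = 0 := by
        ext a
        change (if _ then _ else _) = _
        rw [if_neg (Ne.symm hi)]; rfl
      rw [this, zero_mul, TensorProduct.zero_tmul]
    rw [h1, Finset.sum_comm, Finset.sum_congr rfl fun t _ => h2 t, ← Finset.sum_add_distrib,
      map_sum, Fintype.sum_prod_type]
    refine Finset.sum_eq_zero fun s _ => ?_
    have h3 : ∀ t : (K × ι) × Bool,
        equivIntegral hg (dirDeriv (basisVec t) f ⊗ₜ[ℂ] extMul t q) = - ∫ a : Blocks K ι,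
          f.1 a * (2 * (a t.1.1 (t.1.2, t.2) : ℂ) *
            evPoly g (MvPolynomial.X t.1.1 * topForm (MvPolynomial K ℂ) (extMul t q)) a) := by
      intro t
      rw [equivIntegral_apply, ← integral_fderiv_mul_evPoly hg _ hf]
      simp only [density_tmul, dirDeriv_apply]
    have h4 : ∀ t : (K × ι) × Bool,
        equivIntegral hg ((rotField t.1.1 t * f) ⊗ₜ[ℂ] varMul t.1.1 (intMul t q)) =
          ∫ a : Blocks K ι, (rotField t.1.1 t).1 a * f.1 a *
            evPoly g (MvPolynomial.X t.1.1 * topForm (MvPolynomial K ℂ) (intMul t q)) a := by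
      intro t
      rw [equivIntegral_apply]
      refine integral_congr_ae (Filter.Eventually.of_forall fun a => ?_)
      have : topForm (MvPolynomial K ℂ) (varMul t.1.1 (intMul t q)) =
        MvPolynomial.X t.1.1 * topForm (MvPolynomial K ℂ) (intMul t q) := map_smul _ _ _
      rw [density_tmul, this]
      rfl
    have hc : ∀ p : MvPolynomial K ℂ, ∀ r : MvPolynomial K ℂ, ∀ c : ℂ,
        r * (algebraMap ℂ (MvPolynomial K ℂ) c * p) = c • (r * p) := by
      intro p r c
      rw [Algebra.smul_def]; ring
    rw [Fintype.sum_bool, map_add, map_add, h3, h3, h4, h4, topForm_extMul_true,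
      topForm_extMul_false, neg_mul, mul_neg, hc, hc, map_neg, map_smul, map_smul]
    have hr : ∀ a : Blocks K ι,
        (rotField s.1 (s, true)).1 a = -Complex.I * (a s.1 (s.2, false) : ℂ) :=
      fun a => if_pos rfl
    have hr' : ∀ a : Blocks K ι,
        (rotField s.1 (s, false)).1 a = Complex.I * (a s.1 (s.2, true) : ℂ) :=
      fun a => if_pos rfl
    simp only [hr, hr', Pi.neg_apply, Pi.smul_apply, smul_eq_mul]
    rw [add_comm (-_) (∫ _, _), add_add_add_comm, ← sub_eq_add_neg, neg_add_eq_sub,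
      sub_eq_zero.2, sub_eq_zero.2, add_zero]
    all_goals
      refine integral_congr_ae (Filter.Eventually.of_forall fun a => ?_)
      dsimp only
      ring

end EquivariantIntegral

section Evaluation

open scoped ContDiff TensorProduct

variable {K ι J : Type*} [Fintype K] [Fintype ι] [DecidableEq K] [DecidableEq ι]

lemma evalAt_M (a : Blocks K ι) (u : smoothFun (Blocks K ι))
    (h : EquivForms (smoothFun (Blocks K ι)) ((K × ι) × Bool) K) :
    evalAt a ((blockOps K ι).M u h) = u.1 a • evalAt a h := by
  induction h using TensorProduct.induction_on with
  | zero => simp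
  | add x y hx hy => rw [map_add, map_add, hx, hy, map_add, smul_add]
  | tmul f q =>
    change (u.1 a * f.1 a) • q = u.1 a • (f.1 a • q)
    rw [mul_smul]

omit [DecidableEq K] [DecidableEq ι] in
lemma evalAt_formOp (a : Blocks K ι)
    (T : Module.End (MvPolynomial K ℂ) (Forms (MvPolynomial K ℂ) ((K × ι) × Bool)))
    (h : EquivForms (smoothFun (Blocks K ι)) ((K × ι) × Bool) K) :
    evalAt a (formOp T h) = T (evalAt a h) := by
  induction h using TensorProduct.induction_on with
  | zero => simp
  | add x y hx hy => rw [map_add, map_add, hx, hy, map_add, map_add]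
  | tmul f q => exact ((T.restrictScalars ℂ).map_smul (f.1 a) q).symm

lemma evalAt_df (a : Blocks K ι) (u : smoothFun (Blocks K ι))
    (h : EquivForms (smoothFun (Blocks K ι)) ((K × ι) × Bool) K) :
    evalAt a ((blockOps K ι).df u h) =
      ∑ t, fderiv ℝ u.1 a (basisVec t) • extMul t (evalAt a h) := by
  simp only [DeRhamOps.df, LinearMap.sum_apply, Module.End.mul_apply, map_sum, evalAt_M]
  refine Finset.sum_congr rfl fun t _ => ?_
  exact congrArg _ (evalAt_formOp a (extMul t) h)

lemma evalAt_df_df (a : Blocks K ι) (u v : smoothFun (Blocks K ι)) (c : ℂ)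
    (hc : ∀ t, fderiv ℝ u.1 a (basisVec t) = c * fderiv ℝ v.1 a (basisVec t))
    (h : EquivForms (smoothFun (Blocks K ι)) ((K × ι) × Bool) K) :
    evalAt a ((blockOps K ι).df u ((blockOps K ι).df v h)) = 0 := by
  set d := fun t : (K × ι) × Bool => fderiv ℝ v.1 a (basisVec t)
  set q := evalAt a h
  set L : (K × ι) × Bool → Module.End ℂ (Forms (MvPolynomial K ℂ) ((K × ι) × Bool)) :=
    fun t => (extMul t).restrictScalars ℂ with hL
  have hLL : ∀ s t, L s (L t q) = - L t (L s q) := fun s t =>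
    congrArg (fun T : Module.End (MvPolynomial K ℂ) (Forms (MvPolynomial K ℂ) ((K × ι) × Bool)) =>
      T q) (extMul_extMul _ s t)
  have key : evalAt a ((blockOps K ι).df u ((blockOps K ι).df v h)) =
      c • ∑ s, ∑ t, (d s * d t) • L s (L t q) := by
    rw [evalAt_df, evalAt_df, Finset.smul_sum]
    refine Finset.sum_congr rfl fun s _ => ?_
    change _ • L s (∑ t, d t • L t q) = _
    rw [hc, map_sum, Finset.smul_sum, Finset.smul_sum]
    refine Finset.sum_congr rfl fun t _ => ?_
    rw [map_smul, smul_smul, smul_smul, mul_assoc]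
  rw [key]
  have h0 : ∑ s, ∑ t, (d s * d t) • L s (L t q) = -∑ s, ∑ t, (d s * d t) • L s (L t q) := by
    conv_lhs => rw [Finset.sum_comm]
    simp only [← Finset.sum_neg_distrib]
    refine Finset.sum_congr rfl fun s _ => Finset.sum_congr rfl fun t _ => ?_
    rw [hLL, smul_neg, mul_comm]
  rw [DeRhamOps.eq_zero_of_eq_neg h0, smul_zero]

lemma evalAt_wt (a : Blocks K ι) (χ : K → ℂ)
    (h : EquivForms (smoothFun (Blocks K ι)) ((K × ι) × Bool) K) :
    evalAt a ((blockOps K ι).wt χ h) = ∑ i, χ i • varMul i (evalAt a h) := by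
  simp only [DeRhamOps.wt, LinearMap.sum_apply, map_sum, LinearMap.smul_apply, map_smul]
  exact Finset.sum_congr rfl fun i _ => congrArg _ (evalAt_formOp a (varMul i) h)

lemma evalAt_deformedWt_of_eq (a : Blocks K ι) (χ : K → ℂ) (F f : smoothFun (Blocks K ι))
    (h0 : ∀ᶠ b in nhds a, f.1 b * F.1 b = -1)
    (h : EquivForms (smoothFun (Blocks K ι)) ((K × ι) × Bool) K) :
    evalAt a ((blockOps K ι).deformedWt χ F f h) = 0 := by
  have h1 : f.1 a * F.1 a = -1 := h0.self_of_nhds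
  have hF : F.1 a ≠ 0 := fun h => by simp [h] at h1
  have h2 : fderiv ℝ (f.1 * F.1) a = 0 := by
    have : f.1 * F.1 =ᶠ[nhds a] fun _ => -1 := h0
    rw [this.fderiv_eq]; simp
  rw [fderiv_mul (smoothFun.differentiable f a) (smoothFun.differentiable F a)] at h2
  have h3 := evalAt_df_df a f F (-f.1 a / F.1 a) (fun t => by
    have := DFunLike.congr_fun h2 (basisVec t)
    simp only [add_apply, smul_apply, smul_eq_mul, zero_apply] at this
    field_simp
    linear_combination this) h
  simp only [DeRhamOps.deformedWt, LinearMap.add_apply, Module.End.mul_apply, map_add, h3,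
    evalAt_M, Module.End.one_apply]
  have : (f * F).1 a = f.1 a * F.1 a := rfl
  rw [this, h1]
  simp

lemma evalAt_deformedWt_of_evalAt (a : Blocks K ι) (χ : K → ℂ) (F f : smoothFun (Blocks K ι))
    {h : EquivForms (smoothFun (Blocks K ι)) ((K × ι) × Bool) K} (h0 : evalAt a h = 0) :
    evalAt a ((blockOps K ι).deformedWt χ F f h) = 0 := by
  simp [DeRhamOps.deformedWt, evalAt_M, evalAt_wt, evalAt_df, h0]

lemma evalAt_prod_deformedWt (a : Blocks K ι) (χ : J → K → ℂ) (F f : J → smoothFun (Blocks K ι))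
    (h : EquivForms (smoothFun (Blocks K ι)) ((K × ι) × Bool) K) (l : List J)
    (hl : ∃ j ∈ l, ∀ᶠ b in nhds a, (f j).1 b * (F j).1 b = -1) :
    evalAt a ((l.map fun j => (blockOps K ι).deformedWt (χ j) (F j) (f j)).prod h) = 0 := by
  induction l with
  | nil => simp at hl
  | cons j l ih =>
    rw [List.map_cons, List.prod_cons, Module.End.mul_apply]
    obtain ⟨i, hi, h1⟩ := hl
    rcases List.mem_cons.1 hi with rfl | hi
    · exact evalAt_deformedWt_of_eq a _ _ _ h1 _
    · exact evalAt_deformedWt_of_evalAt a _ _ _ (ih ⟨i, hi, h1⟩)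

/-- The polynomial attached to a character. -/
def charPoly (χ : K → ℂ) : MvPolynomial K ℂ := ∑ i, χ i • MvPolynomial.X i

/-- A polynomial as a closed equivariant form. -/
def constForm (b : MvPolynomial K ℂ) : EquivForms (smoothFun (Blocks K ι)) ((K × ι) × Bool) K :=
  1 ⊗ₜ algebraMap _ _ b

lemma wt_constForm (χ : K → ℂ) (b : MvPolynomial K ℂ) :
    (blockOps K ι).wt χ (constForm b) = constForm (charPoly χ * b) := by
  have : (blockOps K ι).wt χ (constForm b) =
      ∑ i, χ i • ((1 : smoothFun (Blocks K ι)) ⊗ₜ[ℂ] varMul i (algebraMap _ _ b)) := by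
    simp only [DeRhamOps.wt, LinearMap.sum_apply]
    rfl
  rw [this, constForm, charPoly, Finset.sum_mul, map_sum, TensorProduct.tmul_sum]
  refine Finset.sum_congr rfl fun i _ => ?_
  rw [TensorProduct.smul_tmul', TensorProduct.smul_tmul]
  congr 1
  rw [smul_mul_assoc]
  change χ i • (MvPolynomial.X i : MvPolynomial K ℂ) • algebraMap (MvPolynomial K ℂ)
    (Forms (MvPolynomial K ℂ) ((K × ι) × Bool)) b = _
  rw [Algebra.algebraMap_eq_smul_one, Algebra.algebraMap_eq_smul_one, smul_assoc, mul_smul]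

lemma prod_wt_constForm (χ : J → K → ℂ) (l : List J) :
    (l.map fun j => (blockOps K ι).wt (χ j)).prod (constForm 1) =
      constForm (l.map fun j => charPoly (χ j)).prod := by
  induction l with
  | nil => rfl
  | cons j l ih =>
    rw [List.map_cons, List.prod_cons, Module.End.mul_apply, ih, wt_constForm, List.map_cons,
      List.prod_cons]

lemma d_constForm_one : (blockOps K ι).d (constForm 1) = 0 := by
  simp only [DeRhamOps.d, LinearMap.sum_apply]
  refine Finset.sum_eq_zero fun t _ => ?_
  change dirDeriv (basisVec t) (1 : smoothFun (Blocks K ι)) ⊗ₜ[ℂ]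
    extMul t (algebraMap (MvPolynomial K ℂ) (Forms (MvPolynomial K ℂ) ((K × ι) × Bool)) 1) = 0
  rw [Derivation.map_one_eq_zero, TensorProduct.zero_tmul]

lemma contr_constForm_one (ξ : (K × ι) × Bool → smoothFun (Blocks K ι)) :
    (blockOps K ι).contr ξ (constForm 1) = 0 := by
  simp only [DeRhamOps.contr, LinearMap.sum_apply]
  refine Finset.sum_eq_zero fun t _ => ?_
  change (ξ t * 1) ⊗ₜ[ℂ]
    intMul t (algebraMap (MvPolynomial K ℂ) (Forms (MvPolynomial K ℂ) ((K × ι) × Bool)) 1) = 0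
  have : intMul t (algebraMap (MvPolynomial K ℂ)
      (Forms (MvPolynomial K ℂ) ((K × ι) × Bool)) 1) = 0 :=
    CliffordAlgebra.contractLeft_algebraMap _ _ _
  rw [this, TensorProduct.tmul_zero]

lemma D_constForm_one (ξ : K → (K × ι) × Bool → smoothFun (Blocks K ι)) :
    (blockOps K ι).D ξ (constForm 1) = 0 := by
  simp only [DeRhamOps.D, LinearMap.add_apply, LinearMap.sum_apply, Module.End.mul_apply,
    d_constForm_one, contr_constForm_one, map_zero, Finset.sum_const_zero, add_zero]

end Evaluation

section Partner

open scoped ContDiff ComplexConjugate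

/-- A smoothed version of `1 / t`, exact for `ε ≤ t`. -/
def smoothInv (ε t : ℝ) : ℝ := Real.smoothTransition (2 * t / ε - 1) / t

lemma smoothInv_mul {ε t : ℝ} (hε : 0 < ε) (ht : ε ≤ t) : smoothInv ε t * t = 1 := by
  have h : 1 ≤ 2 * t / ε - 1 := by
    have : 2 ≤ 2 * t / ε := by rw [le_div_iff₀ hε]; linarith
    linarith
  rw [smoothInv, Real.smoothTransition.one_of_one_le h]
  field_simp [(hε.trans_le ht).ne']

lemma contDiff_smoothInv {ε : ℝ} (hε : 0 < ε) : ContDiff ℝ ∞ (smoothInv ε) := by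
  rw [contDiff_iff_contDiffAt]
  intro t
  by_cases ht : t = 0
  · have : smoothInv ε =ᶠ[nhds t] fun _ => 0 := by
      filter_upwards [gt_mem_nhds (show t < ε / 2 by rw [ht]; positivity)] with s hs
      have : 2 * s / ε - 1 ≤ 0 := by
        rw [sub_nonpos, div_le_one hε]; linarith
      rw [smoothInv, Real.smoothTransition.zero_of_nonpos this, zero_div]
    exact contDiffAt_const.congr_of_eventuallyEq this
  · exact ((Real.smoothTransition.contDiff.comp (by fun_prop)).contDiffAt).div contDiffAt_id ht

variable {X : Type*} [NormedAddCommGroup X] [NormedSpace ℝ X]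

/-- The conjugate of a smooth function. -/
def conjFun (F : smoothFun X) : smoothFun X :=
  ⟨fun a => conj (F.1 a), Complex.conjCLE.contDiff.comp (smoothFun.contDiff F)⟩

/-- For real `S`, the function `S(|F|²)`. -/
def normSqComp {S : ℝ → ℝ} (hS : ContDiff ℝ ∞ S) (F : smoothFun X) : smoothFun X :=
  ⟨fun a => (S ((F * conjFun F).1 a).re : ℂ), Complex.ofRealCLM.contDiff.comp
    (hS.comp (Complex.reCLM.contDiff.comp (smoothFun.contDiff (F * conjFun F))))⟩

lemma dirDeriv_conjFun (v : X) (F : smoothFun X) :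
    dirDeriv v (conjFun F) = conjFun (dirDeriv v F) := by
  refine Subtype.ext (funext fun a => ?_)
  have h := (Complex.conjCLE.toContinuousLinearMap.hasFDerivAt.comp a
    (smoothFun.differentiable F a).hasFDerivAt).fderiv
  exact congrArg (fun L => L v) h

lemma conjFun_conjFun (F : smoothFun X) : conjFun (conjFun F) = F :=
  Subtype.ext (funext fun _ => Complex.conj_conj _)

lemma conjFun_mul (F G : smoothFun X) : conjFun (F * G) = conjFun F * conjFun G :=
  Subtype.ext (funext fun _ => map_mul _ _ _)

lemma dirDeriv_normSqComp {S : ℝ → ℝ} (hS : ContDiff ℝ ∞ S) (F : smoothFun X) :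
    ∃ c : smoothFun X, ∀ v, dirDeriv v (normSqComp hS F) = c * dirDeriv v (F * conjFun F) := by
  refine ⟨normSqComp (contDiff_infty_iff_deriv.1 hS).2 F, fun v => Subtype.ext (funext fun a => ?_)⟩
  set N := F * conjFun F with hN
  have hN' : conjFun N = N := by rw [hN, conjFun_mul, conjFun_conjFun, mul_comm]
  have h1 : conj (fderiv ℝ N.1 a v) = fderiv ℝ N.1 a v :=
    congrFun (congrArg Subtype.val
      ((dirDeriv_conjFun v N).symm.trans (congrArg (dirDeriv v) hN'))) a
  have h2 : HasFDerivAt (fun a => (N.1 a).re) (Complex.reCLM ∘L fderiv ℝ N.1 a) a :=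
    Complex.reCLM.hasFDerivAt.comp a (smoothFun.differentiable N a).hasFDerivAt
  have h3 : HasDerivAt S (deriv S (N.1 a).re : ℝ) (N.1 a).re :=
    ((hS.differentiable (by simp)) _).hasDerivAt
  have h4 := (Complex.ofRealCLM.hasFDerivAt.comp a (h3.comp_hasFDerivAt a h2)).fderiv
  change fderiv ℝ (fun a => (S (N.1 a).re : ℂ)) a v =
    ((deriv S (N.1 a).re : ℝ) : ℂ) * fderiv ℝ N.1 a v
  rw [← Complex.conj_eq_iff_re.1 h1]
  refine (congrArg (fun L => L v) h4).trans ?_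
  simp

end Partner

section Weights

open scoped ContDiff ComplexConjugate

variable {K ι : Type*} [Fintype K] [Fintype ι] [DecidableEq K] [DecidableEq ι]

/-- `F` transforms with weight `χ` under the infinitesimal block rotations. -/
def HasWeight (χ : K → ℝ) (F : smoothFun (Blocks K ι)) : Prop :=
  ∀ i, ∑ t, rotField i t * dirDeriv (basisVec t) F = (χ i : ℂ) • F

omit [DecidableEq ι] in
lemma conjFun_rotField (i : K) (t : (K × ι) × Bool) : conjFun (rotField i t) = -rotField i t := by
  refine Subtype.ext (funext fun a => ?_)
  change conj (ite _ _ _) = - (ite _ _ _ : ℂ)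
  split_ifs <;> simp

lemma hasWeight_conjFun {χ : K → ℝ} {F : smoothFun (Blocks K ι)} (h : HasWeight χ F) :
    HasWeight (-χ) (conjFun F) := by
  intro i
  have h1 : ∑ t, rotField i t * dirDeriv (basisVec t) (conjFun F) =
      - conjFun (∑ t, rotField i t * dirDeriv (basisVec t) F) := by
    have hs : ∀ (s : Finset ((K × ι) × Bool)) (G : (K × ι) × Bool → smoothFun (Blocks K ι)),
        conjFun (∑ t ∈ s, G t) = ∑ t ∈ s, conjFun (G t) := by
      intro s G
      refine Subtype.ext (funext fun a => ?_)
      have h := fun (G : (K × ι) × Bool → smoothFun (Blocks K ι)) =>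
        congrFun (map_sum (smoothFun (Blocks K ι)).val G s) a
      have h5 := congrArg (starRingEnd ℂ) (h G)
      refine h5.trans ((?_ : _ = _).trans (h fun t => conjFun (G t)).symm)
      rw [Finset.sum_apply, Finset.sum_apply, map_sum]
      rfl
    rw [hs, ← Finset.sum_neg_distrib]
    refine Finset.sum_congr rfl fun t _ => ?_
    rw [conjFun_mul, conjFun_rotField, dirDeriv_conjFun]; ring
  rw [h1, h i]
  refine Subtype.ext (funext fun a => ?_)
  change - conj ((χ i : ℂ) * F.1 a) = ((-χ i : ℝ) : ℂ) * conj (F.1 a)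
  simp

lemma exists_partner {χ : K → ℝ} {F : smoothFun (Blocks K ι)} (h : HasWeight χ F) {ε : ℝ}
    (hε : 0 < ε) : ∃ f : smoothFun (Blocks K ι), HasWeight (-χ) f ∧
      ∀ a, ε < ‖F.1 a‖ ^ 2 → ∀ᶠ b in nhds a, f.1 b * F.1 b = -1 := by
  have hS := contDiff_smoothInv hε
  refine ⟨- (conjFun F * normSqComp hS F), fun i => ?_, fun a ha => ?_⟩
  · obtain ⟨c, hc⟩ := dirDeriv_normSqComp hS F
    have h1 : ∑ t, rotField i t * dirDeriv (basisVec t) (F * conjFun F) = 0 := by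
      have : ∀ t, rotField i t * dirDeriv (basisVec t) (F * conjFun F) =
          F * (rotField i t * dirDeriv (basisVec t) (conjFun F)) +
          conjFun F * (rotField i t * dirDeriv (basisVec t) F) := by
        intro t
        rw [Derivation.leibniz, smul_eq_mul, smul_eq_mul]; ring
      rw [Finset.sum_congr rfl fun t _ => this t, Finset.sum_add_distrib, ← Finset.mul_sum,
        ← Finset.mul_sum, h i, hasWeight_conjFun h i, mul_smul_comm, mul_smul_comm,
        mul_comm (conjFun F), ← add_smul]
      simp
    have h2 : ∀ t, rotField i t * dirDeriv (basisVec t) (-(conjFun F * normSqComp hS F)) =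
        -(conjFun F * c) * (rotField i t * dirDeriv (basisVec t) (F * conjFun F)) +
        -normSqComp hS F * (rotField i t * dirDeriv (basisVec t) (conjFun F)) := by
      intro t
      rw [map_neg, Derivation.leibniz, hc, smul_eq_mul, smul_eq_mul]; ring
    rw [Finset.sum_congr rfl fun t _ => h2 t, Finset.sum_add_distrib, ← Finset.mul_sum,
      ← Finset.mul_sum, h1, hasWeight_conjFun h i, mul_zero, zero_add, mul_smul_comm]
    congr 1
    ring
  · have hc : Continuous fun b => ‖F.1 b‖ ^ 2 := ((smoothFun.contDiff F).continuous.norm).pow 2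
    filter_upwards [(isOpen_lt continuous_const hc).mem_nhds ha] with b hb
    have hb' : ε < ‖F.1 b‖ ^ 2 := hb
    change -(conj (F.1 b) * (smoothInv ε (F.1 b * conj (F.1 b)).re : ℂ)) * F.1 b = -1
    have h3 : F.1 b * conj (F.1 b) = ((‖F.1 b‖ ^ 2 : ℝ) : ℂ) := by
      rw [Complex.mul_conj, Complex.normSq_eq_norm_sq]
    have h4 := smoothInv_mul hε hb'.le
    rw [h3, Complex.ofReal_re]
    calc _ = -((smoothInv ε (‖F.1 b‖ ^ 2) : ℝ) * (F.1 b * conj (F.1 b))) := by ring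
      _ = _ := by rw [h3, ← Complex.ofReal_mul, h4, Complex.ofReal_one]

/-- The complex coordinates of a point of `Blocks K ι`. -/
def toComplex (a : Blocks K ι) (i : K) (r : ι) : ℂ :=
  (a i (r, false) : ℂ) + Complex.I * (a i (r, true) : ℂ)

omit [DecidableEq K] [DecidableEq ι] in
lemma contDiff_toComplex : ContDiff ℝ ∞ (toComplex : Blocks K ι → K → ι → ℂ) := by
  refine contDiff_pi.2 fun i => contDiff_pi.2 fun r => ?_
  have h : ∀ b, ContDiff ℝ ∞ fun a : Blocks K ι => (a i (r, b) : ℂ) := fun b =>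
    Complex.ofRealCLM.contDiff.comp (((EuclideanSpace.proj (𝕜 := ℝ) (r, b)).contDiff).comp
      (contDiff_apply ℝ _ i))
  exact (h false).add (contDiff_const.mul (h true))

/-- The infinitesimal rotation of the `i`-th block at `a`. -/
def rotVec (a : Blocks K ι) (i : K) : Blocks K ι :=
  Pi.single i (WithLp.toLp 2 fun s => if s.2 then a i (s.1, false) else - a i (s.1, true))

lemma hasWeight_of_rotate {χ : K → ℝ} {G : (K → ι → ℂ) → ℂ} (hG : ContDiff ℝ ∞ G)
    (h : ∀ (z : K → ι → ℂ) (i : K) (θ : ℝ),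
      G (Function.update z i (Complex.exp (θ * Complex.I) • z i)) =
        Complex.exp (χ i * θ * Complex.I) * G z) :
    HasWeight χ (⟨fun a => G (toComplex a), hG.comp contDiff_toComplex⟩ :
      smoothFun (Blocks K ι)) := by
  intro i
  refine Subtype.ext (funext fun a => ?_)
  set F : smoothFun (Blocks K ι) := ⟨fun a => G (toComplex a), hG.comp contDiff_toComplex⟩
  let γ : ℝ → Blocks K ι := fun θ =>
    a + ((Real.cos θ - 1) • (Pi.single i (a i) : Blocks K ι) + Real.sin θ • rotVec a i)
  have h0 : γ 0 = a := by simp [γ]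
  have hγ : HasDerivAt γ (rotVec a i) 0 := by
    have := ((((Real.hasDerivAt_cos 0).sub_const 1).smul_const (Pi.single i (a i) : Blocks K ι)).add
      ((Real.hasDerivAt_sin 0).smul_const (rotVec a i)))
    simp only [Real.sin_zero, neg_zero, zero_smul, Real.cos_zero, one_smul, zero_add] at this
    exact this.const_add a
  have hγ' : ∀ θ, F.1 (γ θ) = Complex.exp (χ i * θ * Complex.I) * F.1 a := by
    intro θ
    refine Eq.trans (congrArg G ?_) (h (toComplex a) i θ)
    funext k r
    by_cases hk : k = i
    · subst hk
      simp only [toComplex, γ, rotVec, Function.update_self, Pi.add_apply, Pi.smul_apply,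
        Pi.single_eq_same, PiLp.add_apply, PiLp.smul_apply, smul_eq_mul, Complex.exp_mul_I]
      push_cast
      simp
      linear_combination (-(a k (r, true)) * Complex.sin θ) * Complex.I_sq
    · simp [toComplex, γ, rotVec, hk]
  have h1 : HasDerivAt (fun θ => F.1 (γ θ)) (fderiv ℝ F.1 a (rotVec a i)) 0 := by
    have h2 : HasFDerivAt F.1 (fderiv ℝ F.1 a) (γ 0) := by
      rw [h0]; exact (smoothFun.differentiable F a).hasFDerivAt
    exact h2.comp_hasDerivAt 0 hγ
  have h2 : HasDerivAt (fun θ : ℝ => F.1 (γ θ)) (χ i * Complex.I * F.1 a) 0 := by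
    simp only [hγ']
    have : HasDerivAt (fun θ : ℝ => (χ i : ℂ) * θ * Complex.I) (χ i * Complex.I) 0 := by
      simpa using ((Complex.ofRealCLM.hasDerivAt (x := 0)).const_mul (χ i : ℂ)).mul_const Complex.I
    simpa using (this.cexp.mul_const (F.1 a))
  have h3 := h1.unique h2
  have h4 : rotVec a i = ∑ t : (K × ι) × Bool, (if t.1.1 = i then
      (if t.2 then a t.1.1 (t.1.2, false) else - a t.1.1 (t.1.2, true)) else 0) • basisVec t := by
    funext k
    ext s
    have hb : ∀ t : (K × ι) × Bool, (basisVec t : Blocks K ι) k s =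
        if t = ((k, s.1), s.2) then 1 else 0 := by
      rintro ⟨⟨k', r⟩, b⟩
      obtain ⟨r', b'⟩ := s
      by_cases hk : k' = k
      · subst hk
        simp [basisVec, Prod.ext_iff, eq_comm]
      · have : k ≠ k' := fun h => hk h.symm
        simp [basisVec, hk, this]
    rw [Finset.sum_apply, WithLp.ofLp_sum, Finset.sum_apply,
      Finset.sum_eq_single ((k, s.1), s.2)]
    · simp only [Pi.smul_apply, PiLp.smul_apply, hb]
      by_cases hk : k = i
      · subst hk
        simp [rotVec]
      · simp [rotVec, hk]
    · intro t _ ht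
      simp only [Pi.smul_apply, PiLp.smul_apply, hb, if_neg ht, smul_zero]
    · simp
  rw [h4, map_sum] at h3
  have h5 : (∑ t, rotField i t * dirDeriv (basisVec t) F).1 a =
      ∑ t, (rotField i t).1 a * fderiv ℝ F.1 a (basisVec t) := by
    have := congrFun (map_sum (smoothFun (Blocks K ι)).val
      (fun t => rotField i t * dirDeriv (basisVec t) F) Finset.univ) a
    rw [Finset.sum_apply] at this
    exact this
  rw [h5]
  change _ = (χ i : ℂ) * F.1 a
  calc _ = -Complex.I * ∑ t : (K × ι) × Bool, fderiv ℝ F.1 a ((if t.1.1 = i then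
      (if t.2 then a t.1.1 (t.1.2, false) else - a t.1.1 (t.1.2, true)) else 0) • basisVec t) := by
        rw [Finset.mul_sum]
        refine Finset.sum_congr rfl fun t _ => ?_
        change (ite _ _ _) * _ = _
        rw [map_smul]
        split_ifs <;> simp [mul_assoc]
    _ = _ := by
        rw [h3]
        linear_combination (-(χ i : ℂ) * F.1 a) * Complex.I_sq

end Weights

section CutoffIntegrals

open MeasureTheory
open scoped ContDiff

lemma IsCutoff.hasCompactSupport {g : ℝ → ℝ} (hg : IsCutoff g) : HasCompactSupport g :=
  HasCompactSupport.intro isCompact_Icc fun _ ht => hg.eq_zero ht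

lemma IsCutoff.integrable_pow_mul {g : ℝ → ℝ} (hg : IsCutoff g) (q : ℕ) :
    Integrable fun t => t ^ q * g t :=
  ((continuous_pow q).mul hg.1.continuous).integrable_of_hasCompactSupport
    hg.hasCompactSupport.mul_left

lemma IsCutoff.integral_pow_mul_deriv {g : ℝ → ℝ} (hg : IsCutoff g) (q : ℕ) :
    ∫ t, t ^ q * _root_.deriv g t = - (q * ∫ t, t ^ (q - 1) * g t) := by
  have := integral_mul_deriv_eq_deriv_mul_of_integrable (u := fun t : ℝ => t ^ q) (v := g)
    (u' := fun t => q * t ^ (q - 1)) (v' := _root_.deriv g) (fun t _ => hasDerivAt_pow q t)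
    (fun t _ => (hg.1.differentiable (by simp) t).hasDerivAt) (hg.deriv.integrable_pow_mul q)
    (by simpa only [Pi.mul_def, mul_assoc] using (hg.integrable_pow_mul (q - 1)).const_mul (q : ℝ))
    (hg.integrable_pow_mul q)
  rw [this, ← integral_const_mul]
  simp only [mul_assoc]

lemma IsCutoff.integral_pow_mul_iterate_deriv_of_lt {g : ℝ → ℝ} (hg : IsCutoff g) {q p : ℕ}
    (h : q < p) : ∫ t, t ^ q * _root_.deriv^[p] g t = 0 := by
  induction q generalizing p with
  | zero =>
    obtain ⟨p, rfl⟩ : ∃ r, p = r + 1 := ⟨p - 1, by omega⟩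
    rw [Function.iterate_succ_apply', (hg.iterate_deriv p).integral_pow_mul_deriv]
    simp
  | succ q ih =>
    obtain ⟨p, rfl⟩ : ∃ r, p = r + 1 := ⟨p - 1, by omega⟩
    rw [Function.iterate_succ_apply', (hg.iterate_deriv p).integral_pow_mul_deriv,
      Nat.add_sub_cancel, ih (by omega), mul_zero, neg_zero]

lemma IsCutoff.integral_pow_mul_iterate_deriv_self {g : ℝ → ℝ} (hg : IsCutoff g) (q : ℕ) :
    ∫ t, t ^ q * _root_.deriv^[q] g t = (-1) ^ q * q.factorial * ∫ t, g t := by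
  induction q with
  | zero => simp
  | succ q ih =>
    rw [Function.iterate_succ_apply', (hg.iterate_deriv q).integral_pow_mul_deriv,
      Nat.add_sub_cancel, ih, Nat.factorial_succ]
    push_cast
    ring

lemma IsCutoff.integral_comp_norm_sq {ι : Type*} [Fintype ι] [Nonempty ι] {g : ℝ → ℝ}
    (hg : IsCutoff g) : ∃ C : ℝ, C ≠ 0 ∧ ∀ p : ℕ,
      ∫ v : EuclideanSpace ℝ (ι × Bool), _root_.deriv^[p] g (‖v‖ ^ 2) =
        C * ∫ t, t ^ (Fintype.card ι - 1) * _root_.deriv^[p] g t := by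
  set E := EuclideanSpace ℝ (ι × Bool)
  set m := Fintype.card ι
  have hm : 0 < m := Fintype.card_pos
  have hdim : Module.finrank ℝ E = 2 * m := by simp [E, m, mul_comm]
  refine ⟨m * (volume : Measure E).real (Metric.ball 0 1), ?_, fun p => ?_⟩
  · refine mul_ne_zero (by exact_mod_cast hm.ne') ?_
    exact (ENNReal.toReal_pos (Metric.measure_ball_pos _ _ one_pos).ne'
      measure_ball_lt_top.ne).ne'
  · set h := _root_.deriv^[p] g with hh
    have hc : IsCutoff h := hg.iterate_deriv p
    have h1 := integral_fun_norm_addHaar (volume : Measure E) (fun y => h (y ^ 2))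
    have h2 := integral_comp_rpow_Ioi_of_pos (g := fun t => t ^ (m - 1) * h t) (two_pos (α := ℝ))
    have h3 : ∫ t in Set.Ioi (0 : ℝ), t ^ (m - 1) * h t = ∫ t, t ^ (m - 1) * h t := by
      refine setIntegral_eq_integral_of_forall_compl_eq_zero fun t ht => ?_
      rw [hc.eq_zero, mul_zero]
      rintro ⟨h4, -⟩
      exact ht (lt_of_lt_of_le (by norm_num) h4)
    rw [h1, hdim, ← h3, ← h2, nsmul_eq_mul, smul_eq_mul]
    have h4 : ∫ x in Set.Ioi (0 : ℝ), (2 * x ^ ((2 : ℝ) - 1)) • ((x ^ (2 : ℝ)) ^ (m - 1) *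
        h (x ^ (2 : ℝ))) = 2 * ∫ y in Set.Ioi (0 : ℝ), y ^ (2 * m - 1) • h (y ^ 2) := by
      rw [← integral_const_mul]
      refine integral_congr_ae (Filter.Eventually.of_forall fun x => ?_)
      have : (2 : ℝ) - 1 = 1 := by norm_num
      dsimp only
      rw [this, Real.rpow_one, Real.rpow_two, ← pow_mul, smul_eq_mul, smul_eq_mul,
        show 2 * m - 1 = 2 * (m - 1) + 1 by omega, pow_succ]
      ring
    rw [h4]
    push_cast
    ring

lemma exists_isCutoff : ∃ g : ℝ → ℝ, IsCutoff g ∧ 0 < ∫ t, g t := by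
  obtain ⟨g, h1, h2, h3, h4, h5⟩ := exists_contDiff_tsupport_subset (n := ⊤)
    (Icc_mem_nhds (show (1 / 2 : ℝ) < 1 by norm_num) (show (1 : ℝ) < 2 by norm_num))
  refine ⟨g, ⟨h3, h1⟩, ?_⟩
  refine h3.continuous.integral_pos_of_hasCompactSupport_nonneg_nonzero h2 (x := 1) ?_ ?_
  · exact fun x => (h4 ⟨x, rfl⟩).1
  · rw [h5]; norm_num

end CutoffIntegrals

section CommonZero

open MeasureTheory
open scoped ContDiff

variable {K ι J : Type*} [Fintype K] [Fintype ι]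

lemma integral_evPoly_monomial [Nonempty ι] {g : ℝ → ℝ} (hg : IsCutoff g) :
    ∃ c : ℕ → ℂ, (∀ p, Fintype.card ι ≤ p → c p = 0) ∧
      ((∫ t, g t) ≠ 0 → c (Fintype.card ι - 1) ≠ 0) ∧ ∀ p : K →₀ ℕ,
      ∫ a : Blocks K ι, evPoly g (MvPolynomial.monomial p 1) a = ∏ i, c (p i) := by
  obtain ⟨C, hC, h⟩ := hg.integral_comp_norm_sq (ι := ι)
  have hm : 0 < Fintype.card ι := Fintype.card_pos
  refine ⟨fun p => ((∫ v : EuclideanSpace ℝ (ι × Bool), deriv^[p] g (‖v‖ ^ 2) : ℝ) : ℂ),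
    fun p hp => ?_, fun h0 => ?_, fun p => ?_⟩
  · dsimp only
    rw [h, hg.integral_pow_mul_iterate_deriv_of_lt (by omega), mul_zero, Complex.ofReal_zero]
  · dsimp only
    rw [h, hg.integral_pow_mul_iterate_deriv_self, Complex.ofReal_ne_zero]
    exact mul_ne_zero hC (mul_ne_zero (mul_ne_zero (pow_ne_zero _ (by norm_num))
      (by exact_mod_cast Nat.factorial_ne_zero _)) h0)
  · rw [evPoly_monomial]
    have := integral_fintype_prod_volume_eq_prod (𝕜 := ℂ)
      (fun (i : K) (v : EuclideanSpace ℝ (ι × Bool)) => ((deriv^[p i] g (‖v‖ ^ 2) : ℝ) : ℂ))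
    refine this.trans (Finset.prod_congr rfl fun i _ => ?_)
    exact integral_ofReal

lemma integral_evPoly_of_isHomogeneous [Nonempty ι] {g : ℝ → ℝ} (hg : IsCutoff g)
    {P : MvPolynomial K ℂ} (hP : P.IsHomogeneous (Fintype.card K * (Fintype.card ι - 1)))
    (hc : P.coeff (Finsupp.equivFunOnFinite.symm fun _ => Fintype.card ι - 1) ≠ 0)
    (h0 : (∫ t, g t) ≠ 0) : ∫ a : Blocks K ι, evPoly g P a ≠ 0 := by
  obtain ⟨c, h1, h2, h3⟩ := integral_evPoly_monomial (K := K) (ι := ι) hg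
  set m := Fintype.card ι
  have hm : 0 < m := Fintype.card_pos
  set q : K →₀ ℕ := Finsupp.equivFunOnFinite.symm fun _ => m - 1
  have h_integrable : ∀ p : MvPolynomial K ℂ, Integrable (evPoly g p : Blocks K ι → ℂ) := fun p => by
    simpa using integrable_mul_evPoly hg p (f := fun _ => 1) continuous_const
  have h4 : ∫ a : Blocks K ι, evPoly g P a = ∑ p ∈ P.support, P.coeff p * ∏ i, c (p i) := by
    conv_lhs => rw [P.as_sum, map_sum]
    simp only [Finset.sum_apply]
    rw [integral_finsetSum _ fun p _ => h_integrable _]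
    refine Finset.sum_congr rfl fun p _ => ?_
    rw [← h3, ← integral_const_mul]
    refine integral_congr_ae (Filter.Eventually.of_forall fun a => ?_)
    have : MvPolynomial.monomial p (P.coeff p) = P.coeff p • MvPolynomial.monomial p (1 : ℂ) := by
      rw [MvPolynomial.smul_monomial, smul_eq_mul, mul_one]
    dsimp only
    rw [this, map_smul]
    rfl
  rw [h4, Finset.sum_eq_single q]
  · exact mul_ne_zero hc (Finset.prod_ne_zero_iff.2 fun i _ => h2 h0)
  · intro p hp hpq
    have hdeg : ∑ i, p i = Fintype.card K * (m - 1) := by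
      have := hP (MvPolynomial.mem_support_iff.1 hp)
      rw [Finsupp.weight_apply, Finsupp.sum_fintype _ _ (by simp)] at this
      simpa using this
    obtain ⟨i, hi⟩ : ∃ i, m ≤ p i := by
      by_contra! hlt
      refine hpq (Finsupp.ext fun i => ?_)
      have h5 : ∑ i, p i = ∑ i : K, (m - 1) := by simp [hdeg]
      exact (Finset.sum_eq_sum_iff_of_le fun i _ => by have := hlt i; omega).1 h5 i
        (Finset.mem_univ i)
    rw [Finset.prod_eq_zero (Finset.mem_univ i) (h1 _ hi), mul_zero]
  · intro hq
    exact absurd (MvPolynomial.mem_support_iff.2 hc) hq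

set_option maxHeartbeats 1000000 in
/-- If the coefficient of `∏ i, x i ^ (|ι| - 1)` in the product of the linear forms
`∑ i, χ j i * x i` is nonzero, then smooth functions `G j` of weights `χ j` on `K → ι → ℂ` have a
common zero with all blocks nonzero. -/
theorem exists_common_zero [DecidableEq K] [Nonempty ι] [Fintype J] (χ : J → K → ℝ)
    (G : J → (K → ι → ℂ) → ℂ) (hG : ∀ j, ContDiff ℝ ∞ (G j))
    (hrot : ∀ j (z : K → ι → ℂ) (i : K) (θ : ℝ),
      G j (Function.update z i (Complex.exp (θ * Complex.I) • z i)) =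
        Complex.exp (χ j i * θ * Complex.I) * G j z)
    (hJ : Fintype.card J = Fintype.card K * (Fintype.card ι - 1))
    (hc : (∏ j, charPoly fun i => (χ j i : ℂ)).coeff
      (Finsupp.equivFunOnFinite.symm fun _ => Fintype.card ι - 1) ≠ 0) :
    ∃ z, (∀ i, z i ≠ 0) ∧ ∀ j, G j z = 0 := by
  classical
  by_contra! hno
  let F : J → smoothFun (Blocks K ι) := fun j =>
    ⟨fun a => G j (toComplex a), (hG j).comp contDiff_toComplex⟩
  have hF : ∀ j, HasWeight (χ j) (F j) := fun j => hasWeight_of_rotate (hG j) (hrot j)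
  obtain ⟨δ, hδ, hmin⟩ : ∃ δ, 0 < δ ∧ ∀ a ∈ shell K ι, δ ≤ ∑ j, ‖(F j).1 a‖ ^ 2 := by
    refine (isCompact_shell K ι).exists_forall_le' (f := fun a => ∑ j, ‖(F j).1 a‖ ^ 2)
      (continuous_finsetSum _ fun j _ =>
        ((smoothFun.contDiff (F j)).continuous.norm).pow 2).continuousOn fun a ha => ?_
    obtain ⟨j, hj⟩ := hno (toComplex a) fun i hi => by
      have h1 : a i = 0 := by
        ext ⟨r, b⟩
        have := congrFun hi r
        have h2 := congrArg Complex.re this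
        have h3 := congrArg Complex.im this
        simp [toComplex] at h2 h3
        cases b <;> assumption
      have h2 := (ha i).1
      rw [h1] at h2
      norm_num at h2
    exact Finset.sum_pos' (fun _ _ => by positivity) ⟨j, Finset.mem_univ j, by
      have : (F j).1 a ≠ 0 := hj
      positivity⟩
  set ε := δ / (Fintype.card J + 1)
  have hε : 0 < ε := by positivity
  have hlarge : ∀ a ∈ shell K ι, ∃ j, ε < ‖(F j).1 a‖ ^ 2 := by
    intro a ha
    by_contra! hle
    have h1 := (hmin a ha).trans (Finset.sum_le_sum fun j _ => hle j)
    rw [Finset.sum_const, Finset.card_univ, nsmul_eq_mul] at h1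
    have h2 : (Fintype.card J + 1) * ε = δ := by simp only [ε]; field_simp
    linarith
  choose f hf hpart using fun j => exists_partner (hF j) hε
  obtain ⟨g, hg, hgpos⟩ := exists_isCutoff
  obtain ⟨-, γ, hγ⟩ := (blockOps K ι).prod_deformedWt_apply rotField (constForm 1)
    (D_constForm_one _) (fun j i => (χ j i : ℂ)) F f hF (fun j i => by simpa using hf j i)
    Finset.univ.toList
  have h0 := congrArg (equivIntegral hg) hγ
  rw [map_add, equivIntegral_D, add_zero, prod_wt_constForm, equivIntegral_apply,
    equivIntegral_apply] at h0
  have h1 : ∀ a : Blocks K ι, density g (constForm (Finset.univ.toList.map fun j =>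
      charPoly fun i => (χ j i : ℂ)).prod) a =
      evPoly g (∏ j, charPoly fun i => (χ j i : ℂ)) a := by
    intro a
    rw [constForm, density_tmul, topForm_algebraMap, Finset.prod_map_toList]
    exact one_mul _
  simp only [h1] at h0
  refine integral_evPoly_of_isHomogeneous (ι := ι) hg ?_ hc hgpos.ne' (h0.symm.trans ?_)
  · rw [← hJ]
    have : Fintype.card J = ∑ j : J, 1 := by simp
    rw [this]
    refine MvPolynomial.IsHomogeneous.prod _ _ _ fun j _ =>
      MvPolynomial.IsHomogeneous.sum _ _ _ fun i _ => ?_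
    rw [MvPolynomial.smul_eq_C_mul]
    exact MvPolynomial.isHomogeneous_C_mul_X _ _
  · rw [← integral_zero (Blocks K ι) ℂ]
    refine integral_congr_ae (Filter.Eventually.of_forall fun a => ?_)
    dsimp only
    by_cases ha : a ∈ shell K ι
    · obtain ⟨j, hj⟩ := hlarge a ha
      rw [density, evalAt_prod_deformedWt a _ _ _ _ _ ⟨j, by simp, hpart j a hj⟩, map_zero,
        map_zero]
      rfl
    · exact evPoly_eq_zero hg _ ha

end CommonZero

section TripleCoordinates

open scoped ContDiff ComplexConjugate

variable {M : ℕ}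

/-- The alternating form `x ↦ det (row p · x q)` on `ℂ^M`. -/
def rowDet {n : ℕ} (a : Fin n → Fin M → ℂ) : (EuclideanSpace ℂ (Fin M)) [⋀^Fin n]→ₗ[ℂ] ℂ :=
  Matrix.detRowAlternating.compLinearMap
    (LinearMap.pi fun p => ∑ r, a p r • (EuclideanSpace.proj r).toLinearMap)

lemma rowDet_apply {n : ℕ} (a : Fin n → Fin M → ℂ) (x : Fin n → EuclideanSpace ℂ (Fin M)) :
    rowDet a x = (Matrix.of fun p q => ∑ r, a q r * x p r).det := by
  simp only [rowDet, AlternatingMap.compLinearMap_apply]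
  change Matrix.det _ = _
  congr 1
  ext p q
  simp [LinearMap.sum_apply]

/-- The linear form on the exterior algebra extending `rowDet a` by zero in other degrees. -/
def rowForm {n : ℕ} (a : Fin n → Fin M → ℂ) :
    ExteriorAlgebra ℂ (EuclideanSpace ℂ (Fin M)) →ₗ[ℂ] ℂ :=
  ExteriorAlgebra.liftAlternating (Pi.single n (rowDet a))

lemma rowForm_ιMulti {n : ℕ} (a : Fin n → Fin M → ℂ) (x : Fin n → EuclideanSpace ℂ (Fin M)) :
    rowForm a (ExteriorAlgebra.ιMulti ℂ n x) = (Matrix.of fun p q => ∑ r, a q r * x p r).det := by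
  rw [rowForm, ExteriorAlgebra.liftAlternating_apply_ιMulti, Pi.single_eq_same, rowDet_apply]

lemma rowForm_smul {n : ℕ} (c : Fin n → ℂ) (a : Fin n → Fin M → ℂ) :
    rowForm (fun p => c p • a p) = (∏ p, c p) • rowForm a := by
  have : rowDet (fun p => c p • a p) = (∏ p, c p) • rowDet a := by
    ext x
    rw [AlternatingMap.smul_apply, rowDet_apply, rowDet_apply, smul_eq_mul, ← Matrix.det_mul_row]
    congr 1
    ext p q
    simp [Finset.mul_sum, mul_assoc]
  rw [rowForm, this, Pi.single_smul, map_smul]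
  rfl

lemma exteriorPower_induction {n : ℕ} {E : Type*} [AddCommGroup E] [Module ℂ E]
    {motive : ExteriorAlgebra ℂ E → Prop}
    (hι : ∀ x : Fin n → E, motive (ExteriorAlgebra.ιMulti ℂ n x))
    (h0 : motive 0) (hadd : ∀ x y, motive x → motive y → motive (x + y))
    (hsmul : ∀ (c : ℂ) x, motive x → motive (c • x)) {ψ : ExteriorAlgebra ℂ E}
    (hψ : ψ ∈ ⋀[ℂ]^n E) : motive ψ := by
  rw [← ExteriorAlgebra.ιMulti_span_fixedDegree] at hψ
  induction hψ using Submodule.span_induction with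
  | mem x hx => obtain ⟨v, rfl⟩ := hx; exact hι v
  | zero => exact h0
  | add x y _ _ hx hy => exact hadd x y hx hy
  | smul c x _ hx => exact hsmul c x hx

lemma contDiff_rowForm {n : ℕ} {X : Type*} [NormedAddCommGroup X] [NormedSpace ℝ X]
    {a : X → Fin n → Fin M → ℂ} (ha : ContDiff ℝ ∞ a)
    {ψ : ExteriorAlgebra ℂ (EuclideanSpace ℂ (Fin M))}
    (hψ : ψ ∈ ⋀[ℂ]^n (EuclideanSpace ℂ (Fin M))) :
    ContDiff ℝ ∞ fun y => rowForm (a y) ψ := by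
  refine exteriorPower_induction (motive := fun ψ => ContDiff ℝ ∞ fun y => rowForm (a y) ψ)
    (fun x => ?_) ?_ (fun x y hx hy => ?_) (fun c x hx => ?_) hψ
  · simp only [rowForm_ιMulti, Matrix.det_apply, Matrix.of_apply]
    have h : ∀ q r, ContDiff ℝ ∞ fun y => a y q r := fun q r =>
      contDiff_pi.1 (contDiff_pi.1 ha q) r
    exact ContDiff.sum fun σ _ => ContDiff.const_smul _ (contDiff_prod fun p _ =>
      ContDiff.sum fun r _ => (h _ r).mul contDiff_const)
  · simpa using contDiff_const
  · simpa using hx.add hy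
  · simpa using contDiff_const.mul hx

lemma rowForm_map {n : ℕ} (a : Fin n → Fin M → ℂ)
    (f : EuclideanSpace ℂ (Fin M) →ₗ[ℂ] EuclideanSpace ℂ (Fin M)) (b : Fin n → Fin M → ℂ)
    (h : ∀ p x, ∑ r, a p r * f x r = ∑ r, b p r * x r)
    {ψ : ExteriorAlgebra ℂ (EuclideanSpace ℂ (Fin M))}
    (hψ : ψ ∈ ⋀[ℂ]^n (EuclideanSpace ℂ (Fin M))) :
    rowForm a (ExteriorAlgebra.map f ψ) = rowForm b ψ := by
  refine exteriorPower_induction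
    (motive := fun ψ => rowForm a (ExteriorAlgebra.map f ψ) = rowForm b ψ)
    (fun x => ?_) ?_ (fun x y hx hy => ?_) (fun c x hx => ?_) hψ
  · rw [ExteriorAlgebra.map_apply_ιMulti, rowForm_ιMulti, rowForm_ιMulti]
    simp [h]
  · simp
  · simp [hx, hy]
  · simp [hx]

lemma map_mem_exteriorPower {n : ℕ} {E : Type*} [AddCommGroup E] [Module ℂ E] (f : E →ₗ[ℂ] E)
    {ψ : ExteriorAlgebra ℂ E} (hψ : ψ ∈ ⋀[ℂ]^n E) : ExteriorAlgebra.map f ψ ∈ ⋀[ℂ]^n E := by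
  refine exteriorPower_induction (motive := fun ψ => ExteriorAlgebra.map f ψ ∈ ⋀[ℂ]^n E)
    (fun x => ?_) ?_ (fun x y hx hy => ?_) (fun c x hx => ?_) hψ
  · rw [ExteriorAlgebra.map_apply_ιMulti, ← ExteriorAlgebra.ιMulti_span_fixedDegree]
    exact Submodule.subset_span ⟨_, rfl⟩
  · simp
  · rw [map_add]; exact add_mem hx hy
  · rw [map_smul]; exact Submodule.smul_mem _ _ hx

/-- A square matrix with orthonormal rows acts as a linear isometry. -/
lemma exists_linearIsometryEquiv_of_rows (B : Matrix (Fin M) (Fin M) ℂ)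
    (hB : ∀ i j, ∑ r, B i r * conj (B j r) = if i = j then 1 else 0) :
    ∃ U : EuclideanSpace ℂ (Fin M) ≃ₗᵢ[ℂ] EuclideanSpace ℂ (Fin M),
      ∀ x i, U x i = ∑ r, B i r * x r := by
  have h1 : B * star B = 1 := by
    ext i j
    simpa [Matrix.mul_apply, Matrix.star_apply, Matrix.one_apply] using hB i j
  have h2 : B ∈ unitary (Matrix (Fin M) (Fin M) ℂ) :=
    Unitary.mem_iff.2 ⟨mul_eq_one_comm.1 h1, h1⟩
  let T := Matrix.toEuclideanCLM (n := Fin M) (𝕜 := ℂ) B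
  have h3 : T ∈ unitary _ := Unitary.map_mem (Matrix.toEuclideanCLM (n := Fin M) (𝕜 := ℂ)) h2
  refine ⟨Unitary.linearIsometryEquiv ⟨T, h3⟩, fun x i => ?_⟩
  rfl

end TripleCoordinates

section UnitaryNormalForm

open scoped ContDiff ComplexConjugate

variable {M : ℕ}

/-- The entries of a triple. -/
def tripleEntry (t : Fin M × Fin M × Fin M) : Fin 3 → Fin M := ![t.1, t.2.1, t.2.2]

lemma exists_unitary_rowForm_eq_zero [NeZero M] (T : List (Fin M × Fin M × Fin M))
    (hcard : T.length + Fintype.card {p : Fin M × Fin M // p.1 < p.2} = M * (M - 1))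
    (hc : ((T.map fun t => ∑ p, MvPolynomial.X (tripleEntry t p)).prod *
      ∏ p : {p : Fin M × Fin M // p.1 < p.2}, (MvPolynomial.X p.1.2 - MvPolynomial.X p.1.1) :
        MvPolynomial (Fin M) ℂ).coeff (Finsupp.equivFunOnFinite.symm fun _ => M - 1) ≠ 0)
    {ψ : ExteriorAlgebra ℂ (EuclideanSpace ℂ (Fin M))}
    (hψ : ψ ∈ ⋀[ℂ]^3 (EuclideanSpace ℂ (Fin M))) :
    ∃ U : EuclideanSpace ℂ (Fin M) ≃ₗᵢ[ℂ] EuclideanSpace ℂ (Fin M), ∀ t ∈ T,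
      rowForm (fun p => Pi.single (tripleEntry t p) 1)
        (ExteriorAlgebra.map U.toLinearEquiv.toLinearMap ψ) = 0 := by
  let G : Fin T.length ⊕ {p : Fin M × Fin M // p.1 < p.2} → (Fin M → Fin M → ℂ) → ℂ :=
    Sum.elim (fun j z => rowForm (fun p => z (tripleEntry (T.get j) p)) ψ)
      (fun q z => ∑ r, z q.1.2 r * conj (z q.1.1 r))
  let χ : Fin T.length ⊕ {p : Fin M × Fin M // p.1 < p.2} → Fin M → ℝ :=
    Sum.elim (fun j i => ∑ p, if tripleEntry (T.get j) p = i then 1 else 0)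
      (fun q i => (if q.1.2 = i then 1 else 0) - (if q.1.1 = i then 1 else 0))
  obtain ⟨z, hz0, hz⟩ : ∃ z : Fin M → Fin M → ℂ, (∀ i, z i ≠ 0) ∧ ∀ j, G j z = 0 := by
    refine exists_common_zero χ G ?_ ?_ ?_ ?_
    · rintro (j | q)
      · exact contDiff_rowForm (contDiff_pi.2 fun p => contDiff_apply ℝ _ _) hψ
      · have h : ∀ i r, ContDiff ℝ ∞ fun z : Fin M → Fin M → ℂ => z i r := fun i r =>
          contDiff_pi.1 (contDiff_apply ℝ _ i) r
        exact ContDiff.sum fun r _ => (h _ r).mul (Complex.conjCLE.contDiff.comp (h _ r))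
    · rintro (j | q) z i θ
      · let c : Fin 3 → ℂ := fun p => if tripleEntry (T.get j) p = i then
          Complex.exp (θ * Complex.I) else 1
        have h1 : (fun p => Function.update z i (Complex.exp (θ * Complex.I) • z i)
            (tripleEntry (T.get j) p)) = fun p => c p • z (tripleEntry (T.get j) p) := by
          funext p
          dsimp only [c]
          generalize tripleEntry (T.get j) p = k
          by_cases h : k = i
          · subst h; simp
          · simp [h]
        change rowForm (fun p => Function.update z i (Complex.exp (θ * Complex.I) • z i)
            (tripleEntry (T.get j) p)) ψ = _
        rw [h1, rowForm_smul]
        change (∏ p, c p) * rowForm _ ψ = _ * rowForm _ ψ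
        congr 1
        simp only [χ, Sum.elim_inl, c]
        push_cast
        rw [Finset.sum_mul, Finset.sum_mul, Complex.exp_sum]
        refine Finset.prod_congr rfl fun p _ => ?_
        split_ifs <;> simp
      · have hne : q.1.1 ≠ q.1.2 := q.2.ne
        simp only [G, χ, Sum.elim_inr, Finset.mul_sum]
        refine Finset.sum_congr rfl fun r _ => ?_
        by_cases h1 : q.1.2 = i
        · have h2 : q.1.1 ≠ i := fun h => hne (h.trans h1.symm)
          simp [h1, h2, mul_assoc]
        · by_cases h2 : q.1.1 = i
          · simp [h1, h2, ← Complex.exp_conj]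
            ring
          · simp [h1, h2]
    · simp [hcard]
    · have h1 : ∀ i : Fin M, (charPoly fun k => if i = k then (1 : ℂ) else 0) =
          MvPolynomial.X i := fun i => by simp [charPoly]
      have h2 : ∀ j, (charPoly fun i => ((χ (Sum.inl j) i : ℝ) : ℂ)) =
          ∑ p, MvPolynomial.X (tripleEntry (T.get j) p) := fun j => by
        rw [Finset.sum_congr rfl fun p _ => (h1 (tripleEntry (T.get j) p)).symm]
        simp only [charPoly, χ, Sum.elim_inl]
        rw [Finset.sum_comm]
        refine Finset.sum_congr rfl fun k _ => ?_
        push_cast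
        rw [Finset.sum_smul]
        exact Finset.sum_congr rfl fun p _ => by split_ifs <;> simp
      have h3 : ∀ q, (charPoly fun i => ((χ (Sum.inr q) i : ℝ) : ℂ)) =
          MvPolynomial.X q.1.2 - MvPolynomial.X q.1.1 := fun q => by
        rw [← h1 q.1.2, ← h1 q.1.1]
        simp only [charPoly, χ, Sum.elim_inr]
        rw [← Finset.sum_sub_distrib]
        refine Finset.sum_congr rfl fun k _ => ?_
        push_cast
        rw [sub_smul]
        split_ifs <;> simp
      have h4 : (∏ j : Fin T.length, ∑ p, MvPolynomial.X (tripleEntry (T.get j) p) :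
          MvPolynomial (Fin M) ℂ) =
          (T.map fun t => ∑ p, MvPolynomial.X (tripleEntry t p)).prod := by
        rw [← List.prod_ofFn]
        conv_rhs => rw [← List.ofFn_get T, List.map_ofFn]
        rfl
      rw [Fintype.prod_sum_type, Fintype.card_fin]
      simp only [h2, h3]
      rw [h4]
      exact hc
  have hzT : ∀ t ∈ T, rowForm (fun p => z (tripleEntry t p)) ψ = 0 := by
    intro t ht
    obtain ⟨j, rfl⟩ := List.get_of_mem ht
    exact hz (Sum.inl j)
  let N : Fin M → ℝ := fun i => √(∑ r, ‖z i r‖ ^ 2)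
  have hN2 : ∀ i, 0 < ∑ r, ‖z i r‖ ^ 2 := fun i => by
    obtain ⟨r, hr⟩ := Function.ne_iff.1 (hz0 i)
    exact Finset.sum_pos' (fun _ _ => by positivity) ⟨r, Finset.mem_univ r, by
      have : z i r ≠ 0 := hr
      positivity⟩
  have hN : ∀ i, (N i : ℂ) ≠ 0 := fun i => Complex.ofReal_ne_zero.2 (Real.sqrt_pos.2 (hN2 i)).ne'
  have horth : ∀ i j, i ≠ j → ∑ r, z i r * conj (z j r) = 0 := by
    have hlt : ∀ i j, i < j → ∑ r, z j r * conj (z i r) = 0 := fun i j h =>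
      hz (Sum.inr ⟨(i, j), h⟩)
    intro i j hij
    rcases lt_or_gt_of_ne hij with h | h
    · have := congrArg conj (hlt i j h)
      rw [map_sum, map_zero] at this
      rw [← this]
      exact Finset.sum_congr rfl fun r _ => by rw [map_mul, Complex.conj_conj, mul_comm]
    · exact hlt j i h
  obtain ⟨U, hU⟩ := exists_linearIsometryEquiv_of_rows (Matrix.of fun i r => (N i : ℂ)⁻¹ * z i r)
    fun i j => by
      have h1 : ∑ r, (N i : ℂ)⁻¹ * z i r * conj ((N j : ℂ)⁻¹ * z j r) =
          ((N i : ℂ)⁻¹ * (N j : ℂ)⁻¹) * ∑ r, z i r * conj (z j r) := by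
        rw [Finset.mul_sum]
        refine Finset.sum_congr rfl fun r _ => ?_
        rw [map_mul, map_inv₀, Complex.conj_ofReal]; ring
      simp only [Matrix.of_apply]
      rw [h1]
      split_ifs with hij
      · subst hij
        have h2 : ∑ r, z i r * conj (z i r) = (N i : ℂ) * N i := by
          rw [← Complex.ofReal_mul, Real.mul_self_sqrt (hN2 i).le, Complex.ofReal_sum]
          exact Finset.sum_congr rfl fun r _ => by
            rw [Complex.mul_conj, Complex.normSq_eq_norm_sq]
        rw [h2]
        field_simp [hN i]
      · rw [horth i j hij, mul_zero]
  refine ⟨U, fun t ht => ?_⟩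
  rw [rowForm_map (b := fun p => (N (tripleEntry t p) : ℂ)⁻¹ • z (tripleEntry t p)) _ _
    (fun p x => ?_) hψ, rowForm_smul, LinearMap.smul_apply, hzT t ht, smul_zero]
  change ∑ r, (Pi.single (tripleEntry t p) 1 : Fin M → ℂ) r * U x r = _
  simp [Pi.single_apply, hU]

end UnitaryNormalForm

section TopCoefficient

open MvPolynomial

variable {M : ℕ}

/-- The Vandermonde polynomial in the variables `X 0, …, X (M - 1)`. -/
def vandermondePoly (M : ℕ) : MvPolynomial (Fin M) ℂ :=
  (Matrix.vandermonde fun i : Fin M => (X i : MvPolynomial (Fin M) ℂ)).det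

/-- The coefficient of `∏ i, X i ^ (M - 1)` in the product of a polynomial with the Vandermonde
polynomial. -/
def topCoeff (M : ℕ) : MvPolynomial (Fin M) ℂ →ₗ[ℂ] ℂ :=
  lcoeff ℂ (Finsupp.equivFunOnFinite.symm fun _ => M - 1) ∘ₗ
    LinearMap.mulRight ℂ (vandermondePoly M)

lemma topCoeff_apply (f : MvPolynomial (Fin M) ℂ) : topCoeff M f =
    (f * vandermondePoly M).coeff (Finsupp.equivFunOnFinite.symm fun _ => M - 1) := rfl

lemma vandermondePoly_eq_sum : vandermondePoly M =
    ∑ σ : Equiv.Perm (Fin M), (Equiv.Perm.sign σ : ℤ) • ∏ i : Fin M, X (σ i) ^ (i : ℕ) := by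
  rw [vandermondePoly, Matrix.det_apply]
  rfl

lemma isHomogeneous_vandermondePoly :
    (vandermondePoly M).IsHomogeneous (∑ i : Fin M, (i : ℕ)) := by
  rw [vandermondePoly_eq_sum]
  refine IsHomogeneous.sum _ _ _ fun σ _ => ?_
  rw [zsmul_eq_mul, ← map_intCast (C : ℂ →+* MvPolynomial (Fin M) ℂ)]
  exact IsHomogeneous.C_mul (IsHomogeneous.prod _ _ _ fun i _ => by
    simpa using (isHomogeneous_X ℂ (σ i)).pow (i : ℕ)) _

lemma rename_vandermondePoly (σ : Equiv.Perm (Fin M)) :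
    rename σ (vandermondePoly M) = (Equiv.Perm.sign σ : ℤ) • vandermondePoly M := by
  have h : (rename σ).toRingHom (vandermondePoly M) =
      ((Matrix.vandermonde fun i : Fin M =>
        (X i : MvPolynomial (Fin M) ℂ)).submatrix σ id).det := by
    rw [vandermondePoly, RingHom.map_det]
    congr 1
    ext i j : 2
    simp [Matrix.vandermonde]
  rw [Matrix.det_permute, ← zsmul_eq_mul] at h
  exact h

lemma topCoeff_rename (σ : Equiv.Perm (Fin M)) (f : MvPolynomial (Fin M) ℂ) :
    topCoeff M (rename σ f) = (Equiv.Perm.sign σ : ℤ) • topCoeff M f := by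
  have h1 : vandermondePoly M = (Equiv.Perm.sign σ : ℤ) • rename σ (vandermondePoly M) := by
    rw [rename_vandermondePoly, smul_smul]
    simp [← Units.val_mul]
  have h2 : (Finsupp.equivFunOnFinite.symm fun _ : Fin M => M - 1) =
      Finsupp.mapDomain σ (Finsupp.equivFunOnFinite.symm fun _ : Fin M => M - 1) := by
    ext i
    obtain ⟨i, rfl⟩ := σ.surjective i
    rw [Finsupp.mapDomain_apply σ.injective]
    simp
  have h3 : rename σ f * vandermondePoly M =
      (Equiv.Perm.sign σ : ℤ) • rename σ (f * vandermondePoly M) := by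
    conv_lhs => rw [h1]
    rw [mul_smul_comm, map_mul]
  rw [topCoeff_apply, topCoeff_apply, h3, coeff_smul]
  conv_lhs => rw [h2, coeff_rename_mapDomain σ σ.injective]

lemma topCoeff_eq_neg_of_swap {i j : Fin M} (hij : i ≠ j) {f g : MvPolynomial (Fin M) ℂ}
    (h : rename (Equiv.swap i j) f = g) : topCoeff M g = - topCoeff M f := by
  rw [← h, topCoeff_rename, Equiv.Perm.sign_swap hij]
  simp

lemma topCoeff_X_pow_mul (i : Fin M) {k : ℕ} (hk : M ≤ k) (f : MvPolynomial (Fin M) ℂ) :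
    topCoeff M (X i ^ k * f) = 0 := by
  classical
  rw [topCoeff_apply, mul_assoc, X_pow_eq_monomial, coeff_monomial_mul', if_neg]
  intro h
  have := h i
  simp at this
  have := i.2
  omega

lemma coeff_mul_vandermondePoly_eq_zero {s : MvPolynomial (Fin M) ℂ} (hs : s.IsSymmetric) {k : ℕ}
    (hk : s.IsHomogeneous k) (hk0 : k ≠ 0) {m : Fin M →₀ ℕ} (hm : ∀ i, m i < M) :
    (s * vandermondePoly M).coeff m = 0 := by
  by_cases hinj : Function.Injective m
  · have h1 := hk.mul (isHomogeneous_vandermondePoly (M := M))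
    refine h1.coeff_eq_zero fun h => ?_
    let e : Fin M → Fin M := fun i => ⟨m i, hm i⟩
    have he : Function.Bijective e := Finite.injective_iff_bijective.1 fun i j hij =>
      hinj (Fin.mk.inj_iff.1 hij)
    have h2 : ∑ i, m i = ∑ i : Fin M, (i : ℕ) :=
      he.sum_comp (fun i : Fin M => (i : ℕ))
    rw [Finsupp.degree_eq_sum, h2] at h
    omega
  · obtain ⟨i, j, hij, hne⟩ : ∃ i j, m i = m j ∧ i ≠ j := by
      simpa [Function.Injective] using hinj
    have h1 : rename (Equiv.swap i j) (s * vandermondePoly M) = -(s * vandermondePoly M) := by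
      rw [map_mul, hs, rename_vandermondePoly, Equiv.Perm.sign_swap hne]
      simp
    have h2 : m = Finsupp.mapDomain (Equiv.swap i j) m := by
      ext k
      obtain ⟨k, rfl⟩ := (Equiv.swap i j).surjective k
      rw [Finsupp.mapDomain_apply (Equiv.swap i j).injective, Equiv.swap_apply_def]
      split_ifs with h h' <;> simp_all
    have h3 := coeff_rename_mapDomain _ (Equiv.swap i j).injective (s * vandermondePoly M) m
    rw [h1, ← h2, coeff_neg] at h3
    exact self_eq_neg.1 h3.symm

/-- The ideal generated by the elementary symmetric polynomials of positive degree. -/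
def coinvariantIdeal (M : ℕ) : Ideal (MvPolynomial (Fin M) ℂ) :=
  Ideal.span {f | ∃ k ≠ 0, f = esymm (Fin M) ℂ k}

lemma isHomogeneous_esymm (k : ℕ) : (esymm (Fin M) ℂ k).IsHomogeneous k := by
  refine IsHomogeneous.sum _ _ _ fun s hs => ?_
  have := IsHomogeneous.prod s (fun i => (X i : MvPolynomial (Fin M) ℂ)) (fun _ => 1)
    fun i _ => isHomogeneous_X ℂ i
  simpa [(Finset.mem_powersetCard.1 hs).2] using this

lemma topCoeff_eq_zero_of_mem [NeZero M] {f : MvPolynomial (Fin M) ℂ}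
    (hf : f ∈ coinvariantIdeal M) :
    topCoeff M f = 0 := by
  classical
  suffices h : ∀ g, topCoeff M (g * f) = 0 by simpa using h 1
  induction hf using Submodule.span_induction with
  | mem f hf =>
    obtain ⟨k, hk, rfl⟩ := hf
    intro g
    rw [topCoeff_apply, mul_assoc, coeff_mul]
    refine Finset.sum_eq_zero fun p hp => ?_
    rw [coeff_mul_vandermondePoly_eq_zero (esymm_isSymmetric _ _ k) (isHomogeneous_esymm k) hk,
      mul_zero]
    intro i
    have h := DFunLike.congr_fun (Finset.HasAntidiagonal.mem_antidiagonal.1 hp) i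
    simp at h
    have := NeZero.pos M
    omega
  | zero => simp
  | add x y _ _ hx hy => intro g; rw [mul_add, map_add, hx, hy, add_zero]
  | smul a x _ hx => intro g; rw [smul_eq_mul, ← mul_assoc, hx]

lemma topCoeff_congr [NeZero M] {f g : MvPolynomial (Fin M) ℂ}
    (h : Ideal.Quotient.mk (coinvariantIdeal M) f = Ideal.Quotient.mk (coinvariantIdeal M) g) :
    topCoeff M f = topCoeff M g := by
  rw [← sub_eq_zero, ← map_sub]
  exact topCoeff_eq_zero_of_mem (Ideal.Quotient.eq.1 h)

lemma topCoeff_staircase : topCoeff M (∏ i : Fin M, X i ^ (M - 1 - i : ℕ)) = 1 := by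
  classical
  have hmon : ∀ f : Fin M → ℕ, ∏ i, (X i : MvPolynomial (Fin M) ℂ) ^ f i =
      monomial (Finsupp.equivFunOnFinite.symm f) 1 := fun f => by
    rw [monomial_eq, Finsupp.prod_fintype _ _ (by simp)]
    simp
  rw [topCoeff_apply, vandermondePoly_eq_sum, Finset.mul_sum, coeff_sum,
    Finset.sum_eq_single (1 : Equiv.Perm (Fin M))]
  · simp only [Equiv.Perm.sign_one, Equiv.Perm.coe_one, id]
    rw [Units.val_one, one_smul, ← Finset.prod_mul_distrib]
    simp only [← pow_add]
    rw [hmon, coeff_monomial, if_pos]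
    congr 1
    funext i
    omega
  · intro σ _ hσ
    rw [mul_smul_comm, coeff_smul]
    have : ∏ i : Fin M, (X (σ i) : MvPolynomial (Fin M) ℂ) ^ (i : ℕ) =
        ∏ i : Fin M, X i ^ ((σ.symm i : Fin M) : ℕ) := by
      rw [← Equiv.prod_comp σ fun i => (X i : MvPolynomial (Fin M) ℂ) ^ ((σ.symm i : Fin M) : ℕ)]
      simp only [Equiv.symm_apply_apply]
    rw [this, ← Finset.prod_mul_distrib]
    simp only [← pow_add]
    rw [hmon, coeff_monomial, if_neg, smul_zero]
    intro h
    refine hσ ((Equiv.symm_symm σ).symm.trans ?_)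
    have : σ.symm = 1 := Equiv.ext fun i => Fin.ext (by
      have := congrFun (Finsupp.equivFunOnFinite.symm.injective h) i
      change ((σ.symm i : Fin M) : ℕ) = i
      have := (σ.symm i).2
      omega)
    rw [this]; rfl
  · simp

end TopCoefficient

section PairReduction

variable {A : Type*} [CommRing A]

/-- The complete homogeneous polynomial of degree `r` in two variables. -/
def completeHom (a b : A) (r : ℕ) : A := ∑ p ∈ Finset.range (r + 1), a ^ p * b ^ (r - p)

lemma completeHom_succ (a b : A) (r : ℕ) :
    completeHom a b (r + 1) = b * completeHom a b r + a ^ (r + 1) := by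
  rw [completeHom, Finset.sum_range_succ, completeHom, Finset.mul_sum]
  simp only [Nat.sub_self, pow_zero, mul_one]
  congr 1
  refine Finset.sum_congr rfl fun p hp => ?_
  rw [Nat.succ_sub (Finset.mem_range_succ_iff.1 hp), pow_succ]
  ring

lemma completeHom_add_two (a b : A) (r : ℕ) : completeHom a b (r + 2) =
    (a + b) * completeHom a b (r + 1) - a * b * completeHom a b r := by
  rw [completeHom_succ a b (r + 1), completeHom_succ a b r]
  ring

/-- The polynomial part of `T ^ (n + 2) / ((T + a) * (T + b))`. -/
def pairQuotient (T a b : A) : ℕ → A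
  | 0 => 1
  | n + 1 => T * pairQuotient T a b n + (-1) ^ (n + 1) * completeHom a b (n + 1)

lemma mul_pairQuotient (T a b : A) (n : ℕ) : (T + a) * (T + b) * pairQuotient T a b n =
    T ^ (n + 2) + (-1) ^ n * (completeHom a b (n + 1) * T + a * b * completeHom a b n) := by
  induction n with
  | zero => simp [pairQuotient, completeHom, Finset.sum_range_succ]; ring
  | succ n ih =>
    rw [pairQuotient, mul_add, mul_left_comm, ih, completeHom_add_two]
    ring

lemma map_pairQuotient {B : Type*} [CommRing B] (f : A →+* B) (T a b : A) (n : ℕ) :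
    f (pairQuotient T a b n) = pairQuotient (f T) (f a) (f b) n := by
  induction n with
  | zero => simp [pairQuotient]
  | succ n ih => simp [pairQuotient, ih, completeHom]

open Polynomial in
lemma eq_pairQuotient {a b : A} {n : ℕ} {Q : A[X]}
    (hQ : (X + C a) * (X + C b) * Q = X ^ (n + 2)) : Q = pairQuotient X (C a) (C b) n := by
  nontriviality A
  have hm : ((X + C a) * (X + C b)).Monic := (monic_X_add_C a).mul (monic_X_add_C b)
  have hdeg : ((X + C a) * (X + C b)).degree = 2 := by
    rw [(monic_X_add_C b).degree_mul, degree_X_add_C, degree_X_add_C]; rfl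
  have h1 := div_modByMonic_unique Q 0 hm ⟨by rw [zero_add, hQ], by
    rw [degree_zero, hdeg]; exact bot_lt_iff_ne_bot.2 (by simp)⟩
  have h2 := div_modByMonic_unique (f := X ^ (n + 2)) (pairQuotient X (C a) (C b) n)
    (C (-((-1) ^ n * completeHom a b (n + 1))) * X + C (-((-1) ^ n * (a * b * completeHom a b n))))
    hm ⟨by
      rw [mul_pairQuotient]
      simp only [completeHom, map_neg, map_mul, map_pow, map_one, map_sum]
      ring, by
      rw [hdeg]
      exact (degree_linear_le).trans_lt (by norm_num)⟩
  exact h1.1.symm.trans h2.1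

lemma prod_eq_pairQuotient {ι : Type*} [Fintype ι] [DecidableEq ι] {x : ι → A} {n : ℕ}
    (hx : ∏ i, (Polynomial.X + Polynomial.C (x i)) = Polynomial.X ^ (n + 2))
    {i j : ι} (hij : i ≠ j) :
    ∏ k with k ≠ i ∧ k ≠ j, (x i + x j + x k) = pairQuotient (x i + x j) (x i) (x j) n := by
  have h1 : (Polynomial.X + Polynomial.C (x i)) * (Polynomial.X + Polynomial.C (x j)) *
      ∏ k with k ≠ i ∧ k ≠ j, (Polynomial.X + Polynomial.C (x k)) = Polynomial.X ^ (n + 2) := by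
    rw [← hx, ← Finset.prod_pair (f := fun k => Polynomial.X + Polynomial.C (x k)) hij,
      ← Finset.prod_filter_mul_prod_filter_not Finset.univ (fun k => ¬ (k ≠ i ∧ k ≠ j))]
    congr 1
    · refine Finset.prod_congr ?_ fun _ _ => rfl
      ext k
      simp only [Finset.mem_insert, Finset.mem_singleton, Finset.mem_filter, Finset.mem_univ]
      tauto
    · simp only [not_not]
  have h2 := congrArg (Polynomial.evalRingHom (x i + x j)) (eq_pairQuotient h1)
  rw [map_pairQuotient, map_prod] at h2
  simpa using h2

open MvPolynomial in
/-- The image of the `i`-th variable in the coinvariant ring. -/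
def coinvariantVar {M : ℕ} (i : Fin M) : MvPolynomial (Fin M) ℂ ⧸ coinvariantIdeal M :=
  Ideal.Quotient.mk _ (X i)

lemma prod_X_add_C_coinvariantVar {M : ℕ} :
    ∏ i : Fin M, (Polynomial.X + Polynomial.C (coinvariantVar i)) = Polynomial.X ^ M := by
  have h := congrArg (Polynomial.map (Ideal.Quotient.mk (coinvariantIdeal M)))
    (MvPolynomial.prod_C_add_X_eq_sum_esymm ℂ (Fin M))
  rw [Polynomial.map_prod, Polynomial.map_sum, Finset.sum_eq_single 0] at h
  · simpa [coinvariantVar] using h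
  · intro k _ hk
    have : Ideal.Quotient.mk (coinvariantIdeal M) (MvPolynomial.esymm (Fin M) ℂ k) = 0 :=
      Ideal.Quotient.eq_zero_iff_mem.2 (Ideal.subset_span ⟨k, hk, rfl⟩)
    simp [this]
  · simp

open MvPolynomial in
/-- Modulo positive degree symmetric polynomials, the product of the trinomials containing
`X i + X j` only depends on `X i` and `X j`. -/
lemma mk_prod_eq_mk_pairQuotient {n : ℕ} {i j : Fin (n + 2)} (hij : i ≠ j) :
    Ideal.Quotient.mk (coinvariantIdeal (n + 2))
      (∏ k with k ≠ i ∧ k ≠ j, (X i + X j + X k)) =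
    Ideal.Quotient.mk (coinvariantIdeal (n + 2)) (pairQuotient (X i + X j) (X i) (X j) n) := by
  rw [map_pairQuotient, map_prod]
  exact prod_eq_pairQuotient prod_X_add_C_coinvariantVar hij

end PairReduction

section FormalSums

variable {σ τ A : Type*} [CommRing A]

/-- The value of a formal integral linear combination. -/
def formalSum (F : σ → A) (L : List (ℤ × σ)) : A := (L.map fun p => (p.1 : A) * F p.2).sum

@[simp] lemma formalSum_nil (F : σ → A) : formalSum F [] = 0 := rfl

@[simp] lemma formalSum_cons (F : σ → A) (p : ℤ × σ) (L : List (ℤ × σ)) :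
    formalSum F (p :: L) = p.1 * F p.2 + formalSum F L := by simp [formalSum]

@[simp] lemma formalSum_append (F : σ → A) (L L' : List (ℤ × σ)) :
    formalSum F (L ++ L') = formalSum F L + formalSum F L' := by simp [formalSum]

lemma formalSum_map (F : τ → A) (g : σ → τ) (c : ℤ) (L : List (ℤ × σ)) :
    formalSum F (L.map fun p => (c * p.1, g p.2)) = c * formalSum (fun s => F (g s)) L := by
  induction L with
  | nil => simp
  | cons p L ih => simp [ih, mul_add, mul_assoc]

/-- Substitution of formal linear combinations. -/
def formalBind (L : List (ℤ × σ)) (g : σ → List (ℤ × τ)) : List (ℤ × τ) :=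
  L.flatMap fun p => (g p.2).map fun q => (p.1 * q.1, q.2)

lemma formalSum_bind (F : τ → A) (L : List (ℤ × σ)) (g : σ → List (ℤ × τ)) :
    formalSum F (formalBind L g) = formalSum (fun s => formalSum F (g s)) L := by
  induction L with
  | nil => simp [formalBind]
  | cons p L ih =>
    rw [formalBind, List.flatMap_cons, formalSum_append, formalSum_cons, ← ih, formalBind]
    congr 1
    exact formalSum_map F id p.1 _

lemma formalSum_mul_left (F : σ → A) (a : A) (L : List (ℤ × σ)) :
    a * formalSum F L = formalSum (fun s => a * F s) L := by
  induction L with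
  | nil => simp
  | cons p L ih => simp [← ih, mul_add, mul_left_comm]

lemma formalSum_congr {F G : σ → A} (h : ∀ s, F s = G s) (L : List (ℤ × σ)) :
    formalSum F L = formalSum G L := by rw [funext h]

lemma map_formalSum {B G : Type*} [CommRing B] [FunLike G A B] [AddMonoidHomClass G A B] (f : G)
    (F : σ → A) (L : List (ℤ × σ)) : f (formalSum F L) = formalSum (fun s => f (F s)) L := by
  induction L with
  | nil => simp
  | cons p L ih => simp [ih, ← zsmul_eq_mul]

/-- Merging of formal sums sorted by `cmp`; the first argument bounds the recursion depth. -/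
def mergeSums (cmp : σ → σ → Ordering) : ℕ → List (ℤ × σ) → List (ℤ × σ) → List (ℤ × σ)
  | 0, L, L' => L ++ L'
  | _ + 1, [], L' => L'
  | _ + 1, p :: L, [] => p :: L
  | n + 1, p :: L, q :: L' =>
    match cmp p.2 q.2 with
    | .lt => p :: mergeSums cmp n L (q :: L')
    | .gt => q :: mergeSums cmp n (p :: L) L'
    | .eq => (p.1 + q.1, p.2) :: mergeSums cmp n L L'

lemma formalSum_mergeSums {cmp : σ → σ → Ordering} (hcmp : ∀ s t, cmp s t = .eq → s = t)
    (F : σ → A) (n : ℕ) (L L' : List (ℤ × σ)) :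
    formalSum F (mergeSums cmp n L L') = formalSum F L + formalSum F L' := by
  induction n generalizing L L' with
  | zero => simp [mergeSums]
  | succ n ih =>
    match L, L' with
    | [], L' => simp [mergeSums]
    | p :: L, [] => simp [mergeSums]
    | p :: L, q :: L' =>
      rw [mergeSums]
      split
      · simp [ih, add_assoc]
      · simp [ih]; ring
      · next h => simp [ih, hcmp _ _ h]; ring

/-- One round of pairwise merging. -/
def mergePairs (cmp : σ → σ → Ordering) : List (List (ℤ × σ)) → List (List (ℤ × σ))
  | L :: L' :: R => mergeSums cmp 100000 L L' :: mergePairs cmp R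
  | [L] => [L]
  | [] => []

lemma formalSum_mergePairs {cmp : σ → σ → Ordering} (hcmp : ∀ s t, cmp s t = .eq → s = t)
    (F : σ → A) : ∀ R : List (List (ℤ × σ)),
    formalSum F (mergePairs cmp R).flatten = formalSum F R.flatten
  | L :: L' :: R => by
    simp [mergePairs, formalSum_mergeSums hcmp, formalSum_mergePairs hcmp F R, add_assoc]
  | [L] => rfl
  | [] => rfl

/-- Collection of equal terms by merge sort. -/
def collectTerms (cmp : σ → σ → Ordering) (L : List (ℤ × σ)) : List (ℤ × σ) :=
  ((mergePairs cmp)^[16] (L.map fun p => [p])).flatten.filter fun p => p.1 != 0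

lemma formalSum_filter (F : σ → A) (L : List (ℤ × σ)) :
    formalSum F (L.filter fun p => p.1 != 0) = formalSum F L := by
  induction L with
  | nil => rfl
  | cons p L ih =>
    rw [List.filter_cons]
    by_cases h : p.1 = 0 <;> simp [h, ih]

lemma formalSum_collectTerms {cmp : σ → σ → Ordering} (hcmp : ∀ s t, cmp s t = .eq → s = t)
    (F : σ → A) (L : List (ℤ × σ)) : formalSum F (collectTerms cmp L) = formalSum F L := by
  have h : ∀ (k : ℕ) (R : List (List (ℤ × σ))),
      formalSum F ((mergePairs cmp)^[k] R).flatten = formalSum F R.flatten := by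
    intro k
    induction k with
    | zero => exact fun R => rfl
    | succ k ih =>
      intro R
      rw [Function.iterate_succ_apply, ih, formalSum_mergePairs hcmp]
  rw [collectTerms, formalSum_filter, h, ← List.flatMap_def]
  simp

/-- Comparison of natural numbers. -/
def natCmp (a b : ℕ) : Ordering :=
  match Nat.ble a b with
  | false => .gt
  | true => match Nat.beq a b with
    | true => .eq
    | false => .lt

lemma eq_of_natCmp {a b : ℕ} (h : natCmp a b = .eq) : a = b := by
  unfold natCmp at h
  split at h
  · cases h
  · split at h
    · next h' => exact Nat.eq_of_beq_eq_true h'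
    · cases h

/-- Lexicographic comparison of lists. -/
def listCmp : List ℕ → List ℕ → Ordering
  | [], [] => .eq
  | [], _ :: _ => .lt
  | _ :: _, [] => .gt
  | a :: l, b :: l' =>
    match natCmp a b with
    | .lt => .lt
    | .gt => .gt
    | .eq => listCmp l l'

lemma eq_of_listCmp : ∀ {l l' : List ℕ}, listCmp l l' = .eq → l = l'
  | [], [], _ => rfl
  | [], _ :: _, h => by cases h
  | _ :: _, [], h => by cases h
  | a :: l, b :: l', h => by
    rw [listCmp] at h
    split at h
    · cases h
    · cases h
    · next h' => rw [eq_of_natCmp h', eq_of_listCmp h]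

/-- Lexicographic comparison of pairs. -/
def pairCmp {α β : Type*} (f : α → α → Ordering) (g : β → β → Ordering) (p q : α × β) : Ordering :=
  match f p.1 q.1 with
  | .lt => .lt
  | .gt => .gt
  | .eq => g p.2 q.2

lemma eq_of_pairCmp {α β : Type*} {f : α → α → Ordering} {g : β → β → Ordering}
    (hf : ∀ s t, f s t = .eq → s = t) (hg : ∀ s t, g s t = .eq → s = t) (p q : α × β)
    (h : pairCmp f g p q = .eq) : p = q := by
  rw [pairCmp] at h
  split at h
  · cases h
  · cases h
  · next h' => exact Prod.ext (hf _ _ h') (hg _ _ h)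

/-- The coefficients of `pairQuotient (a + b) a b n` as a polynomial in `a` and `b`. -/
def pairTerms : ℕ → List (ℤ × ℕ × ℕ)
  | 0 => [(1, 0, 0)]
  | n + 1 => collectTerms (pairCmp natCmp natCmp)
      ((pairTerms n).map (fun p => (1 * p.1, p.2.1 + 1, p.2.2)) ++
        (pairTerms n).map (fun p => (1 * p.1, p.2.1, p.2.2 + 1)) ++
        (List.range (n + 2)).map fun r => ((-1) ^ (n + 1), r, n + 1 - r))

lemma formalSum_pairTerms (a b : A) (n : ℕ) :
    formalSum (fun p => a ^ p.1 * b ^ p.2) (pairTerms n) = pairQuotient (a + b) a b n := by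
  induction n with
  | zero => simp [pairTerms, pairQuotient]
  | succ n ih =>
    rw [pairTerms, formalSum_collectTerms (eq_of_pairCmp (fun _ _ => eq_of_natCmp)
      fun _ _ => eq_of_natCmp), formalSum_append, formalSum_append,
      formalSum_map _ (fun s : ℕ × ℕ => (s.1 + 1, s.2)),
      formalSum_map _ (fun s : ℕ × ℕ => (s.1, s.2 + 1)), pairQuotient, ← ih, add_mul,
      completeHom, Finset.mul_sum]
    congr 1
    · rw [formalSum_mul_left _ a, formalSum_mul_left _ b]
      simp only [Int.cast_one, one_mul]
      refine congrArg₂ (· + ·) (formalSum_congr (fun s => ?_) _) (formalSum_congr (fun s => ?_) _)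
      · rw [pow_succ]; ring
      · rw [pow_succ]; ring
    · rw [formalSum, List.map_map, Finset.sum_range, ← List.sum_ofFn, List.ofFn_eq_map,
        ← List.map_coe_finRange_eq_range, List.map_map]
      congr 1
      refine List.map_congr_left fun p _ => ?_
      simp

/-- Insertion of an entry into a sorted list, with the sign of the necessary permutation. -/
def signedInsert (x : ℕ) : List ℕ → List (ℤ × List ℕ)
  | [] => [(1, [x])]
  | y :: l =>
    match natCmp x y with
    | .lt => [(1, x :: y :: l)]
    | .eq => []
    | .gt => (signedInsert x l).map fun p => (-1 * p.1, y :: p.2)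

lemma formalSum_signedInsert [CharZero A] [NoZeroDivisors A] {F : List ℕ → A}
    (hF : ∀ l a b l', F (l ++ a :: b :: l') = -F (l ++ b :: a :: l')) (x : ℕ) (l : List ℕ) :
    formalSum F (signedInsert x l) = F (x :: l) := by
  induction l generalizing F with
  | nil => simp [signedInsert]
  | cons y l ih =>
    rw [signedInsert]
    split
    · simp
    · next h =>
      rw [eq_of_natCmp h]
      exact (self_eq_neg.1 (hF [] y y l)).symm
    · rw [formalSum_map F (fun t => y :: t), ih fun l' a b l'' => hF (y :: l') a b l'']
      simpa using (hF [] x y l).symm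

end FormalSums

section CoefficientExtraction

open MvPolynomial

variable {M : ℕ}

lemma pairQuotient_comm {A : Type*} [CommRing A] (T a b : A) (n : ℕ) :
    pairQuotient T a b n = pairQuotient T b a n := by
  have h : ∀ r, completeHom a b r = completeHom b a r := fun r => by
    rw [completeHom, completeHom, ← Finset.sum_range_reflect]
    refine Finset.sum_congr rfl fun p hp => ?_
    have := Finset.mem_range.1 hp
    rw [mul_comm, show r + 1 - 1 - p = r - p by omega, show r - (r - p) = p by omega]
  induction n with
  | zero => rfl
  | succ n ih => rw [pairQuotient, pairQuotient, ih, h]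

/-- The monomial with the given list of exponents. -/
def listMonomial (M : ℕ) (l : List ℕ) : MvPolynomial (Fin M) ℂ := ∏ i : Fin M, X i ^ l.getD i 0

lemma getD_swap (l : List ℕ) (a b : ℕ) (l' : List ℕ) (i : ℕ) :
    (l ++ a :: b :: l').getD (Equiv.swap l.length (l.length + 1) i) 0 =
      (l ++ b :: a :: l').getD i 0 := by
  rcases lt_trichotomy i l.length with h | rfl | h
  · rw [Equiv.swap_apply_of_ne_of_ne (by omega) (by omega), List.getD_append _ _ _ _ h,
      List.getD_append _ _ _ _ h]
  · rw [Equiv.swap_apply_left, List.getD_append_right _ _ _ _ (by omega),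
      List.getD_append_right _ _ _ _ le_rfl]
    simp
  · rcases (Nat.succ_le_iff.2 h).eq_or_lt with rfl | h'
    · rw [Equiv.swap_apply_right, List.getD_append_right _ _ _ _ le_rfl,
        List.getD_append_right _ _ _ _ (by omega)]
      simp
    · rw [Equiv.swap_apply_of_ne_of_ne (by omega) (by omega),
        List.getD_append_right _ _ _ _ (by omega), List.getD_append_right _ _ _ _ (by omega)]
      obtain ⟨k, hk⟩ : ∃ k, i - l.length = k + 2 := ⟨i - l.length - 2, by omega⟩
      simp [hk]

lemma rename_listMonomial_swap (l : List ℕ) (a b : ℕ) (l' : List ℕ) {i j : Fin M}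
    (hi : (i : ℕ) = l.length) (hj : (j : ℕ) = l.length + 1) :
    rename (Equiv.swap i j) (listMonomial M (l ++ a :: b :: l')) =
      listMonomial M (l ++ b :: a :: l') := by
  rw [listMonomial, listMonomial, map_prod, ← Equiv.prod_comp (Equiv.swap i j)]
  refine Finset.prod_congr rfl fun k _ => ?_
  rw [map_pow, rename_X, Equiv.swap_apply_self, ← getD_swap l a b l', ← hj, ← hi,
    Fin.val_injective.map_swap]

lemma topCoeff_listMonomial_swap (l : List ℕ) (a b : ℕ) (l' : List ℕ) {i j : Fin M}
    (hi : (i : ℕ) = l.length) (hj : (j : ℕ) = l.length + 1) {h : MvPolynomial (Fin M) ℂ}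
    (hh : rename (Equiv.swap i j) h = h) :
    topCoeff M (listMonomial M (l ++ a :: b :: l') * h) =
      -topCoeff M (listMonomial M (l ++ b :: a :: l') * h) := by
  refine topCoeff_eq_neg_of_swap (i := i) (j := j) (fun h => ?_) ?_
  · rw [h] at hi; omega
  · rw [map_mul, hh, rename_listMonomial_swap _ _ _ _ hi hj]

/-- Increment of an entry of a list which is implicitly extended by zeros. -/
def incEntry : ℕ → List ℕ → List ℕ
  | 0, [] => [1]
  | 0, a :: l => (a + 1) :: l
  | k + 1, [] => 0 :: incEntry k []
  | k + 1, a :: l => a :: incEntry k l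

lemma getD_incEntry (k : ℕ) (l : List ℕ) (i : ℕ) :
    (incEntry k l).getD i 0 = l.getD i 0 + if i = k then 1 else 0 := by
  induction k generalizing l i with
  | zero => cases l <;> cases i <;> simp [incEntry]
  | succ k ih =>
    cases l <;> cases i <;> simp only [incEntry, List.getD_cons_zero, List.getD_cons_succ, ih] <;>
      simp

lemma append_incEntry (l : List ℕ) (k : ℕ) (l' : List ℕ) :
    l ++ incEntry k l' = incEntry (l.length + k) (l ++ l') := by
  induction l with
  | nil => simp
  | cons a l ih => simp [ih, Nat.succ_add, incEntry]

lemma listMonomial_incEntry {k : ℕ} (hk : k < M) (l : List ℕ) :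
    listMonomial M (incEntry k l) = X ⟨k, hk⟩ * listMonomial M l := by
  rw [listMonomial, listMonomial]
  simp only [getD_incEntry, pow_add, Finset.prod_mul_distrib]
  rw [mul_comm]
  congr 1
  rw [Finset.prod_eq_single ⟨k, hk⟩]
  · simp
  · intro i _ hi
    rw [if_neg fun h => hi (Fin.ext h), pow_zero]
  · simp

lemma listMonomial_append_incEntry {k : ℕ} (hk : k < M) {l : List ℕ} (hl : l.length ≤ k)
    (l' : List ℕ) : listMonomial M (l ++ incEntry (k - l.length) l') =
      X ⟨k, hk⟩ * listMonomial M (l ++ l') := by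
  rw [append_incEntry, Nat.add_sub_cancel' hl, listMonomial_incEntry hk]

lemma listMonomial_append_cons (l : List ℕ) (a b : ℕ) (l' : List ℕ) (u v : ℕ)
    (hM : l.length + 1 < M) : listMonomial M (l ++ (a + u) :: (b + v) :: l') =
      listMonomial M (l ++ a :: b :: l') *
        (X ⟨l.length, by omega⟩ ^ u * X ⟨l.length + 1, hM⟩ ^ v) := by
  have h1 : ∀ u a b, listMonomial M (l ++ (a + u) :: b :: l') =
      listMonomial M (l ++ a :: b :: l') * X ⟨l.length, by omega⟩ ^ u := by
    intro u a b
    induction u with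
    | zero => simp
    | succ u ih =>
      rw [pow_succ, ← mul_assoc, ← ih, mul_comm, ← listMonomial_append_incEntry _ le_rfl]
      simp [incEntry, add_assoc]
  have h2 : ∀ v a b, listMonomial M (l ++ a :: (b + v) :: l') =
      listMonomial M (l ++ a :: b :: l') * X ⟨l.length + 1, hM⟩ ^ v := by
    intro v a b
    induction v with
    | zero => simp
    | succ v ih =>
      rw [pow_succ, ← mul_assoc, ← ih, mul_comm, ← listMonomial_append_incEntry _ (by omega)]
      simp [incEntry, add_assoc]
  rw [h1, h2]
  ring

lemma listMonomial_append_headD (l l' : List ℕ) :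
    listMonomial M (l ++ l'.headD 0 :: l'.tail.headD 0 :: l'.drop 2) =
      listMonomial M (l ++ l') := by
  rw [listMonomial, listMonomial]
  refine Finset.prod_congr rfl fun i _ => ?_
  congr 1
  rcases lt_or_ge (i : ℕ) l.length with h | h
  · rw [List.getD_append _ _ _ _ h, List.getD_append _ _ _ _ h]
  · rw [List.getD_append_right _ _ _ _ h, List.getD_append_right _ _ _ _ h]
    generalize (i : ℕ) - l.length = k
    match l', k with
    | [], 0 => rfl
    | [], 1 => rfl
    | [], k + 2 => rfl
    | [a], 0 => rfl
    | [a], 1 => rfl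
    | [a], k + 2 => rfl
    | a :: b :: l', k => rfl

/-- The value of a pair of exponent lists: the first one holds, in reversed order, the exponents of
the first `n` variables, the second one the exponents of the other variables. -/
def stateValue (n : ℕ) (h : MvPolynomial (Fin M) ℂ) (s : List ℕ × List ℕ) : ℂ :=
  if s.1.length = n then topCoeff M (listMonomial M (s.1.reverse ++ s.2) * h) else 0

/-- Invariance of a polynomial under permutations of the first `n` variables. -/
def IsInvariantBelow (n : ℕ) (h : MvPolynomial (Fin M) ℂ) : Prop :=
  ∀ i j : Fin M, (i : ℕ) < n → (j : ℕ) < n → rename (Equiv.swap i j) h = h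

lemma IsInvariantBelow.mono {m n : ℕ} (hmn : m ≤ n) {h : MvPolynomial (Fin M) ℂ}
    (hh : IsInvariantBelow n h) : IsInvariantBelow m h :=
  fun i j hi hj => hh i j (hi.trans_le hmn) (hj.trans_le hmn)

lemma IsInvariantBelow.mul {n : ℕ} {h h' : MvPolynomial (Fin M) ℂ} (hh : IsInvariantBelow n h)
    (hh' : IsInvariantBelow n h') : IsInvariantBelow n (h * h') :=
  fun i j hi hj => by rw [map_mul, hh i j hi hj, hh' i j hi hj]

lemma IsInvariantBelow.add {n : ℕ} {h h' : MvPolynomial (Fin M) ℂ} (hh : IsInvariantBelow n h)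
    (hh' : IsInvariantBelow n h') : IsInvariantBelow n (h + h') :=
  fun i j hi hj => by rw [map_add, hh i j hi hj, hh' i j hi hj]

lemma isInvariantBelow_one {n : ℕ} : IsInvariantBelow n (1 : MvPolynomial (Fin M) ℂ) :=
  fun _ _ _ _ => map_one _

lemma isInvariantBelow_X {n : ℕ} {k : Fin M} (hk : n ≤ k) : IsInvariantBelow n (X k) := by
  intro i j hi hj
  rw [rename_X, Equiv.swap_apply_of_ne_of_ne (fun h => by omega) (fun h => by omega)]

lemma IsInvariantBelow.pairQuotient {n : ℕ} {f g h : MvPolynomial (Fin M) ℂ}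
    (hf : IsInvariantBelow n f) (hg : IsInvariantBelow n g) (hh : IsInvariantBelow n h) (k : ℕ) :
    IsInvariantBelow n (pairQuotient f g h k) := fun i j hi hj => by
  refine (map_pairQuotient (rename (Equiv.swap i j)).toRingHom f g h k).trans ?_
  simp only [AlgHom.toRingHom_eq_coe, RingHom.coe_coe, hf i j hi hj, hg i j hi hj, hh i j hi hj]

lemma stateValue_swap {n : ℕ} (hn : n ≤ M) {h : MvPolynomial (Fin M) ℂ}
    (hh : IsInvariantBelow n h) (l : List ℕ) (a b : ℕ) (l' t : List ℕ) :
    stateValue n h (l ++ a :: b :: l', t) = -stateValue n h (l ++ b :: a :: l', t) := by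
  rw [stateValue, stateValue]
  simp only [List.length_append, List.length_cons]
  split_ifs with hlen
  · simp only [List.reverse_append, List.reverse_cons, List.append_assoc, List.cons_append,
      List.nil_append]
    exact topCoeff_listMonomial_swap l'.reverse b a (l.reverse ++ t)
      (i := ⟨l'.length, by omega⟩) (j := ⟨l'.length + 1, by omega⟩) (by simp) (by simp)
      (hh _ _ (by simp; omega) (by simp; omega))
  · simp

/-- The effect of multiplication with `X i + X j + X (M - 1)`. -/
def edgeStep (M i j : ℕ) (s : List ℕ × List ℕ) : List (ℤ × List ℕ × List ℕ) :=
  [(1, s.1, incEntry (i - s.1.length) s.2), (1, s.1, incEntry (j - s.1.length) s.2),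
    (1, s.1, incEntry (M - 1 - s.1.length) s.2)]

lemma formalSum_edgeStep {n i j : ℕ} (hni : n ≤ i) (hi : i < M) (hnj : n ≤ j) (hj : j < M)
    (h : MvPolynomial (Fin M) ℂ) (s : List ℕ × List ℕ) :
    formalSum (stateValue n h) (edgeStep M i j s) =
      stateValue n ((X ⟨i, hi⟩ + X ⟨j, hj⟩ + X ⟨M - 1, by omega⟩) * h) s := by
  have key : ∀ k, n ≤ k → ∀ hk : k < M, stateValue n h (s.1, incEntry (k - s.1.length) s.2) =
      stateValue n (X ⟨k, hk⟩ * h) s := by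
    intro k hnk hk
    rw [stateValue, stateValue]
    split_ifs with hs
    · rw [← List.length_reverse, listMonomial_append_incEntry hk (by simp [hs, hnk])]
      congr 1
      ring
    · rfl
  simp only [edgeStep, formalSum_cons, formalSum_nil, key i hni hi, key j hnj hj,
    key (M - 1) (by omega) (by omega)]
  simp only [stateValue]
  split_ifs with hs
  · simp only [add_mul, mul_add, map_add]
    push_cast
    ring
  · simp

/-- Sorting of the exponents of the first two remaining variables. -/
def sortStep (s : List ℕ × List ℕ) : List (ℤ × List ℕ × List ℕ) :=
  match natCmp (s.2.headD 0) (s.2.tail.headD 0) with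
  | .lt => [(1, s)]
  | .eq => []
  | .gt => [(-1, s.1, s.2.tail.headD 0 :: s.2.headD 0 :: s.2.drop 2)]

lemma formalSum_sortStep {n : ℕ} (hn : n + 1 < M) {h : MvPolynomial (Fin M) ℂ}
    (hh : rename (Equiv.swap (⟨n, by omega⟩ : Fin M) ⟨n + 1, hn⟩) h = h) (s : List ℕ × List ℕ) :
    formalSum (stateValue n h) (sortStep s) = stateValue n h s := by
  have key : stateValue n h (s.1, s.2.tail.headD 0 :: s.2.headD 0 :: s.2.drop 2) =
      -stateValue n h s := by
    rw [stateValue, stateValue]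
    split_ifs with hs
    · rw [← listMonomial_append_headD _ s.2]
      exact topCoeff_listMonomial_swap _ _ _ _ (by simp [hs]) (by simp [hs]) hh
    · simp
  rw [sortStep]
  split
  · simp
  · next h' =>
    rw [eq_of_natCmp h', ← eq_of_natCmp h'] at key
    have : stateValue n h (s.1, s.2.headD 0 :: s.2.tail.headD 0 :: s.2.drop 2) =
        stateValue n h s := by
      rw [stateValue, stateValue, listMonomial_append_headD]
    rw [eq_of_natCmp h'] at this key
    rw [formalSum_nil]
    rw [this] at key
    exact (self_eq_neg.1 key).symm
  · rw [formalSum_cons, formalSum_nil, key]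
    simp

/-- The effect of multiplication with a polynomial in the first two remaining variables, after
which these variables count as processed. -/
def pairStep (M : ℕ) (P : List (ℤ × ℕ × ℕ)) (s : List ℕ × List ℕ) : List (ℤ × List ℕ × List ℕ) :=
  formalBind P fun e =>
    bif Nat.blt (s.2.headD 0 + e.1) M && Nat.blt (s.2.tail.headD 0 + e.2) M then
      (formalBind (signedInsert (s.2.headD 0 + e.1) s.1)
        (signedInsert (s.2.tail.headD 0 + e.2))).map fun l => (1 * l.1, l.2, s.2.drop 2)
    else []

lemma formalSum_pairStep {n : ℕ} (hn : n + 1 < M) {h : MvPolynomial (Fin M) ℂ}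
    (hh : IsInvariantBelow (n + 2) h) (P : List (ℤ × ℕ × ℕ)) (s : List ℕ × List ℕ) :
    formalSum (stateValue (n + 2) h) (pairStep M P s) = stateValue n
      (formalSum (fun p => X (⟨n, by omega⟩ : Fin M) ^ p.1 * X ⟨n + 1, hn⟩ ^ p.2) P * h) s := by
  rw [pairStep, formalSum_bind]
  have key : ∀ e : ℕ × ℕ, stateValue n
      (X (⟨n, by omega⟩ : Fin M) ^ e.1 * X ⟨n + 1, hn⟩ ^ e.2 * h) s =
      stateValue (n + 2) h
        ((s.2.tail.headD 0 + e.2) :: (s.2.headD 0 + e.1) :: s.1, s.2.drop 2) := by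
    intro e
    rw [stateValue, stateValue]
    by_cases hs : s.1.length = n
    · rw [if_pos hs, if_pos (by simp [hs]), ← mul_assoc]
      simp only [List.reverse_cons, List.append_assoc, List.cons_append, List.nil_append]
      rw [listMonomial_append_cons _ _ _ _ _ _ (by simpa [hs] using hn), listMonomial_append_headD]
      simp only [List.length_reverse, hs]
    · rw [if_neg hs, if_neg (by simpa using hs)]
  have hzero : ∀ e : ℕ × ℕ, (M ≤ s.2.headD 0 + e.1 ∨ M ≤ s.2.tail.headD 0 + e.2) →
      stateValue (n + 2) h
        ((s.2.tail.headD 0 + e.2) :: (s.2.headD 0 + e.1) :: s.1, s.2.drop 2) = 0 := by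
    intro e he
    rw [stateValue]
    split_ifs with hs
    · have hs' : s.1.length = n := by simpa using hs
      simp only [List.reverse_cons, List.append_assoc, List.cons_append, List.nil_append]
      have h0 := listMonomial_append_cons (M := M) s.1.reverse 0 0 (s.2.drop 2)
        (s.2.headD 0 + e.1) (s.2.tail.headD 0 + e.2) (by simpa [hs'] using hn)
      rw [zero_add, zero_add] at h0
      rw [h0]
      rcases he with he | he
      · rw [mul_comm (listMonomial _ _), mul_assoc, mul_assoc]
        exact topCoeff_X_pow_mul _ he _
      · rw [mul_comm (listMonomial _ _), mul_comm (X _ ^ _) (X _ ^ _), mul_assoc, mul_assoc]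
        exact topCoeff_X_pow_mul _ he _
    · rfl
  have hsum : ∀ Q : List (ℤ × ℕ × ℕ), stateValue n (formalSum
      (fun p => X (⟨n, by omega⟩ : Fin M) ^ p.1 * X ⟨n + 1, hn⟩ ^ p.2) Q * h) s =
      formalSum (fun p => stateValue n
        (X (⟨n, by omega⟩ : Fin M) ^ p.1 * X ⟨n + 1, hn⟩ ^ p.2 * h) s) Q := by
    intro Q
    simp only [stateValue]
    split_ifs with hs
    · rw [mul_comm, mul_assoc, mul_comm, formalSum_mul_left, map_formalSum]
      refine formalSum_congr (fun p => ?_) _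
      congr 1
      ring
    · simp [formalSum]
  have hb : ∀ {a b : ℕ}, Nat.blt a b = true ↔ a < b := iff_of_eq (Nat.blt_eq)
  rw [hsum]
  refine formalSum_congr (fun e => ?_) _
  rw [key]
  rcases lt_or_ge (s.2.headD 0 + e.1) M with h1 | h1
  · rcases lt_or_ge (s.2.tail.headD 0 + e.2) M with h2 | h2
    · rw [hb.2 h1, hb.2 h2, Bool.and_self, cond_true, formalSum_map _
        (fun l => (l, s.2.drop 2)), formalSum_bind, Int.cast_one, one_mul]
      have hF := stateValue_swap (by omega : n + 2 ≤ M) hh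
      rw [← formalSum_signedInsert (F := fun l => stateValue (n + 2) h
        ((s.2.tail.headD 0 + e.2) :: l, s.2.drop 2)) fun l a b l' => hF (_ :: l) a b l' _]
      exact formalSum_congr (fun l => formalSum_signedInsert
        (F := fun l => stateValue (n + 2) h (l, s.2.drop 2)) (fun l a b l' => hF l a b l' _) _ _) _
    · rw [hzero e (Or.inr h2), Bool.eq_false_iff.2 (fun h => h2.not_gt (hb.1 h)),
        Bool.and_false, cond_false, formalSum_nil]
  · rw [hzero e (Or.inl h1), Bool.eq_false_iff.2 (fun h => h1.not_gt (hb.1 h)),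
      Bool.false_and, cond_false, formalSum_nil]

/-- A factor of a product of trinomials: `edge i j` stands for `X i + X j + X (M - 1)`, while `pair`
stands for the product of all trinomials containing the first two remaining variables. -/
inductive TrinomialFactor
  | edge (i j : ℕ)
  | pair

open TrinomialFactor

/-- Well-formedness of a list of factors, if the first `n` variables have been processed. -/
def IsValidFrom (M : ℕ) : ℕ → List TrinomialFactor → Prop
  | _, [] => True
  | n, edge i j :: L => (n ≤ i ∧ i < M ∧ n ≤ j ∧ j < M) ∧ IsValidFrom M n L
  | n, pair :: L => n + 1 < M ∧ IsValidFrom M (n + 2) L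

instance : ∀ n L, Decidable (IsValidFrom M n L)
  | _, [] => inferInstanceAs (Decidable True)
  | n, edge _ _ :: L =>
    have := instDecidableIsValidFrom n L
    inferInstanceAs (Decidable (_ ∧ _))
  | n, pair :: L =>
    have := instDecidableIsValidFrom (n + 2) L
    inferInstanceAs (Decidable (_ ∧ _))

/-- The product of a list of factors, if the first `n` variables have been processed. -/
def factorProd (M : ℕ) [NeZero M] : ℕ → List TrinomialFactor → MvPolynomial (Fin M) ℂ
  | _, [] => 1
  | n, edge i j :: L =>
    (X (Fin.ofNat M i) + X (Fin.ofNat M j) + X (Fin.ofNat M (M - 1))) * factorProd M n L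
  | n, pair :: L => pairQuotient (X (Fin.ofNat M n) + X (Fin.ofNat M (n + 1))) (X (Fin.ofNat M n))
      (X (Fin.ofNat M (n + 1))) (M - 2) * factorProd M (n + 2) L

/-- The number of processed variables at the end. -/
def finalCount : ℕ → List TrinomialFactor → ℕ
  | n, [] => n
  | n, edge _ _ :: L => finalCount n L
  | n, pair :: L => finalCount (n + 2) L

/-- Multiplication of a formal sum of exponent lists with a list of factors. -/
def expandFactors (M : ℕ) :
    List TrinomialFactor → List (ℤ × List ℕ × List ℕ) → List (ℤ × List ℕ × List ℕ)
  | [], S => S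
  | edge i j :: L, S => expandFactors M L
      (collectTerms (pairCmp listCmp listCmp) (formalBind S (edgeStep M i j)))
  | pair :: L, S => expandFactors M L
      (collectTerms (pairCmp listCmp listCmp) (formalBind
        (collectTerms (pairCmp listCmp listCmp) (formalBind S sortStep))
        (pairStep M (pairTerms (M - 2)))))

lemma ofNat_eq_mk [NeZero M] {i : ℕ} (hi : i < M) : Fin.ofNat M i = ⟨i, hi⟩ :=
  Fin.ext (Nat.mod_eq_of_lt hi)

lemma isInvariantBelow_factorProd [NeZero M] {n : ℕ} {L : List TrinomialFactor}
    (hL : IsValidFrom M n L) : IsInvariantBelow n (factorProd M n L) := by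
  induction L generalizing n with
  | nil => exact isInvariantBelow_one
  | cons o L ih =>
    match o, hL with
    | edge _ _, hL =>
      obtain ⟨⟨h1, h2, h3, h4⟩, hL⟩ := hL
      refine IsInvariantBelow.mul (.add (.add ?_ ?_) ?_) (ih hL)
      · rw [ofNat_eq_mk h2]; exact isInvariantBelow_X h1
      · rw [ofNat_eq_mk h4]; exact isInvariantBelow_X h3
      · rw [ofNat_eq_mk (show M - 1 < M by omega)]
        exact isInvariantBelow_X (show n ≤ M - 1 by omega)
    | pair, hL =>
      have h1 : IsInvariantBelow n (X (Fin.ofNat M n)) := by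
        rw [ofNat_eq_mk (show n < M by have := hL.1; omega)]; exact isInvariantBelow_X le_rfl
      have h2 : IsInvariantBelow n (X (Fin.ofNat M (n + 1))) := by
        rw [ofNat_eq_mk hL.1]; exact isInvariantBelow_X (Nat.le_succ n)
      exact (IsInvariantBelow.pairQuotient (h1.add h2) h1 h2 _).mul ((ih hL.2).mono (by omega))

lemma formalSum_expandFactors [NeZero M] {n : ℕ} {L : List TrinomialFactor}
    (hL : IsValidFrom M n L) (S : List (ℤ × List ℕ × List ℕ)) :
    formalSum (stateValue (M := M) (finalCount n L) 1) (expandFactors M L S) =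
      formalSum (stateValue n (factorProd M n L)) S := by
  have hcmp : ∀ s t : List ℕ × List ℕ, pairCmp listCmp listCmp s t = .eq → s = t :=
    eq_of_pairCmp (fun _ _ => eq_of_listCmp) fun _ _ => eq_of_listCmp
  induction L generalizing n S with
  | nil => rfl
  | cons o L ih =>
    match o, hL with
    | edge i j, hL =>
      have hinv := isInvariantBelow_factorProd hL
      obtain ⟨⟨h1, h2, h3, h4⟩, hL⟩ := hL
      rw [expandFactors, finalCount, ih hL, formalSum_collectTerms hcmp, formalSum_bind]
      refine formalSum_congr (fun s => ?_) _
      rw [formalSum_edgeStep h1 h2 h3 h4, factorProd, ofNat_eq_mk h2, ofNat_eq_mk h4,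
        ofNat_eq_mk (show M - 1 < M by omega)]
    | pair, hL =>
      obtain ⟨h1, hL⟩ := hL
      rw [expandFactors, finalCount, ih hL, formalSum_collectTerms hcmp, formalSum_bind]
      have hinv := isInvariantBelow_factorProd hL
      have hprod : factorProd M n (pair :: L) = formalSum
          (fun p => X (⟨n, by omega⟩ : Fin M) ^ p.1 * X ⟨n + 1, h1⟩ ^ p.2) (pairTerms (M - 2)) *
            factorProd M (n + 2) L := by
        rw [formalSum_pairTerms, factorProd, ofNat_eq_mk h1, ofNat_eq_mk (show n < M by omega)]
      have hswap : rename (Equiv.swap (⟨n, by omega⟩ : Fin M) ⟨n + 1, h1⟩)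
          (factorProd M n (pair :: L)) = factorProd M n (pair :: L) := by
        rw [factorProd, map_mul, hinv _ _ (by simp) (by simp), ofNat_eq_mk h1,
          ofNat_eq_mk (show n < M by omega)]
        congr 1
        refine (map_pairQuotient (rename (R := ℂ)
          (Equiv.swap (⟨n, by omega⟩ : Fin M) ⟨n + 1, h1⟩)).toRingHom
          _ _ _ _).trans ?_
        rw [pairQuotient_comm]
        simp [add_comm]
      refine (formalSum_congr (fun s => ?_) _).trans ((formalSum_collectTerms hcmp _ _).trans
        ((formalSum_bind _ _ _).trans (formalSum_congr (formalSum_sortStep h1 hswap) _)))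
      rw [formalSum_pairStep h1 hinv, hprod]

end CoefficientExtraction

section TrinomialProducts

open MvPolynomial TrinomialFactor

variable {M : ℕ}

/-- The trinomials in a product of factors, given by the indices of their variables. -/
def factorTriples (M : ℕ) [NeZero M] : ℕ → List TrinomialFactor → List (Fin M × Fin M × Fin M)
  | _, [] => []
  | n, edge i j :: L => (Fin.ofNat M i, Fin.ofNat M j, Fin.ofNat M (M - 1)) :: factorTriples M n L
  | n, pair :: L =>
    ((List.finRange M).filter fun k => k ≠ Fin.ofNat M n ∧ k ≠ Fin.ofNat M (n + 1)).map
      (fun k => (Fin.ofNat M n, Fin.ofNat M (n + 1), k)) ++ factorTriples M (n + 2) L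

/-- The product of the trinomials with the given indices of variables. -/
def trinomialProd (T : List (Fin M × Fin M × Fin M)) : MvPolynomial (Fin M) ℂ :=
  (T.map fun t => ∑ p, X (tripleEntry t p)).prod

lemma sum_X_tripleEntry (t : Fin M × Fin M × Fin M) :
    ∑ p, (X (tripleEntry t p) : MvPolynomial (Fin M) ℂ) = X t.1 + X t.2.1 + X t.2.2 := by
  rw [Fin.sum_univ_three]
  rfl

lemma mk_trinomialProd_factorTriples [NeZero M] {n : ℕ} {L : List TrinomialFactor}
    (hL : IsValidFrom M n L) :
    Ideal.Quotient.mk (coinvariantIdeal M) (trinomialProd (factorTriples M n L)) =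
      Ideal.Quotient.mk (coinvariantIdeal M) (factorProd M n L) := by
  induction L generalizing n with
  | nil => rfl
  | cons o L ih =>
    match o, hL with
    | edge i j, hL =>
      rw [factorTriples, factorProd, trinomialProd, List.map_cons, List.prod_cons, map_mul, map_mul,
        sum_X_tripleEntry, ← ih hL.2]
      rfl
    | pair, hL =>
      obtain ⟨h1, hL⟩ := hL
      obtain ⟨m, rfl⟩ : ∃ m, M = m + 2 := ⟨M - 2, by omega⟩
      have hne : Fin.ofNat (m + 2) n ≠ Fin.ofNat (m + 2) (n + 1) := by
        rw [ofNat_eq_mk h1, ofNat_eq_mk (show n < m + 2 by omega)]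
        simp
      rw [factorTriples, factorProd, trinomialProd, List.map_append, List.prod_append, map_mul,
        map_mul, ← ih hL, trinomialProd, Nat.add_sub_cancel, ← mk_prod_eq_mk_pairQuotient hne,
        List.map_map]
      congr 2
      rw [← List.prod_toFinset _ ((List.nodup_finRange _).filter _)]
      refine Finset.prod_congr ?_ fun k _ => sum_X_tripleEntry _
      ext k
      simp

lemma vandermondePoly_eq_prod_subtype : vandermondePoly M =
    ∏ p : {p : Fin M × Fin M // p.1 < p.2}, (X p.1.2 - X p.1.1) := by
  rw [vandermondePoly, Matrix.det_vandermonde, ← Finset.prod_subtype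
    (Finset.univ.filter fun p : Fin M × Fin M => p.1 < p.2) (by simp)
    fun p => (X p.2 - X p.1 : MvPolynomial (Fin M) ℂ), Finset.prod_filter,
    Fintype.prod_prod_type]
  refine Finset.prod_congr rfl fun i _ => ?_
  rw [← Finset.prod_filter]
  refine Finset.prod_congr ?_ fun _ _ => rfl
  ext j
  simp

lemma topCoeff_listMonomial_eq_one {l : List ℕ} (hl : ∀ i : Fin M, l.getD i 0 = M - 1 - i) :
    topCoeff M (listMonomial M l) = 1 := by
  rw [← topCoeff_staircase (M := M), listMonomial]
  simp only [hl]

/-- The coefficient of `∏ i, X i ^ (M - 1)` in the product of a list of trinomials and the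
Vandermonde polynomial, in terms of the expansion of the list. -/
lemma coeff_trinomialProd_mul [NeZero M] {L : List TrinomialFactor} (hL : IsValidFrom M 0 L) {c : ℤ}
    {l l' : List ℕ} (h : expandFactors M L [(1, [], List.replicate M 0)] = [(c, l, l')])
    (hl : l.length = finalCount 0 L) (hl' : ∀ i : Fin M, (l.reverse ++ l').getD i 0 = M - 1 - i) :
    (trinomialProd (factorTriples M 0 L) *
      ∏ p : {p : Fin M × Fin M // p.1 < p.2}, (X p.1.2 - X p.1.1)).coeff
        (Finsupp.equivFunOnFinite.symm fun _ => M - 1) = c := by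
  have h1 := formalSum_expandFactors hL [(1, [], List.replicate M 0)]
  rw [h] at h1
  have h2 : listMonomial M (List.replicate M 0) = 1 := by
    rw [listMonomial]
    refine Finset.prod_eq_one fun i _ => ?_
    rw [List.getD_replicate (h := i.2), pow_zero]
  simp only [formalSum_cons, formalSum_nil, stateValue, if_pos hl, List.length_nil, if_true,
    List.reverse_nil, List.nil_append, h2, one_mul, mul_one, Int.cast_one, add_zero,
    topCoeff_listMonomial_eq_one hl'] at h1
  rw [← vandermondePoly_eq_prod_subtype, ← topCoeff_apply,
    topCoeff_congr (mk_trinomialProd_factorTriples hL), ← h1]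

/-- The factors belonging to the standard pairs after the first `k` ones, and to the excluded
triples `(i, i + 2, M - 1)`. -/
def tailFactors (k : ℕ) : ℕ → List TrinomialFactor
  | 0 => []
  | 1 => [pair]
  | m + 2 => edge (2 * k) (2 * k + 2) :: edge (2 * k + 1) (2 * k + 3) :: pair ::
      tailFactors (k + 1) (m + 1)

/-- The factors for the vectors missing from the universal subspace in dimension `2 * K + 1`. -/
def missingFactors (K : ℕ) : List TrinomialFactor := edge 0 3 :: edge 1 4 :: tailFactors 0 K

lemma coeff_missingFactors_seven : (trinomialProd (factorTriples 7 0 (missingFactors 3)) *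
    ∏ p : {p : Fin 7 × Fin 7 // p.1 < p.2}, (X p.1.2 - X p.1.1)).coeff
      (Finsupp.equivFunOnFinite.symm fun _ => 7 - 1) = (-48 : ℤ) :=
  coeff_trinomialProd_mul (l := [1, 2, 3, 4, 5, 6]) (l' := [0]) (by decide +kernel)
    (by decide +kernel) (by decide +kernel) (by decide +kernel)

lemma coeff_missingFactors_nine : (trinomialProd (factorTriples 9 0 (missingFactors 4)) *
    ∏ p : {p : Fin 9 × Fin 9 // p.1 < p.2}, (X p.1.2 - X p.1.1)).coeff
      (Finsupp.equivFunOnFinite.symm fun _ => 9 - 1) = (10368 : ℤ) :=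
  coeff_trinomialProd_mul (l := [1, 2, 3, 4, 5, 6, 7, 8]) (l' := [0]) (by decide +kernel)
    (by decide +kernel) (by decide +kernel) (by decide +kernel)

lemma coeff_missingFactors_eleven : (trinomialProd (factorTriples 11 0 (missingFactors 5)) *
    ∏ p : {p : Fin 11 × Fin 11 // p.1 < p.2}, (X p.1.2 - X p.1.1)).coeff
      (Finsupp.equivFunOnFinite.symm fun _ => 11 - 1) = (-12431232 : ℤ) :=
  coeff_trinomialProd_mul (l := [1, 2, 3, 4, 5, 6, 7, 8, 9, 10]) (l' := [0]) (by decide +kernel)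
    (by decide +kernel) (by decide +kernel) (by decide +kernel)

end TrinomialProducts

section UniversalSubspace

variable {M : ℕ}

lemma rowForm_comp_perm {n : ℕ} (σ : Equiv.Perm (Fin n)) (a : Fin n → Fin M → ℂ)
    {ψ : ExteriorAlgebra ℂ (V M)} (hψ : ψ ∈ ⋀[ℂ]^n (V M)) :
    rowForm (a ∘ σ) ψ = (Equiv.Perm.sign σ : ℤ) * rowForm a ψ := by
  refine exteriorPower_induction
    (motive := fun ψ => rowForm (a ∘ σ) ψ = (Equiv.Perm.sign σ : ℤ) * rowForm a ψ)
    (fun x => ?_) ?_ (fun x y hx hy => ?_) (fun c x hx => ?_) hψ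
  · rw [rowForm_ιMulti, rowForm_ιMulti, ← Matrix.det_permute']
    rfl
  · simp
  · rw [map_add, map_add, hx, hy, mul_add]
  · rw [map_smul, map_smul, hx, smul_eq_mul, smul_eq_mul, mul_left_comm]

/-- The coordinate of an element of the third exterior power belonging to a triple of indices. -/
def tripleCoord (t : Fin M × Fin M × Fin M) : ExteriorAlgebra ℂ (V M) →ₗ[ℂ] ℂ :=
  rowForm fun p => Pi.single (tripleEntry t p) 1

lemma tripleCoord_eq_zero_of_perm (σ : Equiv.Perm (Fin 3)) {t t' : Fin M × Fin M × Fin M}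
    (h : tripleEntry t' = tripleEntry t ∘ σ) {ψ : ExteriorAlgebra ℂ (V M)} (hψ : ψ ∈ ⋀[ℂ]^3 (V M))
    (ht : tripleCoord t' ψ = 0) : tripleCoord t ψ = 0 := by
  have h1 : (fun p => Pi.single (tripleEntry t' p) 1 : Fin 3 → Fin M → ℂ) =
      (fun p => Pi.single (tripleEntry t p) 1) ∘ σ := by
    rw [h]
    rfl
  rw [tripleCoord, h1, rowForm_comp_perm σ _ hψ] at ht
  exact (mul_eq_zero.1 ht).resolve_left (by exact_mod_cast (Equiv.Perm.sign σ).ne_zero)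

/-- The increasing triples of indices. -/
abbrev IncTriple (M : ℕ) : Type := {t : Fin M × Fin M × Fin M // t.1 < t.2.1 ∧ t.2.1 < t.2.2}

lemma strictMono_tripleEntry (t : IncTriple M) : StrictMono (tripleEntry t.1) :=
  Fin.strictMono_iff_lt_succ.2 fun i => by
    fin_cases i
    · exact t.2.1
    · exact t.2.2

/-- Increasing triples as finsets with three elements. -/
def incTripleEquiv (M : ℕ) : IncTriple M ≃ Set.powersetCard (Fin M) 3 :=
  Equiv.trans
    { toFun := fun t => OrderEmbedding.ofStrictMono _ (strictMono_tripleEntry t)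
      invFun := fun f => ⟨(f 0, f 1, f 2), f.lt_iff_lt.2 (by decide), f.lt_iff_lt.2 (by decide)⟩
      left_inv := fun t => rfl
      right_inv := fun f => by
        ext i
        fin_cases i <;> rfl }
    Set.powersetCard.ofFinEmbEquiv

/-- The basis of the third exterior power indexed by increasing triples. -/
def tripleBasis (M : ℕ) : Module.Basis (IncTriple M) ℂ (⋀[ℂ]^3 (V M)) :=
  ((EuclideanSpace.basisFun (Fin M) ℂ).toBasis.exteriorPower 3).reindex (incTripleEquiv M).symm

lemma incTripleEquiv_symm_apply (t : IncTriple M) :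
    ⇑(Set.powersetCard.ofFinEmbEquiv.symm (incTripleEquiv M t)) = tripleEntry t.1 := by
  rw [incTripleEquiv, Equiv.trans_apply, Equiv.symm_apply_apply]
  rfl

lemma coe_tripleBasis (t : IncTriple M) : (tripleBasis M t : ExteriorAlgebra ℂ (V M)) =
    ExteriorAlgebra.ιMulti ℂ 3 fun p => EuclideanSpace.single (tripleEntry t.1 p) 1 := by
  rw [tripleBasis, Module.Basis.reindex_apply, Equiv.symm_symm, exteriorPower.basis_apply,
    exteriorPower.ιMulti_family, exteriorPower.ιMulti_apply_coe, incTripleEquiv_symm_apply]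
  congr 1
  ext p : 1
  simp

lemma tripleBasis_repr (t : IncTriple M) (ψ : ⋀[ℂ]^3 (V M)) :
    (tripleBasis M).repr ψ t = tripleCoord t.1 ψ := by
  rw [tripleBasis, Module.Basis.repr_reindex_apply, Equiv.symm_symm, exteriorPower.basis_repr_apply]
  suffices h : exteriorPower.ιMultiDual ℂ 3 (EuclideanSpace.basisFun (Fin M) ℂ).toBasis
      (incTripleEquiv M t) = tripleCoord t.1 ∘ₗ (⋀[ℂ]^3 (V M)).subtype from LinearMap.congr_fun h ψ
  refine exteriorPower.linearMap_ext (AlternatingMap.ext fun x => ?_)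
  rw [LinearMap.compAlternatingMap_apply, LinearMap.compAlternatingMap_apply,
    exteriorPower.ιMultiDual_apply_ιMulti, incTripleEquiv_symm_apply, LinearMap.comp_apply,
    Submodule.subtype_apply, exteriorPower.ιMulti_apply_coe, tripleCoord, rowForm_ιMulti]
  congr 1
  ext p q
  simp [Pi.single_apply]

/-- The condition on the (zero-based) indices of a triple to belong to the basis of the universal
subspace. -/
def IsRetained (M : ℕ) (t : Fin M × Fin M × Fin M) : Prop :=
  ((t.1 + 2 : ℕ) / 2 ≠ (t.2.1 + 2) / 2 ∧ (t.1 + 2 : ℕ) / 2 ≠ (t.2.2 + 2) / 2 ∧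
    (t.2.1 + 2 : ℕ) / 2 ≠ (t.2.2 + 2) / 2) ∧
  ¬ ((t.2.2 + 1 : ℕ) = M ∧ (((t.1 : ℕ) = 0 ∧ (t.2.1 : ℕ) = 3) ∨ ((t.1 : ℕ) = 1 ∧ (t.2.1 : ℕ) = 4) ∨
    ((t.1 : ℕ) < M - 3 ∧ (t.2.1 : ℕ) = t.1 + 2)))

instance : DecidablePred (IsRetained M) := fun t => by
  unfold IsRetained
  infer_instance

/-- The basis vectors of the universal subspace. -/
def retainedVector (M : ℕ) (t : {t : IncTriple M // IsRetained M t.1}) : ExteriorAlgebra ℂ (V M) :=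
  tripleBasis M t.1

lemma linearIndependent_retainedVector : LinearIndependent ℂ (retainedVector M) :=
  ((tripleBasis M).linearIndependent.map' (⋀[ℂ]^3 (V M)).subtype
    (Submodule.ker_subtype _)).comp _ Subtype.val_injective

lemma setOf_wedge_eq_range (hM : 7 ≤ M) {E : Set (ℕ × ℕ × ℕ)}
    (hE : E = {t | t = (1, 4, M) ∨ t = (2, 5, M) ∨
      ∃ i : ℕ, 1 ≤ i ∧ i ≤ M - 3 ∧ t = (i, i + 2, M)}) :
    {x | ∃ i : Fin 3 → ℕ, IsBasisIndex M 3 i ∧ SingleOcc 3 i ∧ (i 0, i 1, i 2) ∉ E ∧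
      x = wedge M 3 i} = Set.range (retainedVector M) := by
  have hmem : ∀ a b c : ℕ, (a + 1, b + 1, c + 1) ∈ E ↔ c + 1 = M ∧ ((a = 0 ∧ b = 3) ∨
      (a = 1 ∧ b = 4) ∨ (a < M - 3 ∧ b = a + 2)) := by
    intro a b c
    simp only [hE, Set.mem_ofPred_eq, Prod.mk.injEq]
    constructor
    · rintro (h | h | ⟨i, h⟩) <;> omega
    · rintro ⟨h, h' | h' | h'⟩
      · omega
      · omega
      · exact Or.inr (Or.inr ⟨a + 1, by omega⟩)
  ext x
  constructor
  · rintro ⟨i, ⟨hi, hi'⟩, hs, hiE, rfl⟩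
    have h01 : i 0 < i 1 := hi (by decide)
    have h12 : i 1 < i 2 := hi (by decide)
    have h0 := hi' 0
    have h1 := hi' 1
    have h2 := hi' 2
    let t : Fin M × Fin M × Fin M :=
      (⟨i 0 - 1, by omega⟩, ⟨i 1 - 1, by omega⟩, ⟨i 2 - 1, by omega⟩)
    have ht : IsRetained M t := by
      have s1 := hs 0 1 (by decide)
      have s2 := hs 0 2 (by decide)
      have s3 := hs 1 2 (by decide)
      rw [← Nat.sub_add_cancel h0.1, ← Nat.sub_add_cancel h1.1, ← Nat.sub_add_cancel h2.1,
        hmem] at hiE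
      refine ⟨⟨?_, ?_, ?_⟩, hiE⟩ <;> simp only [t] <;> omega
    refine ⟨⟨⟨t, ?_, ?_⟩, ht⟩, ?_⟩
    · exact Fin.mk_lt_mk.2 (by omega)
    · exact Fin.mk_lt_mk.2 (by omega)
    · rw [retainedVector, coe_tripleBasis, wedge]
      congr 1
      ext p : 1
      rw [stdVec, dif_pos (hi' p)]
      fin_cases p <;> rfl
  · rintro ⟨⟨t, ht⟩, rfl⟩
    have hval : ∀ p, ![(t.1.1 + 1 : ℕ), t.1.2.1 + 1, t.1.2.2 + 1] p = tripleEntry t.1 p + 1 := by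
      intro p
      fin_cases p <;> rfl
    refine ⟨![(t.1.1 + 1 : ℕ), t.1.2.1 + 1, t.1.2.2 + 1],
      ⟨fun p q hpq => ?_, fun p => ?_⟩, ?_, ?_, ?_⟩
    · rw [hval, hval]
      exact Nat.succ_lt_succ (strictMono_tripleEntry t hpq)
    · rw [hval]
      omega
    · obtain ⟨⟨h1, h2, h3⟩, -⟩ := ht
      intro p q hpq
      fin_cases p <;> fin_cases q <;> first | exact absurd rfl hpq | skip
      exacts [h1, h2, h1.symm, h3, h2.symm, h3.symm]
    · exact fun h => ht.2 ((hmem _ _ _).1 h)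
    · rw [retainedVector, coe_tripleBasis, wedge]
      congr 1
      ext p : 1
      rw [hval, stdVec, dif_pos ⟨by omega, by omega⟩]
      rfl

lemma mem_span_retainedVector {φ : ExteriorAlgebra ℂ (V M)} (hφ : φ ∈ ⋀[ℂ]^3 (V M))
    (h : ∀ t : IncTriple M, ¬ IsRetained M t.1 → tripleCoord t.1 φ = 0) :
    φ ∈ Submodule.span ℂ (Set.range (retainedVector M)) := by
  have hsum : ((∑ t, (tripleBasis M).repr ⟨φ, hφ⟩ t • tripleBasis M t : ⋀[ℂ]^3 (V M)) :
      ExteriorAlgebra ℂ (V M)) = φ := congrArg Subtype.val ((tripleBasis M).sum_repr ⟨φ, hφ⟩)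
  suffices h : ((∑ t, (tripleBasis M).repr ⟨φ, hφ⟩ t • tripleBasis M t : ⋀[ℂ]^3 (V M)) :
      ExteriorAlgebra ℂ (V M)) ∈ Submodule.span ℂ (Set.range (retainedVector M)) by
    rwa [hsum] at h
  rw [Submodule.coe_sum]
  refine Submodule.sum_mem _ fun t _ => ?_
  rw [Submodule.coe_smul, tripleBasis_repr]
  by_cases ht : IsRetained M t.1
  · exact Submodule.smul_mem _ _ (Submodule.subset_span ⟨⟨t, ht⟩, rfl⟩)
  · rw [h t ht, zero_smul]
    exact Submodule.zero_mem _

lemma universal_and_finrank_of_coeff_ne_zero (hM : 7 ≤ M) [NeZero M]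
    (T : List (Fin M × Fin M × Fin M))
    (hcard : T.length + Fintype.card {p : Fin M × Fin M // p.1 < p.2} = M * (M - 1))
    (hc : (trinomialProd T * ∏ p : {p : Fin M × Fin M // p.1 < p.2},
      (MvPolynomial.X p.1.2 - MvPolynomial.X p.1.1)).coeff
        (Finsupp.equivFunOnFinite.symm fun _ => M - 1) ≠ 0)
    (hT : ∀ a b c : Fin M, a < b → b < c → ¬ IsRetained M (a, b, c) →
      (a, b, c) ∈ T ∨ (a, c, b) ∈ T ∨ (b, c, a) ∈ T)
    {E : Set (ℕ × ℕ × ℕ)}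
    (hE : E = {t | t = (1, 4, M) ∨ t = (2, 5, M) ∨
      ∃ i : ℕ, 1 ≤ i ∧ i ≤ M - 3 ∧ t = (i, i + 2, M)})
    {W : Submodule ℂ (ExteriorAlgebra ℂ (V M))}
    (hW : W = Submodule.span ℂ
      {x | ∃ i : Fin 3 → ℕ, IsBasisIndex M 3 i ∧ SingleOcc 3 i ∧
        (i 0, i 1, i 2) ∉ E ∧ x = wedge M 3 i}) :
    (∀ ψ ∈ ⋀[ℂ]^3 (V M), ∃ U : V M ≃ₗᵢ[ℂ] V M, luMap M U ψ ∈ W) ∧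
      Module.finrank ℂ W = Fintype.card {t : IncTriple M // IsRetained M t.1} := by
  rw [hW, setOf_wedge_eq_range hM hE]
  refine ⟨fun ψ hψ => ?_, finrank_span_eq_card linearIndependent_retainedVector⟩
  obtain ⟨U, hU⟩ := exists_unitary_rowForm_eq_zero T hcard hc hψ
  have hφ : luMap M U ψ ∈ ⋀[ℂ]^3 (V M) := map_mem_exteriorPower _ hψ
  refine ⟨U, mem_span_retainedVector hφ ?_⟩
  rintro ⟨⟨a, b, c⟩, hab, hbc⟩ ht
  rcases hT a b c hab hbc ht with h | h | h
  · exact hU _ h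
  · refine tripleCoord_eq_zero_of_perm (Equiv.swap 1 2) ?_ hφ (hU _ h)
    ext p
    fin_cases p <;> rfl
  · refine tripleCoord_eq_zero_of_perm (finRotate 3) ?_ hφ (hU _ h)
    ext p
    fin_cases p <;> rfl

end UniversalSubspace

/-- For `M ∈ {7, 9, 11}`, the subspace spanned by all BSOVs
`e_{ijk}` except the `M-1` of them with index triples `(1,4,M)`, `(2,5,M)` and
`(i, i+2, M)` for `1 ≤ i ≤ M-3` is universal and has dimension
`M(M-1)(M-5)/6`. -/
theorem minimal_universal_subspace_odd (M : ℕ) (hM : M = 7 ∨ M = 9 ∨ M = 11)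
    (E : Set (ℕ × ℕ × ℕ))
    (hE : E = {t | t = (1, 4, M) ∨ t = (2, 5, M) ∨
      ∃ i : ℕ, 1 ≤ i ∧ i ≤ M - 3 ∧ t = (i, i + 2, M)})
    (W : Submodule ℂ (ExteriorAlgebra ℂ (V M)))
    (hW : W = Submodule.span ℂ
      {x | ∃ i : Fin 3 → ℕ, IsBasisIndex M 3 i ∧ SingleOcc 3 i ∧
        (i 0, i 1, i 2) ∉ E ∧ x = wedge M 3 i}) :
    (∀ ψ ∈ ⋀[ℂ]^3 (V M), ∃ U : V M ≃ₗᵢ[ℂ] V M, luMap M U ψ ∈ W) ∧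
      Module.finrank ℂ W = M * (M - 1) * (M - 5) / 6 := by
  rcases hM with rfl | rfl | rfl
  · have h := universal_and_finrank_of_coeff_ne_zero (by norm_num)
      (factorTriples 7 0 (missingFactors 3)) (by decide +kernel)
      (by rw [coeff_missingFactors_seven]; norm_num) (by decide +kernel) hE hW
    exact ⟨h.1, h.2.trans (by decide +kernel)⟩
  · have h := universal_and_finrank_of_coeff_ne_zero (by norm_num)
      (factorTriples 9 0 (missingFactors 4)) (by decide +kernel)
      (by rw [coeff_missingFactors_nine]; norm_num) (by decide +kernel) hE hW
    exact ⟨h.1, h.2.trans (by decide +kernel)⟩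
  · have h := universal_and_finrank_of_coeff_ne_zero (by norm_num)
      (factorTriples 11 0 (missingFactors 5)) (by decide +kernel)
      (by rw [coeff_missingFactors_eleven]; norm_num) (by decide +kernel) hE hW
    exact ⟨h.1, h.2.trans (by decide +kernel)⟩
end
end

section
/- Let M and N be integers with M ≥ 2N ≥ 8, and let V be a complex inner product space of dimension M with a fixed orthonormal basis e_1, …, e_M. Then there exists ψ ∈ ⋀^N V such that for every invertible linear operator A on V one has (⋀^N A) ψ ∉ 𝒮; in particular ψ is not LU-equivalent to any single occupancy vector. -/
open ExteriorAlgebra Finset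

noncomputable section

open MvPolynomial in
/-- Finitely many polynomial maps into `K ^ ι`, each in fewer than `#ι` variables, do not jointly
cover `K ^ ι`. -/
theorem exists_notMem_range_polynomial_maps {K : Type} [Field K] [Infinite K]
    {ι J : Type} [Fintype ι] [Fintype J] (σ : J → Type) [∀ j, Fintype (σ j)]
    (hσ : ∀ j, Fintype.card (σ j) < Fintype.card ι) (F : ∀ j, ι → MvPolynomial (σ j) K) :
    ∃ x : ι → K, ∀ j (z : σ j → K), x ≠ fun i => eval z (F j i) := by
  have h : ∀ j, ∃ P : MvPolynomial ι K, aeval (F j) P = 0 ∧ P ≠ 0 := by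
    intro j
    by_contra! hP
    have hind : AlgebraicIndependent K (F j) := algebraicIndependent_iff.2 hP
    have hle := hind.cardinalMk_le_trdeg
    rw [MvPolynomial.trdeg_of_isDomain] at hle
    simp only [Cardinal.mk_fintype, Cardinal.lift_natCast, Nat.cast_le] at hle
    exact absurd hle (not_le.2 (hσ j))
  choose P hP hP0 using h
  have hprod : ∏ j, P j ≠ 0 := Finset.prod_ne_zero_iff.2 fun j _ => hP0 j
  obtain ⟨x, hx⟩ : ∃ x, eval x (∏ j, P j) ≠ 0 := by
    by_contra! hx
    exact hprod (MvPolynomial.funext fun x => by rw [hx x, map_zero])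
  refine ⟨x, fun j z hxz => hx ?_⟩
  rw [map_prod]
  refine Finset.prod_eq_zero (Finset.mem_univ j) ?_
  have := congrArg (eval z) (hP j)
  rw [map_zero, aeval_def, hom_eval₂] at this
  rw [hxz, ← this, eval, coe_eval₂Hom]
  congr 1
  ext r
  simp

section Shear

variable {K E I : Type*} [Field K] [AddCommGroup E] [Module K E]

/-- The span of the `N`-fold wedge products all of whose factors except possibly the first lie
in `W`. -/
def tailSpan (N : ℕ) (W : Submodule K E) : Submodule K (⋀[K]^N E) :=
  Submodule.span K
    {x | ∃ v : Fin N → E, (∀ j, 0 < j.val → v j ∈ W) ∧ x = exteriorPower.ιMulti K N v}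

theorem map_mem_tailSpan {N : ℕ} {W W' : Submodule K E} {g : E →ₗ[K] E}
    (hg : ∀ w ∈ W, g w ∈ W') {x : ⋀[K]^N E} (hx : x ∈ tailSpan N W) :
    exteriorPower.map N g x ∈ tailSpan N W' := by
  suffices tailSpan N W ≤ (tailSpan N W').comap (exteriorPower.map N g) from this hx
  refine Submodule.span_le.2 ?_
  rintro _ ⟨v, hv, rfl⟩
  refine Submodule.subset_span ⟨g ∘ v, fun j hj => hg _ (hv j hj), ?_⟩
  rw [exteriorPower.map_apply_ιMulti]

theorem coe_exteriorPower_map (N : ℕ) (g : E →ₗ[K] E) (x : ⋀[K]^N E) :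
    (exteriorPower.map N g x : ExteriorAlgebra K E) = ExteriorAlgebra.map g x := by
  have : (⋀[K]^N E).subtype ∘ₗ exteriorPower.map N g =
      (ExteriorAlgebra.map g).toLinearMap ∘ₗ (⋀[K]^N E).subtype := by
    apply exteriorPower.linearMap_ext
    ext v
    simp [exteriorPower.map_apply_ιMulti, ExteriorAlgebra.map_apply_ιMulti]
  exact LinearMap.congr_fun this x

/-- A matrix with two columns vanishing outside a single row has zero determinant. -/
theorem det_eq_zero_of_two_columns {R : Type*} [CommRing R] {n : Type*} [Fintype n]
    [DecidableEq n] (A : Matrix n n R) (r : n → Prop) (hr : ∀ i j, ¬ r i → ¬ r j → i = j)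
    {c d : n} (hcd : c ≠ d) (hc : ∀ i, r i → A i c = 0) (hd : ∀ i, r i → A i d = 0) :
    A.det = 0 := by
  rw [Matrix.det_apply]
  refine Finset.sum_eq_zero fun τ _ => ?_
  by_cases h : r (τ c)
  · rw [Finset.prod_eq_zero (f := fun i => A (τ i) i) (Finset.mem_univ c) (hc _ h), smul_zero]
  · have h' : r (τ d) := by
      by_contra h'
      exact hcd (τ.injective (hr _ _ h h'))
    rw [Finset.prod_eq_zero (f := fun i => A (τ i) i) (Finset.mem_univ d)
      (hd _ h'), smul_zero]

/-- The vectors whose `p`-th and `q`-th coordinates vanish. -/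
def coordKer (b : Module.Basis I K E) (p q : I) : Submodule K E :=
  LinearMap.ker (b.coord p) ⊓ LinearMap.ker (b.coord q)

/-- The map adding to each vector its value under `f` times `x` and its value under `g`
times `y`. -/
def doubleShear (f g : Module.Dual K E) (x y : E) : E →ₗ[K] E :=
  LinearMap.id + f.smulRight x + g.smulRight y

theorem doubleShear_apply (f g : Module.Dual K E) (x y v : E) :
    doubleShear f g x y v = v + f v • x + g v • y := by
  simp [doubleShear]

theorem doubleShear_comp_neg {f g : Module.Dual K E} {x y : E} (hfx : f x = 0) (hfy : f y = 0)
    (hgx : g x = 0) (hgy : g y = 0) :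
    doubleShear f g x y ∘ₗ doubleShear (-f) (-g) x y = LinearMap.id := by
  ext v
  simp only [LinearMap.comp_apply, doubleShear_apply, map_add, map_smul, hfx, hfy, hgx, hgy,
    LinearMap.neg_apply, LinearMap.id_apply]
  module

/-- If `f` and `g` are linear forms with `g ≠ 0`, and `f u = 1`, `g u = 0` for some `u`, then some
double shear along two basis vectors carries their common kernel into the corresponding coordinate
subspace. -/
theorem exists_doubleShear_mem_coordKer (b : Module.Basis I K E)
    (f g : Module.Dual K E) {u : E} (hfu : f u = 1) (hgu : g u = 0) (hg0 : g ≠ 0) :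
    ∃ p q : I, p ≠ q ∧ ∃ α β : Module.Dual K E, α (b p) = 0 ∧ α (b q) = 0 ∧ β (b p) = 0 ∧
      β (b q) = 0 ∧ ∀ v, f v = 0 → g v = 0 →
        doubleShear (-α) (-β) (b p) (b q) v ∈ coordKer b p q := by
  obtain ⟨p, q, hd⟩ : ∃ p q, f (b p) * g (b q) - f (b q) * g (b p) ≠ 0 := by
    by_contra! h
    have h1 : ∀ q, f (b q) • g = g (b q) • f := fun q => b.ext fun p => by
      simp only [LinearMap.smul_apply, smul_eq_mul]
      linear_combination - h p q
    refine hg0 (b.ext fun q => by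
      have := LinearMap.congr_fun (h1 q) u
      simp only [LinearMap.smul_apply, smul_eq_mul, hfu, hgu] at this
      simpa using this.symm)
  have hpq : p ≠ q := by
    rintro rfl
    exact hd (sub_self _)
  set d := f (b p) * g (b q) - f (b q) * g (b p) with hd'
  refine ⟨p, q, hpq, b.coord p - d⁻¹ • (g (b q) • f - f (b q) • g),
    b.coord q - d⁻¹ • (f (b p) • g - g (b p) • f), ?_, ?_, ?_, ?_, fun v hf hg => ?_⟩
  · simp only [LinearMap.sub_apply, LinearMap.smul_apply, Module.Basis.coord_apply,
      Module.Basis.repr_self, Finsupp.single_eq_same, smul_eq_mul]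
    field_simp
    rw [hd']
    ring
  · simp only [LinearMap.sub_apply, LinearMap.smul_apply, Module.Basis.coord_apply,
      Module.Basis.repr_self, Finsupp.single_eq_of_ne hpq, smul_eq_mul]
    ring
  · simp only [LinearMap.sub_apply, LinearMap.smul_apply, Module.Basis.coord_apply,
      Module.Basis.repr_self, Finsupp.single_eq_of_ne hpq.symm, smul_eq_mul]
    ring
  · simp only [LinearMap.sub_apply, LinearMap.smul_apply, Module.Basis.coord_apply,
      Module.Basis.repr_self, Finsupp.single_eq_same, smul_eq_mul]
    field_simp
    rw [hd']
    ring
  · simp [coordKer, doubleShear_apply, hf, hg, Finsupp.single_eq_of_ne hpq,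
      Finsupp.single_eq_of_ne hpq.symm]

variable [LinearOrder I]

theorem repr_eq_zero_of_mem_tailSpan {N : ℕ} (b : Module.Basis I K E) {p q : I} (hpq : p ≠ q)
    {x : ⋀[K]^N E} (hx : x ∈ tailSpan N (coordKer b p q)) (s : Set.powersetCard I N)
    (hp : p ∈ s) (hq : q ∈ s) : (b.exteriorPower N).repr x s = 0 := by
  rw [exteriorPower.basis_repr_apply]
  suffices tailSpan N (coordKer b p q) ≤ LinearMap.ker (exteriorPower.ιMultiDual K N b s) from
    this hx
  refine Submodule.span_le.2 ?_
  rintro _ ⟨v, hv, rfl⟩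
  obtain ⟨c, rfl⟩ := (Set.powersetCard.mem_range_ofFinEmbEquiv_symm_iff_mem s p).mpr hp
  obtain ⟨d, rfl⟩ := (Set.powersetCard.mem_range_ofFinEmbEquiv_symm_iff_mem s q).mpr hq
  rw [SetLike.mem_coe, LinearMap.mem_ker, exteriorPower.ιMultiDual_apply_ιMulti]
  refine det_eq_zero_of_two_columns _ (fun i => 0 < i.val) (fun i j hi hj => Fin.ext (by omega))
    (c := c) (d := d) (fun h => hpq (by rw [h])) (fun i hi => ?_) (fun i hi => ?_)
  · exact (hv i hi).1
  · exact (hv i hi).2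

/-- The variables parametrizing the double shears of the vectors of `⋀[K]^N E` none of whose basis
components involves both `p` and `q`. -/
abbrev ShearVar (I : Type*) (N : ℕ) (p q : I) : Type _ :=
  ({r : I // r ≠ p ∧ r ≠ q} × Bool) ⊕ {s : Set.powersetCard I N // ¬ (p ∈ s.1 ∧ q ∈ s.1)}

open MvPolynomial in
/-- The value at the basis vector indexed by `s` of the generic linear form vanishing at those
indexed by `p` and `q`. -/
def genericForm (K : Type*) [Field K] (N : ℕ) (p q : I) (ε : Bool) (s : I) :
    MvPolynomial (ShearVar I N p q) K :=
  if h : s ≠ p ∧ s ≠ q then X (Sum.inl (⟨s, h⟩, ε)) else 0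

open MvPolynomial in
/-- The matrix entries of the generic double shear. -/
def genericShear (K : Type*) [Field K] (N : ℕ) (p q : I) (t s : I) :
    MvPolynomial (ShearVar I N p q) K :=
  (if t = s then 1 else 0) + (if t = p then genericForm K N p q true s else 0) +
    (if t = q then genericForm K N p q false s else 0)

open MvPolynomial in
/-- The coordinates of the generic double shear of a generic vector none of whose basis components
involves both `p` and `q`. -/
def genericCoord (K : Type*) [Field K] [Fintype I] (N : ℕ) (p q : I) (T : Set.powersetCard I N) :
    MvPolynomial (ShearVar I N p q) K :=
  ∑ S : {s : Set.powersetCard I N // ¬ (p ∈ s.1 ∧ q ∈ s.1)}, X (Sum.inr S) *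
    (Matrix.of fun i j => genericShear K N p q (Set.powersetCard.ofFinEmbEquiv.symm T j)
      (Set.powersetCard.ofFinEmbEquiv.symm S.1 i)).det

open MvPolynomial in
theorem exists_eval_genericCoord [Fintype I] {N : ℕ} (b : Module.Basis I K E) {p q : I}
    {α β : Module.Dual K E} (hαp : α (b p) = 0) (hαq : α (b q) = 0) (hβp : β (b p) = 0)
    (hβq : β (b q) = 0) {y : ⋀[K]^N E}
    (hy : ∀ s, p ∈ s → q ∈ s → (b.exteriorPower N).repr y s = 0) :
    ∃ z, ∀ T, eval z (genericCoord K N p q T) =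
      (b.exteriorPower N).repr (exteriorPower.map N (doubleShear α β (b p) (b q)) y) T := by
  let z : ShearVar I N p q → K := Sum.elim
    (fun r => if r.2 then α (b r.1) else β (b r.1)) (fun S => (b.exteriorPower N).repr y S)
  have hform : ∀ ε s, eval z (genericForm K N p q ε s) = if ε then α (b s) else β (b s) := by
    intro ε s
    unfold genericForm
    split_ifs with h hε hε
    · simp [z, hε]
    · simp [z, hε]
    all_goals
      obtain rfl | rfl : s = p ∨ s = q := by tauto
      all_goals simp [*]
  have hshear : ∀ t s, eval z (genericShear K N p q t s) =
      b.coord t (doubleShear α β (b p) (b q) (b s)) := by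
    intro t s
    simp only [genericShear, map_add, apply_ite (eval z), map_one, map_zero, hform,
      doubleShear_apply, Module.Basis.coord_apply, map_smul, Module.Basis.repr_self,
      Finsupp.single_apply, eq_comm (a := t)]
    simp
  refine ⟨z, fun T => ?_⟩
  conv_rhs => rw [← (b.exteriorPower N).sum_repr y]
  rw [exteriorPower.basis_repr_apply, map_sum, map_sum, genericCoord, map_sum]
  rw [← Fintype.sum_subtype_add_sum_subtype (fun s : Set.powersetCard I N => ¬ (p ∈ s.1 ∧ q ∈ s.1))]
  rw [Fintype.sum_eq_zero (fun s : {s : Set.powersetCard I N // ¬ ¬ (p ∈ s.1 ∧ q ∈ s.1)} => _),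
    add_zero]
  · refine Finset.sum_congr rfl fun S _ => ?_
    rw [map_mul, eval_X, RingHom.map_det, map_smul, map_smul, smul_eq_mul,
      exteriorPower.basis_apply, exteriorPower.map_apply_ιMulti_family,
      exteriorPower.ιMulti_family, exteriorPower.ιMultiDual_apply_ιMulti]
    congr 2
    ext i j
    simp only [RingHom.mapMatrix_apply, Matrix.map_apply, Matrix.of_apply, hshear,
      Function.comp_apply]
  · rintro ⟨s, hs⟩
    rw [not_not] at hs
    rw [hy s hs.1 hs.2, zero_smul, map_zero, map_zero]

theorem two_mul_lt_choose {m k : ℕ} (hk : 2 ≤ k) (hm : 2 * k ≤ m) (hm6 : 6 ≤ m) :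
    2 * m < m.choose k := by
  have h : m.choose 2 ≤ m.choose k := by
    induction k, hk using Nat.le_induction with
    | base => rfl
    | succ k hk ih =>
      exact (ih (by omega)).trans (Nat.choose_le_succ_of_lt_half_left (by omega))
  refine lt_of_lt_of_le ?_ h
  rw [Nat.choose_two_right, Nat.lt_iff_add_one_le, Nat.le_div_iff_mul_le (by norm_num)]
  obtain ⟨c, rfl⟩ := Nat.exists_eq_add_of_le hm6
  have : 6 + c - 1 = c + 5 := by omega
  rw [this]
  nlinarith

theorem card_shearVar_lt [Fintype I] {N : ℕ} (hN : 4 ≤ N) (hI : 2 * N ≤ Fintype.card I) {p q : I}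
    (hpq : p ≠ q) : Fintype.card (ShearVar I N p q) < Fintype.card (Set.powersetCard I N) := by
  have h1 : Fintype.card {r : I // r ≠ p ∧ r ≠ q} = Fintype.card I - 2 := by
    rw [Fintype.card_subtype, ← Finset.card_pair hpq, ← Finset.card_compl]
    congr 1
    ext r
    simp
  have h2 : Fintype.card {s : Set.powersetCard I N // p ∈ s.1 ∧ q ∈ s.1} =
      (Fintype.card I - 2).choose (N - 2) := by
    have h := Finset.card_filter_powersetCard_subset {p, q} (Finset.univ : Finset I) N
      (Finset.subset_univ _) (by rw [Finset.card_pair hpq]; omega)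
    rw [Finset.card_pair hpq, Finset.card_univ] at h
    rw [← h, Fintype.card_subtype]
    refine Finset.card_bij (fun s _ => s.1) ?_ ?_ ?_
    · intro s hs
      simpa [Finset.insert_subset_iff, s.2] using hs
    · intro s _ t _ hst
      exact Subtype.ext hst
    · intro s hs
      simp only [Finset.mem_filter, Finset.mem_powersetCard, Finset.insert_subset_iff,
        Finset.singleton_subset_iff] at hs
      exact ⟨⟨s, hs.1.2⟩, by simpa using hs.2, rfl⟩
  have h3 := Fintype.card_subtype_compl (fun s : Set.powersetCard I N => p ∈ s.1 ∧ q ∈ s.1)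
  have h4 := Fintype.card_subtype_le (fun s : Set.powersetCard I N => p ∈ s.1 ∧ q ∈ s.1)
  have h5 := two_mul_lt_choose (m := Fintype.card I - 2) (k := N - 2) (by omega) (by omega)
    (by omega)
  rw [Fintype.card_sum, Fintype.card_prod, Fintype.card_bool, h1]
  omega

end Shear

/-- For `4 ≤ N` and `2 * N ≤ #I` some vector of `⋀[K]^N E` lies in no `tailSpan N W` for
`W` the common kernel of two linearly independent linear forms. -/
theorem exists_forall_notMem_tailSpan {K E I : Type} [Field K] [Infinite K] [AddCommGroup E]
    [Module K E] [LinearOrder I] [Fintype I] (b : Module.Basis I K E) {N : ℕ} (hN : 4 ≤ N)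
    (hI : 2 * N ≤ Fintype.card I) :
    ∃ ψ : ⋀[K]^N E, ∀ (f g : Module.Dual K E) (u : E), f u = 1 → g u = 0 → g ≠ 0 →
      ψ ∉ tailSpan N (LinearMap.ker f ⊓ LinearMap.ker g) := by
  obtain ⟨x, hx⟩ := exists_notMem_range_polynomial_maps
    (J := {pq : I × I // pq.1 ≠ pq.2}) (fun pq => ShearVar I N pq.1.1 pq.1.2)
    (fun pq => card_shearVar_lt hN hI pq.2) (fun pq => genericCoord K N pq.1.1 pq.1.2)
  refine ⟨(b.exteriorPower N).equivFun.symm x, fun f g u hfu hgu hg0 hψ => ?_⟩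
  set ψ := (b.exteriorPower N).equivFun.symm x with hψ'
  obtain ⟨p, q, hpq, α, β, hαp, hαq, hβp, hβq, hker⟩ :=
    exists_doubleShear_mem_coordKer b f g hfu hgu hg0
  have hy := map_mem_tailSpan (g := doubleShear (-α) (-β) (b p) (b q))
    (W := LinearMap.ker f ⊓ LinearMap.ker g) (W' := coordKer b p q)
    (fun v hv => hker v hv.1 hv.2) hψ
  obtain ⟨z, hz⟩ := exists_eval_genericCoord b hαp hαq hβp hβq
    (fun s hp hq => repr_eq_zero_of_mem_tailSpan b hpq hy s hp hq)
  refine hx ⟨(p, q), hpq⟩ z (funext fun T => ?_)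
  rw [hz T, ← LinearMap.comp_apply, ← exteriorPower.map_comp,
    doubleShear_comp_neg hαp hαq hβp hβq, exteriorPower.map_id, LinearMap.id_apply,
    ← Module.Basis.equivFun_apply, hψ', LinearEquiv.apply_symm_apply]

/-- In a single occupancy vector, all factors but the first avoid `e₁` and `e₂`. -/
theorem sov_le_map_tailSpan {M N : ℕ} (f g : Module.Dual ℂ (V M))
    (hf : ∀ n, 3 ≤ n → f (stdVec M n) = 0) (hg : ∀ n, 3 ≤ n → g (stdVec M n) = 0) :
    SOV M N ≤ (tailSpan N (LinearMap.ker f ⊓ LinearMap.ker g)).map (⋀[ℂ]^N (V M)).subtype := by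
  refine Submodule.span_le.2 ?_
  rintro _ ⟨i, ⟨hmono, hi⟩, hocc, rfl⟩
  refine ⟨exteriorPower.ιMulti ℂ N fun j => stdVec M (i j), Submodule.subset_span
    ⟨_, fun j hj => ?_, rfl⟩, rfl⟩
  have h3 : 3 ≤ i j := by
    have hlt : (⟨0, hj.trans j.2⟩ : Fin N) < j := hj
    have h0 := hocc _ _ hlt.ne
    have h1 := hmono hlt
    have h2 := (hi ⟨0, hj.trans j.2⟩).1
    omega
  exact ⟨hf _ h3, hg _ h3⟩

/-- For `M ≥ 2N ≥ 8` there exists `ψ ∈ ⋀^N V` such that for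
every invertible linear operator `A` on `V`, `(⋀^N A) ψ` is not a single
occupancy vector; in particular `ψ` is not LU-equivalent to any SOV. -/
theorem sov_not_universal (M N : ℕ) (hN : 4 ≤ N) (hM : 2 * N ≤ M) :
    ∃ ψ ∈ ⋀[ℂ]^N (V M), ∀ A : V M ≃ₗ[ℂ] V M,
      ExteriorAlgebra.map (A : V M →ₗ[ℂ] V M) ψ ∉ SOV M N := by
  obtain ⟨ψ, hψ⟩ := exists_forall_notMem_tailSpan
    (EuclideanSpace.basisFun (Fin M) ℂ).toBasis hN (by simpa using hM)
  refine ⟨ψ, ψ.2, fun A hA => ?_⟩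
  let c : Fin M → Module.Dual ℂ (V M) := fun k => EuclideanSpace.projₗ k
  have hc : ∀ (k : Fin M) (n : ℕ), k.val + 2 ≤ n → c k (stdVec M n) = 0 := by
    intro k n hn
    unfold stdVec
    split_ifs
    · have : k ≠ ⟨n - 1, by omega⟩ := fun h => by
        have := congrArg Fin.val h
        simp only at this
        omega
      simp [c, this]
    · simp
  obtain ⟨y, hy, hyA⟩ := sov_le_map_tailSpan (N := N) (c ⟨0, by omega⟩) (c ⟨1, by omega⟩)
    (fun n hn => hc _ n (by simp only; omega)) (fun n hn => hc _ n hn) hA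
  have hyψ : exteriorPower.map N (A : V M →ₗ[ℂ] V M) ψ = y := by
    apply Subtype.ext
    rw [coe_exteriorPower_map, ← hyA, Submodule.subtype_apply]
  have hψy : exteriorPower.map N (A.symm : V M →ₗ[ℂ] V M) y = ψ := by
    rw [← hyψ, ← LinearMap.comp_apply, ← exteriorPower.map_comp, LinearEquiv.symm_comp,
      exteriorPower.map_id, LinearMap.id_apply]
  refine hψ (c ⟨0, by omega⟩ ∘ₗ A) (c ⟨1, by omega⟩ ∘ₗ A)
    (A.symm (EuclideanSpace.single ⟨0, by omega⟩ 1)) (by simp [c]) (by simp [c]) (fun h => ?_) ?_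
  · have := LinearMap.congr_fun h (A.symm (EuclideanSpace.single ⟨1, by omega⟩ 1))
    simp [c] at this
  · rw [← hψy]
    refine map_mem_tailSpan (fun v hv => ?_) hy
    simpa using hv
end
end
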